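/- Let 1 < q ≤ 2, 2 < r < 2q, and ε > 0. Suppose x ∈ ℝ⁺ and P is a finite collection of bitiles with x ∈ I_P for each P ∈ P, and P = ⋃_{T∈T} T where T is either a collection of u-overlapping trees which are td-maximal among all trees contained in P, or a properly-sorted collection of l-overlapping trees. Then for any collection of real coefficients {c_P}_{P∈P}, ‖ (Σ_{P∈P, |I_P|<2^k} c_P 1_{ω_{P_u}})_{k∈ℤ} ‖_{M^{q,*}} ≤ C_{q,r,ε} |T|^{1/q − 1/r + ε} · sup_{T∈T} ‖ Σ_{P∈T} c_P 1_{ω_{P_u}} ‖_{V^r}. -/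

import Mathlib

open MeasureTheory Set Filter
open scoped ENNReal NNReal Classical BigOperators RealInnerProductSpace

noncomputable section

/-- The binary digit of `x` in position `n+1` to the left of the point
(terminating expansion for dyadic rationals). -/
def digit (n : ℤ) (x : ℝ) : ℤ := ⌊x / 2 ^ n⌋ % 2

/-- Bitwise addition `⊕` on nonnegative reals. -/
def wXor (x y : ℝ) : ℝ := ∑' n : ℤ, (((digit n x + digit n y) % 2 : ℤ) : ℝ) * 2 ^ n

/-- The `n`-th digit of the bitwise product `x ⊗ y`. -/
def wMulDigit (n : ℤ) (x y : ℝ) : ℤ :=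
  ⌊∑' m : ℤ, ((digit (n - m) x * digit m y : ℤ) : ℝ)⌋ % 2

/-- Bitwise multiplication `⊗` on nonnegative reals. -/
def wMul (x y : ℝ) : ℝ := ∑' n : ℤ, ((wMulDigit n x y : ℤ) : ℝ) * 2 ^ n

/-- The Walsh character `e(x) = exp (i π d₋₁(x))`. -/
def walshe (x : ℝ) : ℝ := (-1 : ℝ) ^ (digit (-1) x)

/-- The Walsh–Fourier transform on `ℝ⁺`; it is involutive, so it also serves
as the inverse Walsh–Fourier transform `ˇ`. -/
def walshFT (f : ℝ → ℝ) (ξ : ℝ) : ℝ := ∫ x in Set.Ici (0 : ℝ), walshe (wMul ξ x) * f x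

/-- Lebesgue measure on `ℝ⁺`. -/
def μplus : Measure ℝ := volume.restrict (Set.Ici 0)

/-- `L^p` norm (real exponent `p`) of an `ℝ≥0∞`-valued function. -/
def lpNormE (p : ℝ) (μ : Measure ℝ) (F : ℝ → ℝ≥0∞) : ℝ≥0∞ := (∫⁻ x, F x ^ p ∂μ) ^ (1 / p)

/-- The `r`-variation norm of `m` on the domain `D`. -/
def vnorm {ι E : Type*} [LinearOrder ι] [NormedAddCommGroup E] (r : ℝ) (D : Set ι)
    (m : ι → E) : ℝ≥0∞ :=
  (⨆ ξ ∈ D, (‖m ξ‖₊ : ℝ≥0∞)) +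
    ⨆ (N : ℕ) (u : Fin (N + 1) → ι) (_ : StrictMono u) (_ : ∀ i, u i ∈ D),
      (∑ i : Fin N, (‖m (u i.succ) - m (u i.castSucc)‖₊ : ℝ≥0∞) ^ r) ^ (1 / r)

/-- The Walsh `L^q`-multiplier norm. -/
def Mq (q : ℝ) (m : ℝ → ℝ) : ℝ≥0∞ :=
  ⨆ (g : ℝ → ℝ) (_ : eLpNorm g (ENNReal.ofReal q) μplus = 1),
    eLpNorm (walshFT fun ξ => m ξ * walshFT g ξ) (ENNReal.ofReal q) μplus

/-- The Walsh `L^q`-maximal-multiplier norm of a sequence of multipliers. -/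
def Mqstar (q : ℝ) (m : ℤ → ℝ → ℝ) : ℝ≥0∞ :=
  ⨆ (g : ℝ → ℝ) (_ : eLpNorm g (ENNReal.ofReal q) μplus = 1),
    lpNormE q μplus fun x => ⨆ k : ℤ, (‖walshFT (fun ξ => m k ξ * walshFT g ξ) x‖₊ : ℝ≥0∞)

/-- The `s`-variation `L^q`-multiplier norm of a sequence of multipliers. -/
def Mqs (q s : ℝ) (m : ℤ → ℝ → ℝ) : ℝ≥0∞ :=
  ⨆ (g : ℝ → ℝ) (_ : eLpNorm g (ENNReal.ofReal q) μplus = 1),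
    lpNormE q μplus fun x =>
      vnorm s (Set.univ : Set ℤ) fun k => walshFT (fun ξ => m k ξ * walshFT g ξ) x

/-- Dyadic intervals `[n 2^k, (n+1) 2^k)`. -/
def IsDyadic (I : Set ℝ) : Prop :=
  ∃ n k : ℤ, I = Set.Ico ((n : ℝ) * 2 ^ k) (((n : ℝ) + 1) * 2 ^ k)

/-- Dyadic intervals of length `2^k`. -/
def IsDyadicLen (k : ℤ) (ω : Set ℝ) : Prop :=
  ∃ n : ℤ, ω = Set.Ico ((n : ℝ) * 2 ^ k) (((n : ℝ) + 1) * 2 ^ k)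

/-- The lower half of an interval. -/
def lowerHalf (ω : Set ℝ) : Set ℝ := ω ∩ Set.Iio ((sInf ω + sSup ω) / 2)

/-- The upper half of an interval. -/
def upperHalf (ω : Set ℝ) : Set ℝ := ω ∩ Set.Ici ((sInf ω + sSup ω) / 2)

/-- A bitile `I × ω ⊆ ℝ⁺ × ℝ⁺` : a rectangle of dyadic intervals of area `2`. -/
structure Bitile where
  I : Set ℝ
  ω : Set ℝ
  hI : IsDyadic I
  hω : IsDyadic ω
  hIsub : I ⊆ Set.Ici 0
  hωsub : ω ⊆ Set.Ici 0
  harea : volume I * volume ω = 2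

/-- The `L²`-normalized Walsh wave packet of the tile `I × ω`. -/
def wavePacket (I ω : Set ℝ) (x : ℝ) : ℝ :=
  Real.sqrt (volume I).toReal * walshFT (Set.indicator ω fun _ => (1 : ℝ)) (wXor x (sInf I))

/-- `⟨f, φ_{P_l}⟩`, the pairing of `f` with the wave packet of the lower tile of `P`. -/
def walshCoef (P : Bitile) (f : ℝ → ℝ) : ℝ :=
  ∫ y in Set.Ici (0 : ℝ), f y * wavePacket P.I (lowerHalf P.ω) y

/-- The partial order on bitiles. -/
def Bitile.le (P Q : Bitile) : Prop := P.I ⊆ Q.I ∧ Q.ω ⊆ P.ω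

/-- Convexity of a set of bitiles. -/
def ConvexBitiles (S : Set Bitile) : Prop :=
  ∀ P₁ P₂ P₃ : Bitile, P₁ ∈ S → P₃ ∈ S → Bitile.le P₁ P₂ → Bitile.le P₂ P₃ → P₂ ∈ S

/-- The truncated partial Walsh-sum operator attached to a collection `Ps` of bitiles. -/
def Sk (Ps : Set Bitile) (f : ℝ → ℝ) (k : ℤ) (ξ x : ℝ) : ℝ :=
  ∑ᶠ (P : Bitile) (_ : P ∈ Ps ∧ volume P.I < 2 ^ k),
    walshCoef P f * wavePacket P.I (lowerHalf P.ω) x *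
      Set.indicator (upperHalf P.ω) (fun _ => (1 : ℝ)) ξ

/-- The partial Walsh-sum operator `S[f](ξ,x) = (f̂ 1_{[0,ξ)})ˇ(x)`. -/
def Spartial (f : ℝ → ℝ) (ξ x : ℝ) : ℝ :=
  walshFT (fun η => Set.indicator (Set.Ico 0 ξ) (fun _ => (1 : ℝ)) η * walshFT f η) x

/-- A tree of bitiles with top data `(ξtop, Itop)`. -/
structure WTree where
  carrier : Set Bitile
  ξtop : ℝ
  Itop : Set ℝ

/-- The defining conditions of a tree. -/
def IsTree (T : WTree) : Prop :=
  IsDyadic T.Itop ∧ 0 ≤ T.ξtop ∧ ∀ P ∈ T.carrier, P.I ⊆ T.Itop ∧ T.ξtop ∈ P.ω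

/-- `u`-overlapping trees. -/
def UOverlapping (T : WTree) : Prop := ∀ P ∈ T.carrier, T.ξtop ∈ upperHalf P.ω

/-- `l`-overlapping trees. -/
def LOverlapping (T : WTree) : Prop := ∀ P ∈ T.carrier, T.ξtop ∈ lowerHalf P.ω

/-- `T` is td-maximal among the trees in `Cc` : maximal with respect to inclusion among
trees in `Cc` with the same top data. -/
def TdMaximalAmong (T : WTree) (Cc : Set WTree) : Prop :=
  T ∈ Cc ∧ ∀ T' ∈ Cc, T'.ξtop = T.ξtop → T'.Itop = T.Itop →
    T.carrier ⊆ T'.carrier → T'.carrier ⊆ T.carrier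

/-- Order on the lower tiles of two bitiles. -/
def lowerLE (P Q : Bitile) : Prop := P.I ⊆ Q.I ∧ lowerHalf Q.ω ⊆ lowerHalf P.ω

/-- Strict order on the lower tiles of two bitiles. -/
def lowerLT (P Q : Bitile) : Prop := lowerLE P Q ∧ ¬ lowerLE Q P

/-- `l`-convexity of a set of bitiles. -/
def LConvex (S : Set Bitile) : Prop :=
  ∀ P P' P'' : Bitile, P ∈ S → P'' ∈ S → lowerLT P P' → lowerLT P' P'' → P' ∈ S

/-- A properly-sorted collection of `l`-overlapping trees. -/
def ProperlySorted (Ts : Set WTree) : Prop :=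
  (∀ T ∈ Ts, IsTree T ∧ LOverlapping T ∧ LConvex T.carrier) ∧
  (∀ T ∈ Ts, ∀ T' ∈ Ts, T ≠ T' → T.carrier ∩ T'.carrier = ∅) ∧
  (∀ T ∈ Ts, ∀ P ∈ T.carrier, ∀ T' ∈ Ts, (T'.Itop ∩ P.I).Nonempty → T'.ξtop ∉ upperHalf P.ω)

/-- The multiplier `𝒟_k = Σ_{|ω| = 2^k, ω ∩ Ξ ≠ ∅} a_ω 1_ω`. -/
def Dk (a : Set ℝ → ℝ) (Ξ : Set ℝ) (k : ℤ) (ξ : ℝ) : ℝ :=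
  ∑ᶠ (ω : Set ℝ) (_ : IsDyadicLen k ω ∧ (ω ∩ Ξ).Nonempty),
    a ω * Set.indicator ω (fun _ => (1 : ℝ)) ξ

/-- The sequence `k ↦ Σ_{|ω| = 2^k} a_ω 1_ω(ξ)`. -/
def dyadicSum (a : Set ℝ → ℝ) (ξ : ℝ) (k : ℤ) : ℝ :=
  ∑ᶠ (ω : Set ℝ) (_ : IsDyadicLen k ω), a ω * Set.indicator ω (fun _ => (1 : ℝ)) ξ

/-- A tile `I × ω ⊆ ℝ⁺ × ℝ⁺` : a rectangle of dyadic intervals of area `1`. -/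
structure WTile where
  I : Set ℝ
  ω : Set ℝ
  hI : IsDyadic I
  hω : IsDyadic ω
  hIsub : I ⊆ Set.Ici 0
  hωsub : ω ⊆ Set.Ici 0
  harea : volume I * volume ω = 1

/-- The subset of the phase plane occupied by a tile. -/
def WTile.carrier (p : WTile) : Set (ℝ × ℝ) := p.I ×ˢ p.ω

/-- The phase-plane projection `Π_S` associated to a region `S` which can be written as a
finite disjoint union of tiles (it is independent of the chosen tiling). -/
def phaseProj (S : Set (ℝ × ℝ)) (f : ℝ → ℝ) : ℝ → ℝ :=
  if h : ∃ ps : Set WTile, ps.Finite ∧ ps.PairwiseDisjoint WTile.carrier ∧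
      (⋃ p ∈ ps, p.carrier) = S then
    fun x => ∑ᶠ p ∈ h.choose,
      (∫ y in Set.Ici (0 : ℝ), f y * wavePacket p.I p.ω y) * wavePacket p.I p.ω x
  else 0

/-- The region of the phase plane occupied by a tree. -/
def treeRegion (T : WTree) : Set (ℝ × ℝ) := ⋃ P ∈ T.carrier, P.I ×ˢ P.ω

/-- `size(Ps, f) = sup_{T ⊆ Ps convex tree} |I_T|^{-1/2} ‖Π_T f‖_{L²}`. -/
def size (Ps : Set Bitile) (f : ℝ → ℝ) : ℝ≥0∞ :=
  ⨆ (T : WTree) (_ : IsTree T ∧ ConvexBitiles T.carrier ∧ T.carrier ⊆ Ps),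
    (volume T.Itop ^ (1 / 2 : ℝ))⁻¹ * eLpNorm (phaseProj (treeRegion T) f) 2 μplus


namespace SMM

/-- Congruence for `ite` with arbitrary decidability instances. -/
lemma ite_ext {p q : Prop} (ip : Decidable p) (iq : Decidable q) (h : p ↔ q) (a b : ℝ) :
    (@ite ℝ p ip a b) = @ite ℝ q iq a b := by
  by_cases hp : p
  · rw [if_pos hp, if_pos (h.1 hp)]
  · rw [if_neg hp, if_neg (fun hq => hp (h.2 hq))]

/-! ### Finite Walsh analysis -/

/-- The sign attached to a pair of digits. -/
def sg (a b : Bool) : ℝ := if (a && b) then -1 else 1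

/-- Walsh characters of the finite model. -/
def chi {n : ℕ} (ξ x : Fin n → Bool) : ℝ := ∏ i, sg (ξ i) (x i)

lemma sg_comm (a b : Bool) : sg a b = sg b a := by cases a <;> cases b <;> rfl

lemma chi_comm {n : ℕ} (ξ x : Fin n → Bool) : chi ξ x = chi x ξ := by
  unfold chi; exact Finset.prod_congr rfl fun i _ => sg_comm _ _

lemma sg_sq (a b : Bool) : sg a b * sg a b = 1 := by
  cases a <;> cases b <;> simp [sg]

lemma chi_mul_self {n : ℕ} (ξ x : Fin n → Bool) : chi ξ x * chi ξ x = 1 := by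
  unfold chi; rw [← Finset.prod_mul_distrib]
  exact Finset.prod_eq_one fun i _ => sg_sq _ _

lemma chi_sq {n : ℕ} (ξ x : Fin n → Bool) : chi ξ x ^ 2 = 1 := by
  rw [sq, chi_mul_self]

lemma abs_chi {n : ℕ} (ξ x : Fin n → Bool) : |chi ξ x| = 1 := by
  have h := chi_sq ξ x
  rw [← sq_abs] at h
  have := abs_nonneg (chi ξ x)
  nlinarith

/-- Basic orthogonality: sum over characters which agree with `η` off `p`. -/
lemma orth_gen {n : ℕ} (p : Fin n → Prop) (c : ℕ)
    (hc : (Finset.univ.filter p).card = c) (η x y : Fin n → Bool) :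
    (∑ ξ : Fin n → Bool, if (∀ i, ¬ p i → ξ i = η i) then chi ξ x * chi ξ y else 0) =
      if (∀ i, p i → x i = y i) then
        (2 : ℝ) ^ c * (chi η x * chi η y) else 0 := by
  subst hc
  have h1 : ∀ ξ : Fin n → Bool,
      (if (∀ i, ¬ p i → ξ i = η i) then chi ξ x * chi ξ y else 0) =
      ∏ i, ((if (¬ p i → ξ i = η i) then 1 else 0) * (sg (ξ i) (x i) * sg (ξ i) (y i))) := by
    intro ξ
    rw [Finset.prod_mul_distrib, Finset.prod_mul_distrib]
    by_cases h : ∀ i, ¬ p i → ξ i = η i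
    · rw [if_pos h, Finset.prod_eq_one, one_mul]; rfl
      intro i _; rw [if_pos (h i)]
    · rw [if_neg h]
      push Not at h
      obtain ⟨i, hi, hi2⟩ := h
      rw [Finset.prod_eq_zero (Finset.mem_univ i), zero_mul]
      rw [if_neg]; intro h; exact hi2 (h hi)
  rw [Finset.sum_congr rfl fun ξ _ => h1 ξ]
  have h2 := Finset.prod_univ_sum (fun _ : Fin n => (Finset.univ : Finset Bool))
    (fun i b => (if (¬ p i → b = η i) then (1:ℝ) else 0) * (sg b (x i) * sg b (y i)))
  rw [Fintype.piFinset_univ] at h2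
  rw [← h2]
  have h3 : ∀ i, (∑ b : Bool, (if (¬ p i → b = η i) then (1:ℝ) else 0) *
      (sg b (x i) * sg b (y i))) =
      (if (p i → x i = y i) then 1 else 0) * ((if p i then 2 else 1) *
        (sg (η i) (x i) * sg (η i) (y i))) := by
    intro i
    rw [Fintype.sum_bool]
    by_cases hp : p i
    · simp only [hp, not_true_eq_false, false_imp_iff, if_true, true_imp_iff]
      generalize x i = a; generalize y i = b; generalize η i = c
      cases a <;> cases b <;> cases c <;> norm_num [sg]
    · simp only [hp, not_false_eq_true, false_imp_iff, if_true, true_imp_iff, if_false]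
      generalize x i = a; generalize y i = b; generalize η i = c
      cases a <;> cases b <;> cases c <;> norm_num [sg]
  rw [Finset.prod_congr rfl fun i _ => h3 i, Finset.prod_mul_distrib, Finset.prod_mul_distrib,
    Finset.prod_mul_distrib]
  by_cases h : ∀ i, p i → x i = y i
  · rw [if_pos h, Finset.prod_eq_one, one_mul]
    · rw [Finset.prod_ite, Finset.prod_const, Finset.prod_const, one_pow, mul_one]; rfl
    · intro i _; rw [if_pos (h i)]
  · rw [if_neg h]
    push Not at h
    obtain ⟨i, hi, hi2⟩ := h
    rw [Finset.prod_eq_zero (Finset.mem_univ i), zero_mul]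
    rw [if_neg]; intro h; exact hi2 (h hi)

/-- `x` and `y` lie in the same cell of level `t`. -/
def Sx {n : ℕ} (t : ℕ) (x y : Fin n → Bool) : Prop := ∀ i : Fin n, (i : ℕ) < t → x i = y i

/-- Canonical representative of the frequency class of level `t`. -/
def cls {n : ℕ} (t : ℕ) (ξ : Fin n → Bool) : Fin n → Bool :=
  fun i => if t ≤ (i : ℕ) then ξ i else false

lemma cls_eq_iff {n : ℕ} {t : ℕ} {ξ η : Fin n → Bool} :
    cls t ξ = cls t η ↔ ∀ i : Fin n, t ≤ (i : ℕ) → ξ i = η i := by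
  constructor
  · intro h i hi
    have := congrFun h i
    simpa [cls, hi] using this
  · intro h; funext i
    by_cases hi : t ≤ (i : ℕ)
    · simp [cls, hi, h i hi]
    · simp [cls, hi]

lemma cls_cls {n : ℕ} {s t : ℕ} (h : s ≤ t) (ξ : Fin n → Bool) : cls t (cls s ξ) = cls t ξ := by
  rw [cls_eq_iff]; intro i hi
  simp [cls, h.trans hi]

lemma cls_zero {n : ℕ} (ξ : Fin n → Bool) : cls 0 ξ = ξ := by funext i; simp [cls]

lemma Sx.symm {n : ℕ} {t : ℕ} {x y : Fin n → Bool} (h : Sx t x y) : Sx t y x :=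
  fun i hi => (h i hi).symm

lemma Sx_comm {n : ℕ} {t : ℕ} {x y : Fin n → Bool} : Sx t x y ↔ Sx t y x :=
  ⟨Sx.symm, Sx.symm⟩

lemma Sx.refl {n : ℕ} (t : ℕ) (x : Fin n → Bool) : Sx t x x := fun _ _ => rfl

lemma Sx.trans {n : ℕ} {t : ℕ} {x y z : Fin n → Bool} (h : Sx t x y) (h' : Sx t y z) : Sx t x z :=
  fun i hi => (h i hi).trans (h' i hi)

lemma Sx.mono {n : ℕ} {s t : ℕ} (hst : s ≤ t) {x y : Fin n → Bool} (h : Sx t x y) : Sx s x y :=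
  fun i hi => h i (hi.trans_le hst)

lemma Sx_full {n : ℕ} {x y : Fin n → Bool} : Sx n x y ↔ x = y :=
  ⟨fun h => funext fun i => h i i.2, fun h => h ▸ Sx.refl _ _⟩

lemma card_lt {n t : ℕ} (ht : t ≤ n) :
    (Finset.univ.filter fun i : Fin n => (i : ℕ) < t).card = t := by
  rw [Fin.card_filter_val_lt]; omega

lemma card_ge {n t : ℕ} (ht : t ≤ n) :
    (Finset.univ.filter fun i : Fin n => t ≤ (i : ℕ)).card = n - t := by
  have h := Finset.card_filter_add_card_filter_not (s := (Finset.univ : Finset (Fin n)))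
    (fun i : Fin n => (i : ℕ) < t)
  rw [card_lt ht] at h
  simp only [not_lt, Finset.card_univ, Fintype.card_fin] at h
  omega

lemma orth_freq {n t : ℕ} (ht : t ≤ n) (η x y : Fin n → Bool) :
    (∑ ξ : Fin n → Bool, if cls t ξ = cls t η then chi ξ x * chi ξ y else 0) =
      if Sx t x y then (2 : ℝ) ^ t * (chi η x * chi η y) else 0 := by
  have h := orth_gen (fun i : Fin n => (i : ℕ) < t) t (by convert card_lt ht) η x y
  simp only [not_lt] at h
  simp only [cls_eq_iff]
  convert h using 1
  exact ite_ext _ _ Iff.rfl _ _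

lemma orth_space {n t : ℕ} (ht : t ≤ n) (x ξ η : Fin n → Bool) :
    (∑ y : Fin n → Bool, if Sx t x y then chi ξ y * chi η y else 0) =
      if cls t ξ = cls t η then (2 : ℝ) ^ (n - t) * (chi ξ x * chi η x) else 0 := by
  have h := orth_gen (fun i : Fin n => t ≤ (i : ℕ)) (n - t) (by convert card_ge ht) x ξ η
  simp only [not_le] at h
  simp only [cls_eq_iff]
  rw [chi_comm ξ x, chi_comm η x]
  refine Eq.trans (Finset.sum_congr rfl fun y _ => ?_) (h.trans (ite_ext _ _ Iff.rfl _ _))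
  rw [chi_comm ξ y, chi_comm η y]
  exact ite_ext _ _ Sx_comm _ _

/-- Walsh transform. -/
def hat {n : ℕ} (f : (Fin n → Bool) → ℝ) (ξ : Fin n → Bool) : ℝ := ∑ y, chi ξ y * f y

/-- Walsh multiplier. -/
def Tm {n : ℕ} (m f : (Fin n → Bool) → ℝ) (x : Fin n → Bool) : ℝ :=
  ((2 : ℝ) ^ n)⁻¹ * ∑ ξ, m ξ * chi ξ x * hat f ξ

lemma orth_full {n : ℕ} (x y : Fin n → Bool) :
    (∑ ξ : Fin n → Bool, chi ξ x * chi ξ y) = if x = y then (2 : ℝ) ^ n else 0 := by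
  have h := orth_freq (le_refl n) (fun _ => false) x y
  have h2 : ∀ ξ : Fin n → Bool, cls n ξ = cls n (fun _ => false) := by
    intro ξ; rw [cls_eq_iff]; intro i hi; exact absurd i.2 (not_lt.2 hi)
  simp only [h2, if_true, Sx_full] at h
  rw [h]
  split_ifs with hxy
  · subst hxy; rw [chi_mul_self, mul_one]
  · rfl

lemma hat_Tm {n : ℕ} (m f : (Fin n → Bool) → ℝ) (ξ : Fin n → Bool) :
    hat (Tm m f) ξ = m ξ * hat f ξ := by
  have : hat (Tm m f) ξ = ((2 : ℝ) ^ n)⁻¹ * ∑ η, m η * hat f η * ∑ y, chi y ξ * chi y η := by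
    rw [hat]
    unfold Tm
    generalize hat f = F
    simp only [Finset.mul_sum]
    rw [Finset.sum_comm]
    refine Finset.sum_congr rfl fun η _ => ?_
    refine Finset.sum_congr rfl fun y _ => ?_
    rw [chi_comm y ξ, chi_comm y η]; ring
  rw [this]
  simp only [orth_full, mul_ite, mul_zero, Finset.sum_ite_eq, Finset.mem_univ, if_true]
  field_simp

lemma plancherel {n : ℕ} (f : (Fin n → Bool) → ℝ) :
    ∑ ξ, hat f ξ ^ 2 = (2 : ℝ) ^ n * ∑ x, f x ^ 2 := by
  have : ∀ ξ, hat f ξ ^ 2 = ∑ x, ∑ y, f x * f y * (chi ξ x * chi ξ y) := by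
    intro ξ; rw [sq]; unfold hat; rw [Finset.sum_mul_sum]
    refine Finset.sum_congr rfl fun x _ => Finset.sum_congr rfl fun y _ => ?_
    ring
  simp only [this]
  rw [Finset.sum_comm, Finset.mul_sum]
  refine Finset.sum_congr rfl fun x _ => ?_
  rw [Finset.sum_comm]
  simp only [← Finset.mul_sum, orth_full, mul_ite, mul_zero, Finset.sum_ite_eq, Finset.mem_univ,
    if_true]
  ring

lemma Tm_sq {n : ℕ} (m f : (Fin n → Bool) → ℝ) :
    ∑ x, Tm m f x ^ 2 = ((2 : ℝ) ^ n)⁻¹ * ∑ ξ, m ξ ^ 2 * hat f ξ ^ 2 := by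
  have h := plancherel (Tm m f)
  simp only [hat_Tm, mul_pow] at h
  rw [h]; field_simp

lemma Tm_Tm {n : ℕ} (m m' f : (Fin n → Bool) → ℝ) :
    Tm m (Tm m' f) = Tm (fun ξ => m ξ * m' ξ) f := by
  funext x; unfold Tm
  congr 1
  refine Finset.sum_congr rfl fun ξ _ => ?_
  have := hat_Tm m' f ξ
  unfold Tm at this
  rw [this]; ring

lemma Tm_one {n : ℕ} (f : (Fin n → Bool) → ℝ) : Tm (fun _ => 1) f = f := by
  funext x; unfold Tm hat
  simp only [one_mul, Finset.mul_sum]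
  rw [Finset.sum_comm]
  have : ∀ y, ∑ ξ : Fin n → Bool, ((2:ℝ)^n)⁻¹ * (chi ξ x * (chi ξ y * f y)) =
      ((2:ℝ)^n)⁻¹ * f y * ∑ ξ : Fin n → Bool, chi ξ x * chi ξ y := by
    intro y; rw [Finset.mul_sum]; refine Finset.sum_congr rfl fun ξ _ => by ring
  simp only [this, orth_full, mul_ite, mul_zero, Finset.sum_ite_eq, Finset.mem_univ, if_true]
  field_simp

lemma hat_add {n : ℕ} (f g : (Fin n → Bool) → ℝ) (ξ : Fin n → Bool) :
    hat (fun x => f x + g x) ξ = hat f ξ + hat g ξ := by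
  unfold hat; rw [← Finset.sum_add_distrib]; simp only [mul_add]

lemma Tm_add {n : ℕ} (m f g : (Fin n → Bool) → ℝ) (x : Fin n → Bool) :
    Tm m (fun x => f x + g x) x = Tm m f x + Tm m g x := by
  unfold Tm; simp only [hat_add]
  rw [← mul_add, ← Finset.sum_add_distrib]; simp only [mul_add]

lemma Tm_madd {n : ℕ} (m m' f : (Fin n → Bool) → ℝ) (x : Fin n → Bool) :
    Tm (fun ξ => m ξ + m' ξ) f x = Tm m f x + Tm m' f x := by
  unfold Tm
  rw [← mul_add, ← Finset.sum_add_distrib]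
  congr 1; exact Finset.sum_congr rfl fun ξ _ => by ring

lemma Tm_msub {n : ℕ} (m m' f : (Fin n → Bool) → ℝ) (x : Fin n → Bool) :
    Tm (fun ξ => m ξ - m' ξ) f x = Tm m f x - Tm m' f x := by
  unfold Tm
  rw [← mul_sub, ← Finset.sum_sub_distrib]
  congr 1; exact Finset.sum_congr rfl fun ξ _ => by ring

lemma Tm_smul {n : ℕ} (c : ℝ) (m f : (Fin n → Bool) → ℝ) (x : Fin n → Bool) :
    Tm (fun ξ => c * m ξ) f x = c * Tm m f x := by
  unfold Tm
  rw [mul_left_comm, Finset.mul_sum, Finset.mul_sum, Finset.mul_sum]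
  exact Finset.sum_congr rfl fun ξ _ => by ring

lemma Tm_bound {n : ℕ} {m : (Fin n → Bool) → ℝ} (hm : ∀ ξ, |m ξ| ≤ 1)
    (f : (Fin n → Bool) → ℝ) : ∑ x, Tm m f x ^ 2 ≤ ∑ x, f x ^ 2 := by
  rw [Tm_sq, inv_mul_le_iff₀ (by positivity), ← plancherel]
  refine Finset.sum_le_sum fun ξ _ => ?_
  have : m ξ ^ 2 ≤ 1 := by rw [← sq_abs]; exact pow_le_one₀ (abs_nonneg _) (hm ξ)
  nlinarith [sq_nonneg (hat f ξ)]

/-- Conditional expectation of level `t`. -/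
def Et {n : ℕ} (t : ℕ) (f : (Fin n → Bool) → ℝ) (x : Fin n → Bool) : ℝ :=
  ((2 : ℝ) ^ (n - t))⁻¹ * ∑ y, if Sx t x y then f y else 0

lemma Et_congr {n t : ℕ} (f : (Fin n → Bool) → ℝ) {x x' : Fin n → Bool} (h : Sx t x x') :
    Et t f x = Et t f x' := by
  unfold Et; congr 1
  refine Finset.sum_congr rfl fun y _ => ?_
  congr 1
  exact propext ⟨fun h' => h.symm.trans h', fun h' => h.trans h'⟩

lemma card_cell {n t : ℕ} (ht : t ≤ n) (x : Fin n → Bool) :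
    (Finset.univ.filter fun y => Sx t x y).card = 2 ^ (n - t) := by
  have h := orth_space ht x (fun _ => false) (fun _ => false)
  simp only [chi_mul_self, if_true, mul_one] at h
  rw [Finset.sum_ite] at h
  simp only [Finset.sum_const_zero, add_zero, Finset.sum_const, nsmul_eq_mul, mul_one] at h
  exact_mod_cast h

/-- Pulling an adapted factor out of a sum. -/
lemma sum_Et_mul {n t : ℕ} (ht : t ≤ n) (f φ : (Fin n → Bool) → ℝ)
    (hφ : ∀ x y, Sx t x y → φ x = φ y) :
    ∑ x, φ x * Et t f x = ∑ x, φ x * f x := by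
  unfold Et
  simp only [Finset.mul_sum]
  rw [Finset.sum_comm]
  refine Finset.sum_congr rfl fun y _ => ?_
  have : ∀ x, φ x * (((2:ℝ) ^ (n - t))⁻¹ * if Sx t x y then f y else 0) =
      if Sx t y x then (φ y * f y * ((2:ℝ) ^ (n - t))⁻¹) else 0 := by
    intro x
    by_cases h : Sx t x y
    · rw [if_pos h, if_pos h.symm, hφ x y h]; ring
    · rw [if_neg h, if_neg (fun h' => h h'.symm)]; ring
  simp only [this]
  rw [← Finset.sum_filter, Finset.sum_const, card_cell ht, nsmul_eq_mul]
  push_cast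
  field_simp

lemma sum_Et {n t : ℕ} (ht : t ≤ n) (f : (Fin n → Bool) → ℝ) : ∑ x, Et t f x = ∑ x, f x := by
  have := sum_Et_mul ht f (fun _ => 1) (fun _ _ _ => rfl)
  simpa using this

lemma Et_mul {n t : ℕ} (f φ : (Fin n → Bool) → ℝ)
    (hφ : ∀ x y, Sx t x y → φ x = φ y) (x : Fin n → Bool) :
    Et t (fun y => φ y * f y) x = φ x * Et t f x := by
  unfold Et
  simp only [Finset.mul_sum]
  refine Finset.sum_congr rfl fun y _ => ?_
  by_cases h : Sx t x y
  · simp only [h, if_true]; rw [hφ x y h]; ring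
  · simp [h]

lemma Et_full {n : ℕ} (f : (Fin n → Bool) → ℝ) (x : Fin n → Bool) : Et n f x = f x := by
  unfold Et; simp [Sx_full]

lemma Et_mono {n t : ℕ} {f g : (Fin n → Bool) → ℝ} (h : ∀ x, f x ≤ g x) (x : Fin n → Bool) :
    Et t f x ≤ Et t g x := by
  unfold Et
  refine mul_le_mul_of_nonneg_left (Finset.sum_le_sum fun y _ => ?_) (by positivity)
  split_ifs
  · exact h y
  · exact le_rfl

lemma abs_Et_le {n t : ℕ} (f : (Fin n → Bool) → ℝ) (x : Fin n → Bool) :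
    |Et t f x| ≤ Et t (fun y => |f y|) x := by
  unfold Et
  rw [abs_mul, abs_of_nonneg (by positivity : (0:ℝ) ≤ ((2:ℝ)^(n-t))⁻¹)]
  refine mul_le_mul_of_nonneg_left ?_ (by positivity)
  refine le_trans (Finset.abs_sum_le_sum_abs
    (fun y => if Sx t x y then f y else 0) Finset.univ) ?_
  refine Finset.sum_le_sum fun y _ => ?_
  by_cases h : Sx t x y <;> simp [h]

/-- Halving: parent averages dominate half of child averages. -/
lemma Et_succ_le {n t : ℕ} (ht : t < n) {f : (Fin n → Bool) → ℝ} (hf : ∀ x, 0 ≤ f x)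
    (x : Fin n → Bool) : Et (t+1) f x ≤ 2 * Et t f x := by
  unfold Et
  have h1 : (2:ℝ)^(n-t) = 2 * 2^(n-(t+1)) := by
    rw [← pow_succ']; congr 1; omega
  have h2 : (∑ y, if Sx (t+1) x y then f y else 0) ≤ ∑ y, if Sx t x y then f y else 0 := by
    refine Finset.sum_le_sum fun y _ => ?_
    by_cases h : Sx (t+1) x y
    · rw [if_pos h, if_pos (h.mono (Nat.le_succ t))]
    · rw [if_neg h]; split_ifs
      · exact hf y
      · exact le_rfl
  rw [h1, mul_inv]
  have h3 : (0:ℝ) ≤ ((2:ℝ)^(n-(t+1)))⁻¹ := by positivity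
  calc _ ≤ ((2:ℝ)^(n-(t+1)))⁻¹ * ∑ y, (if Sx t x y then f y else 0) :=
        mul_le_mul_of_nonneg_left h2 h3
    _ = _ := by ring

/-- Tower property. -/
lemma Et_Et {n s t : ℕ} (hst : s ≤ t) (ht : t ≤ n) (f : (Fin n → Bool) → ℝ) (x : Fin n → Bool) :
    Et s (Et t f) x = Et s f x := by
  have h := sum_Et_mul ht f (fun y => if Sx s x y then 1 else 0) (by
    intro y z h
    congr 1
    exact propext ⟨fun h' => h'.trans (h.mono hst), fun h' => h'.trans (h.mono hst).symm⟩)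
  simp only [ite_mul, one_mul, zero_mul] at h
  unfold Et at h ⊢
  rw [h]

/-- Representation of a multiplier which is constant on frequency classes of level `t`. -/
lemma Tm_rep {n t : ℕ} (ht : t ≤ n) (m f : (Fin n → Bool) → ℝ) (R : Finset (Fin n → Bool))
    (hm : ∀ ξ η, cls t ξ = cls t η → m ξ = m η)
    (hR : ∀ ξ, m ξ ≠ 0 → ∃ η ∈ R, cls t ξ = cls t η)
    (hinj : ∀ η ∈ R, ∀ η' ∈ R, cls t η = cls t η' → η = η') (x : Fin n → Bool) :
    Tm m f x = ∑ η ∈ R, m η * chi η x * Et t (fun y => chi η y * f y) x := by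
  have h1 : ∀ ξ, m ξ * chi ξ x * hat f ξ =
      ∑ η ∈ R, if cls t ξ = cls t η then m η * chi ξ x * hat f ξ else 0 := by
    intro ξ
    by_cases h0 : m ξ = 0
    · rw [h0, zero_mul, zero_mul, Finset.sum_eq_zero]
      intro η _
      split_ifs with h
      · rw [← hm ξ η h, h0]; ring
      · rfl
    · obtain ⟨η, hη, he⟩ := hR ξ h0
      rw [Finset.sum_eq_single_of_mem η hη, if_pos he, hm ξ η he]
      intro η' hη' hne
      rw [if_neg]
      intro h; exact hne (hinj η' hη' η hη (h.symm.trans he))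
  unfold Tm
  rw [Finset.sum_congr rfl fun ξ _ => h1 ξ, Finset.sum_comm, Finset.mul_sum]
  refine Finset.sum_congr rfl fun η _ => ?_
  have h2 : (∑ ξ, if cls t ξ = cls t η then m η * chi ξ x * hat f ξ else 0) =
      ∑ y, m η * f y * ∑ ξ, if cls t ξ = cls t η then chi ξ x * chi ξ y else 0 := by
    simp only [Finset.mul_sum]
    rw [Finset.sum_comm]
    refine Finset.sum_congr rfl fun ξ _ => ?_
    split_ifs
    · unfold hat; rw [Finset.mul_sum]
      exact Finset.sum_congr rfl fun y _ => by ring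
    · simp
  rw [h2]
  simp only [orth_freq ht]
  unfold Et
  rw [Finset.mul_sum, Finset.mul_sum, Finset.mul_sum]
  have h3 : (2:ℝ)^n = 2^t * 2^(n-t) := by rw [← pow_add]; congr 1; omega
  refine Finset.sum_congr rfl fun y _ => ?_
  split_ifs
  · rw [h3]; field_simp
  · simp

/-- Multipliers constant on frequency classes of level `t` are local at level `t`. -/
lemma Tm_local {n t : ℕ} (ht : t ≤ n) (m f φ : (Fin n → Bool) → ℝ)
    (hm : ∀ ξ η, cls t ξ = cls t η → m ξ = m η)
    (hφ : ∀ x y, Sx t x y → φ x = φ y) (x : Fin n → Bool) :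
    Tm m (fun y => φ y * f y) x = φ x * Tm m f x := by
  have hR : ∀ ξ : Fin n → Bool, m ξ ≠ 0 → ∃ η ∈ Finset.univ.image (cls (n := n) t),
      cls t ξ = cls t η := fun ξ _ => ⟨cls t ξ, by simp, (cls_cls le_rfl ξ).symm⟩
  have hi : ∀ η ∈ Finset.univ.image (cls (n := n) t), ∀ η' ∈ Finset.univ.image (cls (n := n) t),
      cls t η = cls t η' → η = η' := by
    intro η hη η' hη' h
    simp only [Finset.mem_image, Finset.mem_univ, true_and] at hη hη'
    obtain ⟨a, rfl⟩ := hη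
    obtain ⟨b, rfl⟩ := hη'
    rwa [cls_cls le_rfl, cls_cls le_rfl] at h
  rw [Tm_rep ht m _ _ hm hR hi, Tm_rep ht m f _ hm hR hi, Finset.mul_sum]
  refine Finset.sum_congr rfl fun η _ => ?_
  have : (fun y => chi η y * (φ y * f y)) = fun y => φ y * (chi η y * f y) := by
    funext y; ring
  rw [this, Et_mul _ _ hφ]; ring

end SMM

namespace SMM

/-! ### A Rademacher–Menshov type lemma -/

/-- Bounded sequence with `r`-variation at most one. -/
def VB (r : ℝ) (a : ℕ → ℝ) : Prop :=
  (∀ t, |a t| ≤ 1) ∧ ∀ u : ℕ → ℕ, Monotone u → ∀ M : ℕ,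
    ∑ j ∈ Finset.range M, |a (u (j+1)) - a (u j)| ^ r ≤ 1

lemma VB.sum_sq {r : ℝ} (hr : 2 < r) {a : ℕ → ℝ} (ha : VB r a) {u : ℕ → ℕ} (hu : Monotone u)
    (M : ℕ) : ∑ j ∈ Finset.range M, (a (u (j+1)) - a (u j)) ^ 2 ≤ (M : ℝ) ^ (1 - 2 / r) := by
  rcases Nat.eq_zero_or_pos M with h0 | hM
  · subst h0; simp only [Finset.range_zero, Finset.sum_empty]; positivity
  have hMp : (0:ℝ) < M := by exact_mod_cast hM
  have h := Real.rpow_sum_le_const_mul_sum_rpow (Finset.range M)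
    (fun j => (a (u (j+1)) - a (u j)) ^ 2) (p := r / 2) (by linarith)
  simp only [Finset.card_range] at h
  have h1 : ∀ j, |(a (u (j+1)) - a (u j)) ^ 2| ^ (r/2) = |a (u (j+1)) - a (u j)| ^ r := by
    intro j
    rw [abs_pow, ← Real.rpow_natCast, ← Real.rpow_mul (abs_nonneg _)]
    congr 1; push_cast; ring
  simp only [h1] at h; simp only [abs_sq] at h
  have h2 := h.trans (mul_le_mul_of_nonneg_left (ha.2 u hu M) (by positivity))
  rw [mul_one] at h2
  set Q := ∑ j ∈ Finset.range M, (a (u (j+1)) - a (u j)) ^ 2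
  have hQ : 0 ≤ Q := Finset.sum_nonneg fun _ _ => sq_nonneg _
  have h3 := Real.rpow_le_rpow (by positivity) h2 (by positivity : 0 ≤ 2 / r)
  rw [← Real.rpow_mul hQ, ← Real.rpow_mul hMp.le] at h3
  have e1 : r / 2 * (2 / r) = 1 := by field_simp
  have e2 : (r / 2 - 1) * (2 / r) = 1 - 2 / r := by field_simp
  rwa [e1, e2, Real.rpow_one] at h3

lemma H_lem {ι : Type*} {r : ℝ} (hr : 2 < r) (I : Finset ι) (a : ℕ → ι → ℝ)
    (ha : ∀ i ∈ I, VB r fun t => a t i) (v : ι → ℝ) {u : ℕ → ℕ} (hu : Monotone u) (M : ℕ) :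
    ∑ j ∈ Finset.range M, ∑ i ∈ I, v i ^ 2 * (a (u (j+1)) i - a (u j) i) ^ 2 ≤
      (M : ℝ) ^ (1 - 2 / r) * ∑ i ∈ I, v i ^ 2 := by
  rw [Finset.sum_comm, Finset.mul_sum]
  refine Finset.sum_le_sum fun i hi => ?_
  rw [← Finset.mul_sum, mul_comm]
  exact mul_le_mul_of_nonneg_right ((ha i hi).sum_sq hr hu M) (sq_nonneg _)

/-- Dyadic chaining. -/
lemma chain (l : ℕ) : ∀ (X : ℕ → ℝ) (j : ℕ), j < 2 ^ l →
    |X j - X 0| ≤ ∑ k ∈ Finset.range l, Real.sqrt (∑ i ∈ Finset.range (2 ^ (l - k)),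
      (X ((i+1) * 2 ^ k) - X (i * 2 ^ k)) ^ 2) := by
  induction l with
  | zero => intro X j hj; have : j = 0 := by simpa using hj
            subst this; simp
  | succ l ih =>
    intro X j hj
    have h1 := ih (fun i => X (2 * i)) (j / 2) (by rw [pow_succ] at hj; omega)
    rw [Finset.sum_range_succ']
    have h2 : ∀ k ∈ Finset.range l, Real.sqrt (∑ i ∈ Finset.range (2 ^ (l - k)),
        (X (2 * ((i+1) * 2 ^ k)) - X (2 * (i * 2 ^ k))) ^ 2) =
        Real.sqrt (∑ i ∈ Finset.range (2 ^ (l + 1 - (k+1))),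
      (X ((i+1) * 2 ^ (k+1)) - X (i * 2 ^ (k+1))) ^ 2) := by
      intro k _
      rw [Nat.add_sub_add_right]
      congr 1
      refine Finset.sum_congr rfl fun i _ => ?_
      have e1 : 2 * ((i+1) * 2 ^ k) = (i+1) * 2 ^ (k+1) := by ring
      have e2 : 2 * (i * 2 ^ k) = i * 2 ^ (k+1) := by ring
      rw [e1, e2]
    simp only [mul_zero] at h1
    rw [Finset.sum_congr rfl h2] at h1
    have h3 : |X j - X (2 * (j/2))| ≤ Real.sqrt (∑ i ∈ Finset.range (2 ^ (l + 1 - 0)),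
      (X ((i+1) * 2 ^ 0) - X (i * 2 ^ 0)) ^ 2) := by
      rcases Nat.even_or_odd' j with ⟨c, hc | hc⟩
      · have : 2 * (j / 2) = j := by omega
        rw [this, sub_self, abs_zero]; exact Real.sqrt_nonneg _
      · have : 2 * (j / 2) = 2 * c := by omega
        rw [this]
        apply Real.abs_le_sqrt
        have := Finset.single_le_sum (f := fun i => (X ((i+1) * 2 ^ 0) - X (i * 2 ^ 0)) ^ 2)
          (s := Finset.range (2 ^ (l + 1 - 0))) (fun i _ => sq_nonneg _)
          (Finset.mem_range.2 (by simp; omega : 2 * c < 2 ^ (l + 1 - 0)))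
        simpa [hc] using this
    calc |X j - X 0| ≤ |X j - X (2 * (j/2))| + |X (2 * (j/2)) - X 0| := abs_sub_le _ _ _
      _ ≤ _ := by linarith

lemma chain_sq (l : ℕ) (X : ℕ → ℝ) (j : ℕ) (hj : j < 2 ^ l) :
    (X j - X 0) ^ 2 ≤ l * ∑ k ∈ Finset.range l, ∑ i ∈ Finset.range (2 ^ (l - k)),
      (X ((i+1) * 2 ^ k) - X (i * 2 ^ k)) ^ 2 := by
  have h := chain l X j hj
  have h2 := sq_sum_le_card_mul_sum_sq (s := Finset.range l) (f := fun k =>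
    Real.sqrt (∑ i ∈ Finset.range (2 ^ (l - k)), (X ((i+1) * 2 ^ k) - X (i * 2 ^ k)) ^ 2))
  rw [Finset.card_range] at h2
  rw [← sq_abs]
  refine (pow_le_pow_left₀ (abs_nonneg _) h 2).trans (h2.trans ?_)
  refine mul_le_mul_of_nonneg_left (Finset.sum_le_sum fun k _ => ?_) (by positivity)
  rw [Real.sq_sqrt (Finset.sum_nonneg fun _ _ => sq_nonneg _)]

/-- Greedy selection. -/
lemma greedy (D : ℕ → ℕ → ℝ) (hD : ∀ s, D s s = 0) (δ : ℝ) (hδ : 0 ≤ δ) (J : ℕ)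
    (hJ : ∀ u : ℕ → ℕ, Monotone u → ∃ i < J, D (u i) (u (i+1)) ≤ δ) (T : ℕ) :
    ∃ u : ℕ → ℕ, Monotone u ∧ u 0 = 0 ∧ ∀ t ≤ T, ∃ j < J, D (u j) t ≤ δ := by
  let nx : ℕ → ℕ := fun s =>
    if h : ∃ t, s < t ∧ t ≤ T ∧ δ < D s t then Nat.find h else s
  have hnx : ∀ s, s ≤ nx s := by
    intro s
    simp only [nx]
    split_ifs with h
    · exact (Nat.find_spec h).1.le
    · exact le_rfl
  let u : ℕ → ℕ := fun j => nx^[j] 0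
  have hus : ∀ j, u (j+1) = nx (u j) := fun j => Function.iterate_succ_apply' _ _ _
  have hu : Monotone u := monotone_nat_of_le_succ fun j => by rw [hus]; exact hnx _
  refine ⟨u, hu, rfl, fun t ht => ?_⟩
  by_contra hcon
  push Not at hcon
  have key : ∀ j ≤ J, u j ≤ t ∧ ∀ i < j, δ < D (u i) (u (i+1)) := by
    intro j
    induction j with
    | zero => intro _; exact ⟨Nat.zero_le _, fun i hi => absurd hi (Nat.not_lt_zero _)⟩
    | succ j ih =>
      intro hj
      obtain ⟨h1, h2⟩ := ih (by omega)
      have h3 := hcon j (by omega)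
      have h4 : u j < t := by
        rcases h1.lt_or_eq with h | h
        · exact h
        · rw [h, hD] at h3; linarith
      have hex : ∃ t, u j < t ∧ t ≤ T ∧ δ < D (u j) t := ⟨t, h4, ht, h3⟩
      have h5 : u (j+1) = Nat.find hex := by rw [hus]; simp only [nx]; rw [dif_pos hex]
      refine ⟨by rw [h5]; exact Nat.find_min' hex ⟨h4, ht, h3⟩, fun i hi => ?_⟩
      rcases Nat.lt_succ_iff_lt_or_eq.1 hi with h | h
      · exact h2 i h
      · subst h; rw [h5]; exact (Nat.find_spec hex).2.2
  obtain ⟨i, hi, hi2⟩ := hJ u hu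
  exact absurd hi2 (not_le.2 ((key J le_rfl).2 i hi))

/-- The square of the constant in the Rademacher–Menshov lemma. -/
def Ksq (r : ℝ) (l : ℕ) : ℝ := 6 * (l + 1) ^ 2 * ((2:ℝ) ^ l) ^ (1 - 2 / r)

lemma Ksq_ge {r : ℝ} (hr : 2 < r) (l : ℕ) : 1 ≤ Ksq r l := by
  unfold Ksq
  have h1 : (1:ℝ) ≤ ((2:ℝ) ^ l) ^ (1 - 2 / r) := by
    apply Real.one_le_rpow (one_le_pow₀ (by norm_num))
    have : 2 / r < 1 := by rw [div_lt_one (by linarith)]; exact hr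
    linarith
  have h2 : (0:ℝ) ≤ l := by positivity
  nlinarith

lemma K_lem {ι Y : Type*} {r : ℝ} (hr : 2 < r) (I : Finset ι) (l : ℕ) (hI : I.card ≤ 2 ^ l)
    (S : Finset Y) (w : ι → Y → ℝ) (c : ℝ) (hc : (S.card : ℝ) ≤ c) (hw : ∀ i y, |w i y| ≤ 1)
    (hB : ∀ b : ι → ℝ, ∑ y ∈ S, (∑ i ∈ I, b i * w i y) ^ 2 ≤ c * ∑ i ∈ I, b i ^ 2)
    (a : ℕ → ι → ℝ) (ha : ∀ i ∈ I, VB r fun t => a t i) (v : ι → ℝ) (τ : Y → ℕ) :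
    ∑ y ∈ S, (∑ i ∈ I, a (τ y) i * v i * w i y) ^ 2 ≤ Ksq r l * (c * ∑ i ∈ I, v i ^ 2) := by
  set V := ∑ i ∈ I, v i ^ 2 with hV
  have hV0 : 0 ≤ V := Finset.sum_nonneg fun _ _ => sq_nonneg _
  have hc0 : 0 ≤ c := le_trans (by positivity) hc
  set J : ℕ := 2 ^ l with hJ
  have hJp : (0:ℝ) < J := by rw [hJ]; positivity
  have hJ1 : (1:ℝ) ≤ J := by rw [hJ]; exact_mod_cast Nat.one_le_two_pow
  set δ : ℝ := (J:ℝ) ^ (-(2 / r)) with hδ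
  have hδ0 : 0 < δ := by positivity
  set A : ℝ := (J:ℝ) ^ (1 - 2 / r) with hA
  have hθ : 0 ≤ 1 - 2 / r := by
    have : 2 / r < 1 := by rw [div_lt_one (by linarith)]; exact hr
    linarith
  have hA1 : 1 ≤ A := Real.one_le_rpow hJ1 hθ
  have hJδ : J * δ = A := by
    rw [hδ, hA, sub_eq_add_neg, Real.rpow_add hJp, Real.rpow_one]
  let D : ℕ → ℕ → ℝ := fun s t => ∑ i ∈ I, v i ^ 2 * (a t i - a s i) ^ 2
  obtain ⟨T, hT⟩ : ∃ T, ∀ y ∈ S, τ y ≤ T := ⟨S.sup τ, fun y hy => Finset.le_sup hy⟩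
  obtain ⟨u, hu, hu0, hut⟩ := greedy D (fun s => by simp [D]) (δ * V) (by positivity) J (by
    intro u hu
    by_contra hcon
    push Not at hcon
    have h1 := H_lem hr I a ha v hu J
    have h2 : ∑ j ∈ Finset.range J, (δ * V) <
        ∑ j ∈ Finset.range J, ∑ i ∈ I, v i ^ 2 * (a (u (j+1)) i - a (u j) i) ^ 2 := by
      apply Finset.sum_lt_sum_of_nonempty
      · rw [Finset.nonempty_range_iff, hJ]; positivity
      · intro i hi; exact hcon i (Finset.mem_range.1 hi)
    rw [Finset.sum_const, Finset.card_range, nsmul_eq_mul, ← mul_assoc, hJδ] at h2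
    exact absurd h1 (not_le.2 h2)) T
  have hex : ∀ y, ∃ j, y ∈ S → j < J ∧ D (u j) (τ y) ≤ δ * V := by
    intro y
    by_cases hy : y ∈ S
    · obtain ⟨j, h1, h2⟩ := hut (τ y) (hT y hy)
      exact ⟨j, fun _ => ⟨h1, h2⟩⟩
    · exact ⟨0, fun h => absurd h hy⟩
  choose j hj using hex
  let X : Y → ℕ → ℝ := fun y k => ∑ i ∈ I, a (u k) i * v i * w i y
  have hXsub : ∀ y k k', X y k - X y k' = ∑ i ∈ I, ((a (u k) i - a (u k') i) * v i) * w i y := by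
    intro y k k'; simp only [X]; rw [← Finset.sum_sub_distrib]
    exact Finset.sum_congr rfl fun i _ => by ring
  -- pointwise bound
  have hpt : ∀ y ∈ S, (∑ i ∈ I, a (τ y) i * v i * w i y) ^ 2 ≤
      3 * (A * V) + 3 * (X y 0) ^ 2 + 3 * (l * ∑ k ∈ Finset.range l,
        ∑ i ∈ Finset.range (2 ^ (l - k)), (X y ((i+1) * 2 ^ k) - X y (i * 2 ^ k)) ^ 2) := by
    intro y hy
    obtain ⟨h1, h2⟩ := hj y hy
    have h3 := chain_sq l (X y) (j y) h1
    set Z := ∑ i ∈ I, a (τ y) i * v i * w i y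
    have h4 : (Z - X y (j y)) ^ 2 ≤ A * V := by
      have : Z - X y (j y) = ∑ i ∈ I, w i y * (v i * (a (τ y) i - a (u (j y)) i)) := by
        simp only [Z, X]; rw [← Finset.sum_sub_distrib]
        exact Finset.sum_congr rfl fun i _ => by ring
      rw [this]
      refine (Finset.sum_mul_sq_le_sq_mul_sq I (fun i => w i y) _).trans ?_
      have h5 : ∑ i ∈ I, w i y ^ 2 ≤ J := by
        calc ∑ i ∈ I, w i y ^ 2 ≤ ∑ i ∈ I, (1:ℝ) := Finset.sum_le_sum fun i _ => by
              rw [← sq_abs]; exact pow_le_one₀ (abs_nonneg _) (hw i y)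
          _ = I.card := by simp
          _ ≤ J := by exact_mod_cast hI
      have h6 : ∑ i ∈ I, (v i * (a (τ y) i - a (u (j y)) i)) ^ 2 ≤ δ * V := by
        simp only [mul_pow]; exact h2
      calc _ ≤ (J:ℝ) * (δ * V) := mul_le_mul h5 h6
            (Finset.sum_nonneg fun _ _ => sq_nonneg _) hJp.le
        _ = A * V := by rw [← mul_assoc, hJδ]
    nlinarith [sq_nonneg ((Z - X y (j y)) - X y 0), sq_nonneg ((Z - X y (j y)) -
      (X y (j y) - X y 0)), sq_nonneg (X y 0 - (X y (j y) - X y 0))]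
  have hdiff : ∀ k < l, ∑ y ∈ S, ∑ i ∈ Finset.range (2 ^ (l - k)),
      (X y ((i+1) * 2 ^ k) - X y (i * 2 ^ k)) ^ 2 ≤ c * (A * V) := by
    intro k hk
    rw [Finset.sum_comm]
    have h1 : ∀ i ∈ Finset.range (2 ^ (l - k)),
        ∑ y ∈ S, (X y ((i+1) * 2 ^ k) - X y (i * 2 ^ k)) ^ 2 ≤
        c * ∑ i' ∈ I, v i' ^ 2 * (a (u ((i+1) * 2 ^ k)) i' - a (u (i * 2 ^ k)) i') ^ 2 := by
      intro i _
      simp only [hXsub]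
      refine (hB _).trans (le_of_eq ?_)
      congr 1
      exact Finset.sum_congr rfl fun i _ => by ring
    refine (Finset.sum_le_sum h1).trans ?_
    rw [← Finset.mul_sum]
    refine mul_le_mul_of_nonneg_left ?_ hc0
    have h2 := H_lem hr I a ha v (u := fun i => u (i * 2 ^ k))
      (fun x y hxy => hu (Nat.mul_le_mul_right _ hxy)) (2 ^ (l - k))
    refine h2.trans (mul_le_mul_of_nonneg_right ?_ hV0)
    apply Real.rpow_le_rpow (by positivity) _ hθ
    rw [hJ]
    exact_mod_cast Nat.pow_le_pow_right (by norm_num) (Nat.sub_le _ _)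
  have hX0 : ∑ y ∈ S, X y 0 ^ 2 ≤ c * V := by
    refine (hB (fun i => a (u 0) i * v i)).trans (mul_le_mul_of_nonneg_left ?_ hc0)
    refine Finset.sum_le_sum fun i hi => ?_
    rw [mul_pow]
    have : a (u 0) i ^ 2 ≤ 1 := by
      rw [← sq_abs]; exact pow_le_one₀ (abs_nonneg _) ((ha i hi).1 _)
    nlinarith [sq_nonneg (v i)]
  refine (Finset.sum_le_sum hpt).trans ?_
  rw [Finset.sum_add_distrib, Finset.sum_add_distrib, Finset.sum_const, nsmul_eq_mul,
    ← Finset.mul_sum, ← Finset.mul_sum, ← Finset.mul_sum, Finset.sum_comm]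
  have h7 : ∑ k ∈ Finset.range l, ∑ y ∈ S, ∑ i ∈ Finset.range (2 ^ (l - k)),
      (X y ((i+1) * 2 ^ k) - X y (i * 2 ^ k)) ^ 2 ≤ l * (c * (A * V)) := by
    refine (Finset.sum_le_sum fun k hk => hdiff k (Finset.mem_range.1 hk)).trans ?_
    rw [Finset.sum_const, Finset.card_range, nsmul_eq_mul]
  have hl : (0:ℝ) ≤ l := by positivity
  have h8 := mul_le_mul_of_nonneg_left h7 hl
  have hKA : Ksq r l = 6 * (l + 1) ^ 2 * A := by
    unfold Ksq; rw [hA, hJ]; push_cast; rfl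
  rw [hKA]
  have h9 : (S.card : ℝ) * (3 * (A * V)) ≤ c * (3 * (A * V)) :=
    mul_le_mul_of_nonneg_right hc (by positivity)
  have h10 : c * V ≤ c * (A * V) := mul_le_mul_of_nonneg_left (by nlinarith) hc0
  have h11 : 0 ≤ c * (A * V) := by positivity
  nlinarith [mul_nonneg hl h11, mul_nonneg (mul_nonneg hl hl) h11]

/-- Global form of the Rademacher–Menshov lemma. -/
lemma K_glob {n e l : ℕ} (he : e ≤ n) {r : ℝ} (hr : 2 < r) (R : Finset (Fin n → Bool))
    (hR : R.card ≤ 2 ^ l) (hinj : ∀ η ∈ R, ∀ η' ∈ R, cls e η = cls e η' → η = η')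
    (a : ℕ → (Fin n → Bool) → ℝ) (ha : ∀ i ∈ R, VB r fun t => a t i)
    (v : (Fin n → Bool) → (Fin n → Bool) → ℝ) (hv : ∀ η, ∀ x y, Sx e x y → v η x = v η y)
    (τ : (Fin n → Bool) → ℕ) :
    ∑ x, (∑ η ∈ R, a (τ x) η * v η x * chi η x) ^ 2 ≤ Ksq r l * ∑ x, ∑ η ∈ R, v η x ^ 2 := by
  rw [← sum_Et he, Finset.mul_sum]
  refine Finset.sum_le_sum fun x _ => ?_
  unfold Et
  rw [inv_mul_le_iff₀ (by positivity), ← Finset.sum_filter]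
  have h := K_lem hr R l hR (Finset.univ.filter fun y => Sx e x y) chi ((2:ℝ)^(n-e))
    (by rw [card_cell he]; push_cast; rfl) (fun i y => (abs_chi i y).le) (by
      intro b
      rw [Finset.sum_filter]
      have : ∀ y, (if Sx e x y then (∑ i ∈ R, b i * chi i y) ^ 2 else 0) =
          ∑ i ∈ R, ∑ j ∈ R, b i * b j * (if Sx e x y then chi i y * chi j y else 0) := by
        intro y
        split_ifs
        · rw [sq, Finset.sum_mul_sum]
          exact Finset.sum_congr rfl fun i _ => Finset.sum_congr rfl fun j _ => by ring
        · simp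
      simp only [this]
      rw [Finset.sum_comm, Finset.mul_sum]
      refine Finset.sum_le_sum fun i hi => ?_
      rw [Finset.sum_comm]
      simp only [← Finset.mul_sum, orth_space he]
      rw [Finset.sum_eq_single_of_mem i hi]
      · rw [if_pos rfl, chi_mul_self]; apply le_of_eq; ring
      · intro j hj hne
        rw [if_neg, mul_zero]
        intro h; exact hne (hinj i hi j hj h).symm)
    a ha (fun η => v η x) τ
  refine le_trans (le_of_eq ?_) (h.trans (le_of_eq (by ring)))
  refine Finset.sum_congr rfl fun y hy => ?_
  have hy' : Sx e x y := (Finset.mem_filter.1 hy).2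
  congr 1
  exact Finset.sum_congr rfl fun η _ => by rw [hv η x y hy']

end SMM

namespace SMM

/-! ### Martingale part -/

section mart
set_option linter.unusedSectionVars false
variable {Ω E : Type*} [Fintype Ω] [NormedAddCommGroup E] [InnerProductSpace ℝ E]

lemma frozen (A : ℕ → Ω → Ω → Prop)
    (V W : ℕ → Ω → E) (hV : ∀ k x y, A k x y → V k x = V k y)
    (hVm : ∀ k (φ : Ω → E), (∀ x y, A k x y → φ x = φ y) →
      ∑ x, inner ℝ (φ x) (V (k+1) x - V k x) = 0)
    (hW : ∀ k x y, A k x y → W k x = W k y) (hW0 : ∀ x, W 0 x = V 0 x)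
    (hWs : ∀ k x, W (k+1) x = W k x ∨ W (k+1) x = V (k+1) x) (k : ℕ) :
    ∑ x, (‖V k x - W k x‖ ^ 2 + ‖W 0 x‖ ^ 2 +
      ∑ j ∈ Finset.range k, ‖W (j+1) x - W j x‖ ^ 2) = ∑ x, ‖V k x‖ ^ 2 := by
  induction k with
  | zero => simp [hW0]
  | succ k ih =>
    have h1 : ∀ x, ‖V (k+1) x - W (k+1) x‖ ^ 2 + ‖W 0 x‖ ^ 2 +
        ∑ j ∈ Finset.range (k+1), ‖W (j+1) x - W j x‖ ^ 2 =
        (‖V k x - W k x‖ ^ 2 + ‖W 0 x‖ ^ 2 +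
      ∑ j ∈ Finset.range k, ‖W (j+1) x - W j x‖ ^ 2) + ‖V (k+1) x - V k x‖ ^ 2 +
        2 * inner ℝ (V k x - W k x) (V (k+1) x - V k x) := by
      intro x
      rw [Finset.sum_range_succ]
      have h2 : ‖V (k+1) x - W (k+1) x‖ ^ 2 + ‖W (k+1) x - W k x‖ ^ 2 =
          ‖V (k+1) x - W k x‖ ^ 2 := by
        rcases hWs k x with h | h
        · rw [h]; simp
        · rw [h]; simp
      have h3 : ‖V (k+1) x - W k x‖ ^ 2 = ‖V k x - W k x‖ ^ 2 +
          2 * inner ℝ (V k x - W k x) (V (k+1) x - V k x) + ‖V (k+1) x - V k x‖ ^ 2 := by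
        rw [← norm_add_sq_real]; congr 2; abel
      linarith
    have h4 : ∀ x, ‖V (k+1) x‖ ^ 2 = ‖V k x‖ ^ 2 + ‖V (k+1) x - V k x‖ ^ 2 +
        2 * inner ℝ (V k x) (V (k+1) x - V k x) := by
      intro x
      have : ‖V (k+1) x‖ ^ 2 = ‖V k x + (V (k+1) x - V k x)‖ ^ 2 := by congr 2; abel
      rw [this, norm_add_sq_real]; ring
    simp only [h1, h4]
    rw [Finset.sum_add_distrib, Finset.sum_add_distrib, ih, Finset.sum_add_distrib,
      Finset.sum_add_distrib, ← Finset.mul_sum, ← Finset.mul_sum,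
      hVm k (fun x => V k x - W k x) (fun x y h => by rw [hV k x y h, hW k x y h]),
      hVm k (V k) (hV k)]

/-- One step of the stopping time construction. -/
def step (θ : ℝ) (v : E) (p : E × E) : E × E :=
  if ‖p.1‖ < ‖v - p.1‖ then (v, v) else if θ * ‖p.1‖ < ‖v - p.2‖ then (p.1, v) else p

/-- The stopping time process. -/
def st (θ : ℝ) (V : ℕ → Ω → E) : ℕ → Ω → E × E
  | 0, x => (V 0 x, V 0 x)
  | k+1, x => step θ (V (k+1) x) (st θ V k x)

lemma step_fst (θ : ℝ) (v : E) (p : E × E) :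
    (step θ v p).1 = if ‖p.1‖ < ‖v - p.1‖ then v else p.1 := by
  unfold step; split_ifs <;> rfl

lemma st_fst (θ θ' : ℝ) (V : ℕ → Ω → E) (k : ℕ) (x : Ω) : (st θ V k x).1 = (st θ' V k x).1 := by
  induction k with
  | zero => rfl
  | succ k ih => simp only [st, step_fst, ih]

lemma st_ad (A : ℕ → Ω → Ω → Prop) (hA : ∀ k x y, A (k+1) x y → A k x y) (θ : ℝ)
    (V : ℕ → Ω → E) (hV : ∀ k x y, A k x y → V k x = V k y) (k : ℕ) (x y : Ω) (h : A k x y) :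
    st θ V k x = st θ V k y := by
  induction k with
  | zero => simp only [st]; rw [hV 0 x y h]
  | succ k ih => simp only [st]; rw [hV _ x y h, ih (hA _ _ _ h)]

lemma st_inv {θ : ℝ} (hθ : 0 ≤ θ) (V : ℕ → Ω → E) (k : ℕ) (x : Ω) :
    ‖V k x - (st θ V k x).2‖ ≤ θ * ‖(st θ V k x).1‖ ∧
    ‖(st θ V k x).2 - (st θ V k x).1‖ ≤ ‖(st θ V k x).1‖ := by
  induction k with
  | zero => simp only [st, sub_self, norm_zero]; exact ⟨by positivity, norm_nonneg _⟩
  | succ k ih =>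
    simp only [st]
    unfold step
    split_ifs with h1 h2
    · simp only [sub_self, norm_zero]; exact ⟨by positivity, norm_nonneg _⟩
    · simp only [sub_self, norm_zero]; exact ⟨by positivity, not_lt.1 h1⟩
    · exact ⟨not_lt.1 h2, ih.2⟩

lemma st_snd_step (θ : ℝ) (V : ℕ → Ω → E) (k : ℕ) (x : Ω) :
    (st θ V (k+1) x).2 = (st θ V k x).2 ∨ (st θ V (k+1) x).2 = V (k+1) x := by
  simp only [st]; unfold step; split_ifs <;> simp

lemma st_fst_step (θ : ℝ) (V : ℕ → Ω → E) (k : ℕ) (x : Ω) :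
    (st θ V (k+1) x).1 = (st θ V k x).1 ∨ (st θ V (k+1) x).1 = V (k+1) x := by
  simp only [st]; unfold step; split_ifs <;> simp

/-- Cost of a change of the first component. -/
lemma st_cost0 (θ : ℝ) (V : ℕ → Ω → E) (k : ℕ) (x : Ω)
    (h : (st θ V (k+1) x).1 ≠ (st θ V k x).1) :
    ‖(st θ V (k+1) x).1‖ ^ 2 ≤ 4 * ‖(st θ V (k+1) x).1 - (st θ V k x).1‖ ^ 2 := by
  simp only [st, step_fst] at h ⊢
  split_ifs at h ⊢ with h1
  · have h2 : ‖V (k+1) x‖ ≤ ‖V (k+1) x - (st θ V k x).1‖ + ‖(st θ V k x).1‖ := by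
      simpa using norm_add_le (V (k+1) x - (st θ V k x).1) (st θ V k x).1
    have h3 : ‖V (k+1) x‖ ≤ 2 * ‖V (k+1) x - (st θ V k x).1‖ := by linarith
    calc _ ≤ (2 * ‖V (k+1) x - (st θ V k x).1‖) ^ 2 := pow_le_pow_left₀ (norm_nonneg _) h3 2
      _ = _ := by ring
  · exact absurd rfl h

/-- Cost of a change of state. -/
lemma st_cost {θ : ℝ} (hθ : 0 ≤ θ) (hθ1 : θ ≤ 1) (V : ℕ → Ω → E) (k : ℕ) (x : Ω)
    (h : (st θ V (k+1) x).2 ≠ (st θ V k x).2) :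
    θ ^ 2 * ‖(st θ V (k+1) x).1‖ ^ 2 ≤ 4 * ‖(st θ V (k+1) x).1 - (st θ V k x).1‖ ^ 2 +
      ‖(st θ V (k+1) x).2 - (st θ V k x).2‖ ^ 2 := by
  by_cases hc : (st θ V (k+1) x).1 = (st θ V k x).1
  · rw [hc, sub_self, norm_zero]
    have key : θ * ‖(st θ V k x).1‖ ≤ ‖(st θ V (k+1) x).2 - (st θ V k x).2‖ := by
      simp only [st] at hc h ⊢
      unfold step at hc h ⊢
      split_ifs at hc h ⊢ with h1 h2
      · simp only at hc
        rw [hc, sub_self, norm_zero] at h1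
        exact absurd h1 (not_lt.2 (norm_nonneg _))
      · exact h2.le
      · exact absurd rfl h
    have := pow_le_pow_left₀ (by positivity) key 2
    rw [mul_pow] at this; linarith
  · have h1 := st_cost0 θ V k x hc
    have h2 : θ ^ 2 ≤ 1 := pow_le_one₀ hθ hθ1
    nlinarith [sq_nonneg ‖(st θ V (k+1) x).1‖, sq_nonneg ‖(st θ V (k+1) x).2 - (st θ V k x).2‖]

end mart

lemma cell_orth {n e : ℕ} (he : e ≤ n) (R : Finset (Fin n → Bool))
    (hinj : ∀ η ∈ R, ∀ η' ∈ R, cls e η = cls e η' → η = η')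
    (v : (Fin n → Bool) → (Fin n → Bool) → ℝ) (hv : ∀ η, ∀ x y, Sx e x y → v η x = v η y) :
    ∑ x, (∑ η ∈ R, v η x * chi η x) ^ 2 = ∑ x, ∑ η ∈ R, v η x ^ 2 := by
  rw [← sum_Et he]
  refine Finset.sum_congr rfl fun x _ => ?_
  unfold Et
  have : ∀ y, (if Sx e x y then (∑ i ∈ R, v i y * chi i y) ^ 2 else 0) =
      ∑ i ∈ R, ∑ j ∈ R, v i x * v j x * (if Sx e x y then chi i y * chi j y else 0) := by
    intro y
    split_ifs with h
    · rw [sq, Finset.sum_mul_sum]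
      exact Finset.sum_congr rfl fun i _ => Finset.sum_congr rfl fun j _ => by
        rw [hv i x y h, hv j x y h]; ring
    · simp
  simp only [this]
  rw [Finset.sum_comm, Finset.mul_sum]
  refine Finset.sum_congr rfl fun i hi => ?_
  rw [Finset.sum_comm]
  simp only [← Finset.mul_sum, orth_space he]
  rw [Finset.sum_eq_single_of_mem i hi]
  · rw [if_pos rfl, chi_mul_self]; field_simp
  · intro j hj hne
    rw [if_neg, mul_zero]
    intro h; exact hne (hinj i hi j hj h).symm

lemma bessel {n e : ℕ} (he : e ≤ n) (R : Finset (Fin n → Bool))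
    (hinj : ∀ η ∈ R, ∀ η' ∈ R, cls e η = cls e η' → η = η') (f : (Fin n → Bool) → ℝ) :
    ∑ x, ∑ η ∈ R, Et e (fun y => chi η y * f y) x ^ 2 ≤ ∑ x, f x ^ 2 := by
  set v : (Fin n → Bool) → (Fin n → Bool) → ℝ := fun η => Et e (fun y => chi η y * f y) with hvd
  have hv : ∀ η, ∀ x y, Sx e x y → v η x = v η y := fun η x y h => Et_congr _ h
  have h1 := cell_orth he R hinj v hv
  have h2 : ∑ x, (∑ η ∈ R, v η x * chi η x) * f x = ∑ x, ∑ η ∈ R, v η x ^ 2 := by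
    simp only [Finset.sum_mul]
    rw [Finset.sum_comm, Finset.sum_comm (s := Finset.univ) (t := R)]
    refine Finset.sum_congr rfl fun η _ => ?_
    have := sum_Et_mul he (fun y => chi η y * f y) (v η) (hv η)
    simp only [sq]
    rw [this]
    exact Finset.sum_congr rfl fun x _ => by ring
  have h3 : 0 ≤ ∑ x, (f x - ∑ η ∈ R, v η x * chi η x) ^ 2 :=
    Finset.sum_nonneg fun _ _ => sq_nonneg _
  have h4 : ∑ x, (f x - ∑ η ∈ R, v η x * chi η x) ^ 2 = ∑ x, f x ^ 2 -
      2 * ∑ x, (∑ η ∈ R, v η x * chi η x) * f x + ∑ x, (∑ η ∈ R, v η x * chi η x) ^ 2 := by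
    rw [Finset.mul_sum, ← Finset.sum_sub_distrib, ← Finset.sum_add_distrib]
    exact Finset.sum_congr rfl fun x _ => by ring
  rw [h4, h1, h2] at h3
  linarith

lemma path_lem {n e l : ℕ} (he : e ≤ n) {r : ℝ} (hr : 2 < r) (R : Finset (Fin n → Bool))
    (hR : R.card ≤ 2 ^ l) (hinj : ∀ η ∈ R, ∀ η' ∈ R, cls e η = cls e η' → η = η')
    (a : ℕ → (Fin n → Bool) → ℝ) (ha : ∀ i ∈ R, VB r fun t => a t i)
    (U : ℕ → (Fin n → Bool) → EuclideanSpace ℝ (Fin n → Bool))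
    (hU : ∀ k, ∀ x y, Sx e x y → U k x = U k y)
    (τ κ : (Fin n → Bool) → ℕ) (d : ℕ) (hκ : ∀ x, κ x ≤ d) :
    ∑ x, (∑ η ∈ R, a (τ x) η * U (κ x) x η * chi η x) ^ 2 ≤
      Ksq r l * ∑ x, (‖U 0 x‖ ^ 2 + ∑ j ∈ Finset.range d,
        if U (j+1) x ≠ U j x then ‖U (j+1) x‖ ^ 2 else 0) := by
  -- selected indices
  let sel : ℕ → (Fin n → Bool) → Prop := fun j x => j = 0 ∨ U j x ≠ U (j-1) x
  have hsel : ∀ x k, ∃ j ≤ k, sel j x ∧ U j x = U k x := by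
    intro x k
    induction k with
    | zero => exact ⟨0, le_rfl, Or.inl rfl, rfl⟩
    | succ k ih =>
      by_cases h : U (k+1) x = U k x
      · obtain ⟨j, h1, h2, h3⟩ := ih
        exact ⟨j, by omega, h2, by rw [h3, h]⟩
      · exact ⟨k+1, le_rfl, Or.inr (by simpa using h), rfl⟩
  let v : ℕ → (Fin n → Bool) → (Fin n → Bool) → ℝ := fun j η x => if sel j x then U j x η else 0
  have hpt : ∀ x, (∑ η ∈ R, a (τ x) η * U (κ x) x η * chi η x) ^ 2 ≤
      ∑ j ∈ Finset.range (d+1), (∑ η ∈ R, a (τ x) η * v j η x * chi η x) ^ 2 := by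
    intro x
    obtain ⟨j, h1, h2, h3⟩ := hsel x (κ x)
    have := Finset.single_le_sum (f := fun j => (∑ η ∈ R, a (τ x) η * v j η x * chi η x) ^ 2)
      (s := Finset.range (d+1)) (fun i _ => sq_nonneg _)
      (Finset.mem_range.2 (by have := hκ x; omega : j < d+1))
    refine le_trans (le_of_eq ?_) this
    simp only [v, h2, if_true, h3]
  refine (Finset.sum_le_sum fun x _ => hpt x).trans ?_
  rw [Finset.sum_comm]
  have hK0 : 0 ≤ Ksq r l := zero_le_one.trans (Ksq_ge hr l)
  have hj : ∀ j ∈ Finset.range (d+1), ∑ x, (∑ η ∈ R, a (τ x) η * v j η x * chi η x) ^ 2 ≤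
      Ksq r l * ∑ x, if sel j x then ‖U j x‖ ^ 2 else 0 := by
    intro j _
    refine (K_glob he hr R hR hinj a ha (v j) ?_ τ).trans ?_
    · intro η x y h
      simp only [v, sel]
      rw [hU j x y h, hU (j-1) x y h]
    · refine mul_le_mul_of_nonneg_left (Finset.sum_le_sum fun x _ => ?_) hK0
      simp only [v]
      split_ifs
      · rw [EuclideanSpace.norm_sq_eq]
        simp only [Real.norm_eq_abs, sq_abs]
        exact Finset.sum_le_univ_sum_of_nonneg fun _ => sq_nonneg _
      · simp
  refine (Finset.sum_le_sum hj).trans ?_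
  rw [← Finset.mul_sum, Finset.sum_comm]
  refine mul_le_mul_of_nonneg_left (Finset.sum_le_sum fun x _ => ?_) hK0
  rw [Finset.sum_range_succ', add_comm]
  refine le_of_eq ?_
  simp [sel]

end SMM

namespace SMM

lemma path_bound {E : Type*} [NormedAddCommGroup E] (W D : ℕ → E) (d k : ℕ) (hk : k ≤ d)
    (h : ∀ j, W (j+1) ≠ W j → ‖W (j+1)‖ ^ 2 ≤ 4 * ‖D j‖ ^ 2) :
    ‖W k‖ ^ 2 ≤ ‖W 0‖ ^ 2 + ∑ j ∈ Finset.range d, 4 * ‖D j‖ ^ 2 := by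
  have h1 : ∀ k, ‖W k‖ ^ 2 ≤ ‖W 0‖ ^ 2 + ∑ j ∈ Finset.range k, 4 * ‖D j‖ ^ 2 := by
    intro k
    induction k with
    | zero => simp
    | succ k ih =>
      rw [Finset.sum_range_succ]
      by_cases hc : W (k+1) = W k
      · rw [hc]; have := sq_nonneg ‖D k‖; linarith
      · have h2 := h k hc
        have h3 : 0 ≤ ∑ j ∈ Finset.range k, 4 * ‖D j‖ ^ 2 :=
          Finset.sum_nonneg fun _ _ => by positivity
        have := sq_nonneg ‖W 0‖
        linarith
  refine (h1 k).trans ?_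
  gcongr

/-- The estimate on a window without branching. -/
lemma base_case {n s e l : ℕ} (hse : s ≤ e) (he : e ≤ n) {r : ℝ} (hr : 2 < r)
    (R : Finset (Fin n → Bool)) (hR : R.card ≤ 2 ^ l)
    (hinj : ∀ η ∈ R, ∀ η' ∈ R, cls e η = cls e η' → η = η')
    (a : ℕ → (Fin n → Bool) → ℝ) (ha : ∀ i ∈ R, VB r fun t => a t i)
    (f : (Fin n → Bool) → ℝ) (τ : (Fin n → Bool) → ℕ) (hτ : ∀ x, s ≤ τ x ∧ τ x ≤ e) :
    ∑ x, (∑ η ∈ R, a (τ x) η * Et (τ x) (fun y => chi η y * f y) x * chi η x) ^ 2 ≤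
      216 * ((l:ℝ) + 1) ^ 2 * Ksq r l * ∑ x, f x ^ 2 := by
  let A : ℕ → (Fin n → Bool) → (Fin n → Bool) → Prop := fun k => Sx (min (s+k) e)
  let V : ℕ → (Fin n → Bool) → EuclideanSpace ℝ (Fin n → Bool) := fun k x =>
    WithLp.toLp 2 fun η => if η ∈ R then Et (min (s+k) e) (fun y => chi η y * f y) x else 0
  have hA : ∀ k x y, A (k+1) x y → A k x y := fun k x y h =>
    Sx.mono (by omega) h
  have hAe : ∀ k x y, Sx e x y → A k x y := fun k x y h => Sx.mono (by omega) h
  have hV : ∀ k x y, A k x y → V k x = V k y := by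
    intro k x y h
    simp only [V]
    congr 1; funext η
    rw [Et_congr _ h]
  have hVm : ∀ k (φ : (Fin n → Bool) → EuclideanSpace ℝ (Fin n → Bool)),
      (∀ x y, A k x y → φ x = φ y) → ∑ x, inner ℝ (φ x) (V (k+1) x - V k x) = 0 := by
    intro k φ hφ
    simp only [PiLp.inner_apply]
    rw [Finset.sum_comm]
    refine Finset.sum_eq_zero fun η _ => ?_
    by_cases hη : η ∈ R
    · have h1 := sum_Et_mul (t := min (s+(k+1)) e) (by omega) (fun y => chi η y * f y)
        (fun x => φ x η) (fun x y h => by rw [hφ x y (hA _ _ _ h)])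
      have h2 := sum_Et_mul (t := min (s+k) e) (by omega) (fun y => chi η y * f y)
        (fun x => φ x η) (fun x y h => by rw [hφ x y h])
      have h3 := h1.trans h2.symm
      rw [← sub_eq_zero, ← Finset.sum_sub_distrib] at h3
      rw [← h3]
      refine Finset.sum_congr rfl fun x _ => ?_
      simp only [V, PiLp.sub_apply, hη, if_true, RCLike.inner_apply, conj_trivial]
      ring
    · refine Finset.sum_eq_zero fun x _ => ?_
      simp [V, hη]
  set d := e - s with hd
  set κ : (Fin n → Bool) → ℕ := fun x => τ x - s with hκ
  have hκd : ∀ x, κ x ≤ d := fun x => by have := hτ x; simp only [hκ]; omega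
  have hκτ : ∀ x, min (s + κ x) e = τ x := fun x => by
    have := hτ x; simp only [hκ]; omega
  set S := ∑ x, ‖V d x‖ ^ 2 with hS
  have hSf : S ≤ ∑ x, f x ^ 2 := by
    refine le_trans (le_of_eq ?_) (bessel he R hinj f)
    refine Finset.sum_congr rfl fun x _ => ?_
    rw [EuclideanSpace.norm_sq_eq]
    have hde : min (s + d) e = e := by omega
    simp only [V, hde, Real.norm_eq_abs, sq_abs]
    rw [← Finset.sum_filter_add_sum_filter_not Finset.univ (fun η => η ∈ R),
      Finset.filter_mem_eq_inter, Finset.univ_inter,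
      Finset.sum_congr rfl (g := fun η => Et e (fun y => chi η y * f y) x ^ 2)
        (fun η hη => by rw [if_pos hη]), add_eq_left]
    refine Finset.sum_eq_zero fun η hη => ?_
    rw [if_neg (Finset.mem_filter.1 hη).2]; norm_num
  have hS0 : 0 ≤ S := Finset.sum_nonneg fun _ _ => sq_nonneg _
  let θ : ℕ → ℝ := fun i => (1/2:ℝ) ^ i
  have hθ0 : ∀ i, 0 ≤ θ i := fun i => by positivity
  have hθ1 : ∀ i, θ i ≤ 1 := fun i => pow_le_one₀ (by norm_num) (by norm_num)
  let Wl : ℕ → ℕ → (Fin n → Bool) → EuclideanSpace ℝ (Fin n → Bool) := fun i k x =>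
    (st (θ i) V k x).2
  let W0 : ℕ → (Fin n → Bool) → EuclideanSpace ℝ (Fin n → Bool) := fun k x => (st 1 V k x).1
  have hW0θ : ∀ i k x, (st (θ i) V k x).1 = W0 k x := fun i k x => st_fst _ _ _ _ _
  have hWle : ∀ i k x y, Sx e x y → Wl i k x = Wl i k y := fun i k x y h => by
    simp only [Wl]; rw [st_ad A hA (θ i) V hV k x y (hAe k x y h)]
  -- energies
  have hE : ∀ i, ∑ x, (‖Wl i 0 x‖ ^ 2 + ∑ j ∈ Finset.range d, ‖Wl i (j+1) x - Wl i j x‖ ^ 2) ≤ S := by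
    intro i
    have h := frozen A V (Wl i) hV hVm
      (fun k x y h => by simp only [Wl]; rw [st_ad A hA (θ i) V hV k x y h])
      (fun x => rfl) (fun k x => st_snd_step _ _ _ _) d
    rw [hS, ← h]
    refine Finset.sum_le_sum fun x _ => ?_
    have := sq_nonneg ‖V d x - Wl i d x‖
    linarith
  have hE0 : ∑ x, (‖W0 0 x‖ ^ 2 + ∑ j ∈ Finset.range d, ‖W0 (j+1) x - W0 j x‖ ^ 2) ≤ S := by
    have h := frozen A V W0 hV hVm
      (fun k x y h => by simp only [W0]; rw [st_ad A hA 1 V hV k x y h])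
      (fun x => rfl) (fun k x => st_fst_step _ _ _ _) d
    rw [hS, ← h]
    refine Finset.sum_le_sum fun x _ => ?_
    have := sq_nonneg ‖V d x - W0 d x‖
    linarith
  have hVW : ∀ i k x, ‖V k x - Wl i k x‖ ≤ θ i * ‖W0 k x‖ := by
    intro i k x
    have := (st_inv (hθ0 i) V k x).1
    rwa [hW0θ] at this
  have hcost : ∀ i j x, Wl i (j+1) x ≠ Wl i j x → θ i ^ 2 * ‖W0 (j+1) x‖ ^ 2 ≤
      4 * ‖W0 (j+1) x - W0 j x‖ ^ 2 + ‖Wl i (j+1) x - Wl i j x‖ ^ 2 := by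
    intro i j x h
    have := st_cost (hθ0 i) (hθ1 i) V j x h
    rwa [hW0θ, hW0θ] at this
  -- decomposition
  let Wp : ℕ → ℕ → (Fin n → Bool) → EuclideanSpace ℝ (Fin n → Bool) := fun i k x =>
    if i = 0 then 0 else if i ≤ l + 1 then Wl (i-1) k x else V k x
  let U : ℕ → ℕ → (Fin n → Bool) → EuclideanSpace ℝ (Fin n → Bool) := fun i k x =>
    Wp (i+1) k x - Wp i k x
  have hsum : ∀ k x, ∑ i ∈ Finset.range (l+2), U i k x = V k x := by
    intro k x
    simp only [U]
    rw [Finset.sum_range_sub (fun i => Wp i k x)]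
    simp [Wp]
  have hK1 := Ksq_ge hr l
  set K := Ksq r l with hK
  have hbound : ∀ i ∈ Finset.range (l+2),
      ∑ x, (∑ η ∈ R, a (τ x) η * U i (κ x) x η * chi η x) ^ 2 ≤ 54 * K * S := by
    intro i hi
    rw [Finset.mem_range] at hi
    rcases Nat.eq_zero_or_pos i with h0 | hpos
    · -- level zero
      have hU0 : U 0 = Wl 0 := by
        funext k x; simp [U, Wp]
      rw [h0, hU0]
      refine (path_lem he hr R hR hinj a ha (Wl 0) (hWle 0) τ κ d hκd).trans ?_
      rw [mul_comm 54 K, mul_assoc]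
      refine mul_le_mul_of_nonneg_left ?_ (by linarith)
      have hx : ∀ x, ‖Wl 0 0 x‖ ^ 2 + (∑ j ∈ Finset.range d,
          if Wl 0 (j+1) x ≠ Wl 0 j x then ‖Wl 0 (j+1) x‖ ^ 2 else 0) ≤
          4 * (‖Wl 0 0 x‖ ^ 2 + ∑ j ∈ Finset.range d, ‖Wl 0 (j+1) x - Wl 0 j x‖ ^ 2) +
          16 * (‖W0 0 x‖ ^ 2 + ∑ j ∈ Finset.range d, ‖W0 (j+1) x - W0 j x‖ ^ 2) := by
        intro x
        have : ∀ j ∈ Finset.range d, (if Wl 0 (j+1) x ≠ Wl 0 j x then ‖Wl 0 (j+1) x‖ ^ 2 else 0) ≤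
          4 * ‖Wl 0 (j+1) x - Wl 0 j x‖ ^ 2 + 16 * ‖W0 (j+1) x - W0 j x‖ ^ 2 := by
          intro j _
          split_ifs with hne
          · have h1 := hcost 0 j x hne
            have h2 : ‖Wl 0 (j+1) x‖ ≤ 2 * ‖W0 (j+1) x‖ := by
              have h3 := (st_inv (hθ0 0) V (j+1) x).2
              rw [hW0θ] at h3
              have h4 := norm_add_le ((st (θ 0) V (j+1) x).2 - W0 (j+1) x) (W0 (j+1) x)
              rw [sub_add_cancel] at h4
              simp only [Wl]; linarith
            have h5 := pow_le_pow_left₀ (norm_nonneg _) h2 2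
            simp only [θ, pow_zero, one_pow, one_mul] at h1
            rw [mul_pow] at h5
            linarith
          · positivity
        have h6 := Finset.sum_le_sum this
        rw [Finset.sum_add_distrib, ← Finset.mul_sum, ← Finset.mul_sum] at h6
        have := sq_nonneg ‖W0 0 x‖
        have := sq_nonneg ‖Wl 0 0 x‖
        linarith
      refine (Finset.sum_le_sum fun x _ => hx x).trans ?_
      rw [Finset.sum_add_distrib, ← Finset.mul_sum, ← Finset.mul_sum]
      have := hE 0
      linarith
    · obtain ⟨i, rfl⟩ : ∃ i', i = i' + 1 := ⟨i - 1, by omega⟩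
      by_cases hil : i + 1 ≤ l
      · -- middle levels
        have hUi : U (i+1) = fun k x => Wl (i+1) k x - Wl i k x := by
          funext k x
          have h1 : i ≤ l := by omega
          simp [U, Wp, hil, h1]
        rw [hUi]
        refine (path_lem he hr R hR hinj a ha (fun k x => Wl (i+1) k x - Wl i k x)
          (fun k x y h => by rw [hWle _ _ _ _ h, hWle _ _ _ _ h]) τ κ d hκd).trans ?_
        rw [mul_comm 54 K, mul_assoc]
        refine mul_le_mul_of_nonneg_left ?_ (by linarith)
        have hx : ∀ x, ‖Wl (i+1) 0 x - Wl i 0 x‖ ^ 2 + (∑ j ∈ Finset.range d,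
          if Wl (i+1) (j+1) x - Wl i (j+1) x ≠ Wl (i+1) j x - Wl i j x then
            ‖Wl (i+1) (j+1) x - Wl i (j+1) x‖ ^ 2 else 0) ≤
          9 * (‖Wl (i+1) 0 x‖ ^ 2 + ∑ j ∈ Finset.range d, ‖Wl (i+1) (j+1) x - Wl (i+1) j x‖ ^ 2) +
          9 * (‖Wl i 0 x‖ ^ 2 + ∑ j ∈ Finset.range d, ‖Wl i (j+1) x - Wl i j x‖ ^ 2) +
          36 * (‖W0 0 x‖ ^ 2 + ∑ j ∈ Finset.range d, ‖W0 (j+1) x - W0 j x‖ ^ 2) := by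
          intro x
          have : ∀ j ∈ Finset.range d, (if Wl (i+1) (j+1) x - Wl i (j+1) x ≠
              Wl (i+1) j x - Wl i j x then
              ‖Wl (i+1) (j+1) x - Wl i (j+1) x‖ ^ 2 else 0) ≤
              9 * ‖Wl (i+1) (j+1) x - Wl (i+1) j x‖ ^ 2 + 9 * ‖Wl i (j+1) x - Wl i j x‖ ^ 2 +
                36 * ‖W0 (j+1) x - W0 j x‖ ^ 2 := by
            intro j _
            split_ifs with hne
            · have hθs : θ i = 2 * θ (i+1) := by simp only [θ]; ring
              have h1 : θ (i+1) ^ 2 * ‖W0 (j+1) x‖ ^ 2 ≤ 4 * ‖W0 (j+1) x - W0 j x‖ ^ 2 +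
                  ‖Wl (i+1) (j+1) x - Wl (i+1) j x‖ ^ 2 + ‖Wl i (j+1) x - Wl i j x‖ ^ 2 := by
                have n1 := sq_nonneg ‖Wl (i+1) (j+1) x - Wl (i+1) j x‖
                have n2 := sq_nonneg ‖Wl i (j+1) x - Wl i j x‖
                by_cases h2 : Wl (i+1) (j+1) x = Wl (i+1) j x
                · have h3 : Wl i (j+1) x ≠ Wl i j x := by
                    intro h3; rw [h2, h3] at hne; exact hne rfl
                  have h4 := hcost i j x h3
                  rw [hθs] at h4
                  have := mul_nonneg (sq_nonneg (θ (i+1))) (sq_nonneg ‖W0 (j+1) x‖)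
                  nlinarith
                · have := hcost (i+1) j x h2
                  linarith
              have h5 : ‖Wl (i+1) (j+1) x - Wl i (j+1) x‖ ≤ 3 * (θ (i+1) * ‖W0 (j+1) x‖) := by
                have h6 := hVW (i+1) (j+1) x
                have h7 := hVW i (j+1) x
                rw [hθs] at h7
                have h8 := norm_sub_le (V (j+1) x - Wl i (j+1) x) (V (j+1) x - Wl (i+1) (j+1) x)
                rw [sub_sub_sub_cancel_left] at h8
                linarith
              have h9 := pow_le_pow_left₀ (norm_nonneg _) h5 2
              rw [mul_pow, mul_pow] at h9
              linarith
            · positivity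
          have h6 := Finset.sum_le_sum this
          rw [Finset.sum_add_distrib, Finset.sum_add_distrib, ← Finset.mul_sum, ← Finset.mul_sum,
            ← Finset.mul_sum] at h6
          have h0 : Wl (i+1) 0 x - Wl i 0 x = 0 := by simp [Wl, st]
          rw [h0, norm_zero]
          have := sq_nonneg ‖W0 0 x‖
          have := sq_nonneg ‖Wl i 0 x‖
          have := sq_nonneg ‖Wl (i+1) 0 x‖
          linarith
        refine (Finset.sum_le_sum fun x _ => hx x).trans ?_
        rw [Finset.sum_add_distrib, Finset.sum_add_distrib, ← Finset.mul_sum, ← Finset.mul_sum,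
          ← Finset.mul_sum]
        have := hE (i+1)
        have := hE i
        linarith
      · -- remainder
        have hil' : i = l := by omega
        subst hil'
        have hUi : U (i+1) = fun k x => V k x - Wl i k x := by
          funext k x; simp [U, Wp]
        rw [hUi]
        have hx : ∀ x, (∑ η ∈ R, a (τ x) η * (V (κ x) x - Wl i (κ x) x) η * chi η x) ^ 2 ≤
            4 * (‖W0 0 x‖ ^ 2 + ∑ j ∈ Finset.range d, ‖W0 (j+1) x - W0 j x‖ ^ 2) := by
          intro x
          set Z := V (κ x) x - Wl i (κ x) x with hZ
          have h1 : (∑ η ∈ R, a (τ x) η * Z η * chi η x) ^ 2 ≤ 2 ^ i * ‖Z‖ ^ 2 := by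
            have h2 := Finset.sum_mul_sq_le_sq_mul_sq R (fun η => a (τ x) η * chi η x) (fun η => Z η)
            have h3 : ∑ η ∈ R, (a (τ x) η * chi η x) ^ 2 ≤ 2 ^ i := by
              calc _ ≤ ∑ η ∈ R, (1:ℝ) := Finset.sum_le_sum fun η hη => by
                    rw [mul_pow, chi_sq, mul_one, ← sq_abs]
                    exact pow_le_one₀ (abs_nonneg _) ((ha η hη).1 _)
                _ = R.card := by simp
                _ ≤ 2 ^ i := by exact_mod_cast hR
            have h4 : ∑ η ∈ R, Z η ^ 2 ≤ ‖Z‖ ^ 2 := by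
              rw [EuclideanSpace.norm_sq_eq]
              simp only [Real.norm_eq_abs, sq_abs]
              exact Finset.sum_le_univ_sum_of_nonneg fun _ => sq_nonneg _
            calc (∑ η ∈ R, a (τ x) η * Z η * chi η x) ^ 2 =
                  (∑ η ∈ R, a (τ x) η * chi η x * Z η) ^ 2 := by
                    congr 1; exact Finset.sum_congr rfl fun η _ => by ring
              _ ≤ _ := h2
              _ ≤ _ := mul_le_mul h3 h4 (Finset.sum_nonneg fun _ _ => sq_nonneg _) (by positivity)
          have h5 : 2 ^ i * ‖Z‖ ^ 2 ≤ ‖W0 (κ x) x‖ ^ 2 := by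
            have h6 := pow_le_pow_left₀ (norm_nonneg _) (hVW i (κ x) x) 2
            rw [mul_pow] at h6
            have h7 : 2 ^ i * θ i ^ 2 ≤ 1 := by
              have : (2:ℝ) ^ i * θ i = 1 := by simp only [θ]; rw [← mul_pow]; norm_num
              rw [sq, ← mul_assoc, this, one_mul]; exact hθ1 i
            calc 2 ^ i * ‖Z‖ ^ 2 ≤ 2 ^ i * (θ i ^ 2 * ‖W0 (κ x) x‖ ^ 2) :=
                  mul_le_mul_of_nonneg_left h6 (by positivity)
              _ = (2 ^ i * θ i ^ 2) * ‖W0 (κ x) x‖ ^ 2 := by ring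
              _ ≤ 1 * ‖W0 (κ x) x‖ ^ 2 := mul_le_mul_of_nonneg_right h7 (sq_nonneg _)
              _ = _ := one_mul _
          have h8 := path_bound (fun k => W0 k x) (fun j => W0 (j+1) x - W0 j x) d (κ x) (hκd x)
            (fun j hj => st_cost0 1 V j x hj)
          rw [← Finset.mul_sum] at h8
          have := sq_nonneg ‖W0 0 x‖
          linarith
        refine (Finset.sum_le_sum fun x _ => hx x).trans ?_
        rw [← Finset.mul_sum]
        nlinarith
  have hpt : ∀ x, (∑ η ∈ R, a (τ x) η * Et (τ x) (fun y => chi η y * f y) x * chi η x) ^ 2 ≤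
      ((l:ℝ) + 2) * ∑ i ∈ Finset.range (l+2),
        (∑ η ∈ R, a (τ x) η * U i (κ x) x η * chi η x) ^ 2 := by
    intro x
    have h1 : ∑ η ∈ R, a (τ x) η * Et (τ x) (fun y => chi η y * f y) x * chi η x =
        ∑ i ∈ Finset.range (l+2), ∑ η ∈ R, a (τ x) η * U i (κ x) x η * chi η x := by
      rw [Finset.sum_comm]
      refine Finset.sum_congr rfl fun η hη => ?_
      rw [← Finset.sum_mul, ← Finset.mul_sum]
      congr 2
      have h2 := hsum (κ x) x
      have h3 : (∑ i ∈ Finset.range (l+2), U i (κ x) x) η = V (κ x) x η := by rw [h2]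
      rw [WithLp.ofLp_sum, Finset.sum_apply] at h3
      rw [h3]
      simp only [V, hκτ, hη, if_true]
    rw [h1]
    have h2 := sq_sum_le_card_mul_sum_sq (s := Finset.range (l+2)) (f := fun i =>
      ∑ η ∈ R, a (τ x) η * U i (κ x) x η * chi η x)
    rw [Finset.card_range] at h2
    push_cast at h2
    exact h2
  refine (Finset.sum_le_sum fun x _ => hpt x).trans ?_
  rw [← Finset.mul_sum, Finset.sum_comm]
  have h3 := Finset.sum_le_sum hbound
  rw [Finset.sum_const, Finset.card_range, nsmul_eq_mul] at h3
  push_cast at h3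
  have hl : (0:ℝ) ≤ l := by positivity
  have h4 : 54 * K * S ≤ 54 * K * ∑ x, f x ^ 2 := mul_le_mul_of_nonneg_left hSf (by linarith)
  have hF : 0 ≤ 54 * K * ∑ x, f x ^ 2 := by positivity
  calc _ ≤ ((l:ℝ) + 2) * (((l:ℝ) + 2) * (54 * K * S)) :=
        mul_le_mul_of_nonneg_left h3 (by positivity)
    _ ≤ ((l:ℝ) + 2) * (((l:ℝ) + 2) * (54 * K * ∑ x, f x ^ 2)) := by gcongr
    _ = ((l:ℝ) + 2) ^ 2 * (54 * K * ∑ x, f x ^ 2) := by ring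
    _ ≤ (4 * ((l:ℝ) + 1) ^ 2) * (54 * K * ∑ x, f x ^ 2) :=
        mul_le_mul_of_nonneg_right (by nlinarith) hF
    _ = _ := by ring

end SMM

namespace SMM

/-- The `ℓ²` norm on the finite model. -/
def N2 {n : ℕ} (f : (Fin n → Bool) → ℝ) : ℝ := Real.sqrt (∑ x, f x ^ 2)

lemma N2_nonneg {n : ℕ} (f : (Fin n → Bool) → ℝ) : 0 ≤ N2 f := Real.sqrt_nonneg _

lemma N2_sq {n : ℕ} (f : (Fin n → Bool) → ℝ) : N2 f ^ 2 = ∑ x, f x ^ 2 :=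
  Real.sq_sqrt (Finset.sum_nonneg fun _ _ => sq_nonneg _)

lemma N2_eq_norm {n : ℕ} (f : (Fin n → Bool) → ℝ) :
    N2 f = ‖(WithLp.toLp 2 f : EuclideanSpace ℝ (Fin n → Bool))‖ := by
  rw [EuclideanSpace.norm_eq]; simp [N2]

lemma N2_add {n : ℕ} (f g : (Fin n → Bool) → ℝ) : N2 (fun x => f x + g x) ≤ N2 f + N2 g := by
  rw [N2_eq_norm, N2_eq_norm, N2_eq_norm]
  exact norm_add_le (WithLp.toLp 2 f : EuclideanSpace ℝ (Fin n → Bool)) (WithLp.toLp 2 g)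

lemma N2_sub {n : ℕ} (f g : (Fin n → Bool) → ℝ) : N2 (fun x => f x - g x) ≤ N2 f + N2 g := by
  rw [N2_eq_norm, N2_eq_norm, N2_eq_norm]
  exact norm_sub_le (WithLp.toLp 2 f : EuclideanSpace ℝ (Fin n → Bool)) (WithLp.toLp 2 g)

lemma N2_le_of_sq {n : ℕ} {f : (Fin n → Bool) → ℝ} {g : (Fin n → Bool) → ℝ} {B : ℝ} (hB : 0 ≤ B)
    (h : ∑ x, f x ^ 2 ≤ B ^ 2 * ∑ x, g x ^ 2) : N2 f ≤ B * N2 g := by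
  rw [← N2_sq, ← N2_sq, ← mul_pow] at h
  exact (pow_le_pow_iff_left₀ (N2_nonneg _) (mul_nonneg hB (N2_nonneg _)) two_ne_zero).1 h

lemma N2_mono {n : ℕ} {f g : (Fin n → Bool) → ℝ} (h : ∀ x, f x ^ 2 ≤ g x ^ 2) : N2 f ≤ N2 g :=
  Real.sqrt_le_sqrt (Finset.sum_le_sum fun x _ => h x)

/-- Indicator of the frequency classes of level `t` which meet `Ξ`. -/
def ind {n : ℕ} (Ξ : Finset (Fin n → Bool)) (t : ℕ) (ξ : Fin n → Bool) : ℝ :=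
  if cls t ξ ∈ Ξ.image (cls t) then 1 else 0

lemma ind_sq {n : ℕ} (Ξ : Finset (Fin n → Bool)) (t : ℕ) (ξ : Fin n → Bool) :
    ind Ξ t ξ * ind Ξ t ξ = ind Ξ t ξ := by unfold ind; split_ifs <;> simp

lemma ind_congr {n : ℕ} (Ξ : Finset (Fin n → Bool)) {t : ℕ} {ξ η : Fin n → Bool}
    (h : cls t ξ = cls t η) : ind Ξ t ξ = ind Ξ t η := by unfold ind; rw [h]

lemma ind_mul {n : ℕ} (Ξ : Finset (Fin n → Bool)) {s t : ℕ} (h : s ≤ t) (ξ : Fin n → Bool) :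
    ind Ξ t ξ * ind Ξ s ξ = ind Ξ s ξ := by
  unfold ind
  by_cases h1 : cls s ξ ∈ Ξ.image (cls s)
  · have h2 : cls t ξ ∈ Ξ.image (cls t) := by
      rw [Finset.mem_image] at h1 ⊢
      obtain ⟨a, ha, hb⟩ := h1
      refine ⟨a, ha, ?_⟩
      rw [← cls_cls h a, hb, cls_cls h]
    rw [if_pos h1, if_pos h2]; ring
  · rw [if_neg h1, mul_zero]

lemma abs_ind {n : ℕ} (Ξ : Finset (Fin n → Bool)) (t : ℕ) (ξ : Fin n → Bool) :
    |ind Ξ t ξ| ≤ 1 := by unfold ind; split_ifs <;> simp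

lemma ind_one {n : ℕ} (Ξ : Finset (Fin n → Bool)) {s t : ℕ} (hst : s ≤ t) {η : Fin n → Bool}
    (h : η ∈ Ξ.image (cls s)) : ind Ξ t η = 1 := by
  rw [Finset.mem_image] at h
  obtain ⟨a, ha, rfl⟩ := h
  unfold ind
  rw [if_pos]
  rw [cls_cls hst]
  exact Finset.mem_image_of_mem _ ha

lemma inj_self {n : ℕ} (Ξ : Finset (Fin n → Bool)) (s : ℕ) :
    ∀ η ∈ Ξ.image (cls s), ∀ η' ∈ Ξ.image (cls s), cls s η = cls s η' → η = η' := by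
  intro η hη η' hη' h
  rw [Finset.mem_image] at hη hη'
  obtain ⟨a, _, rfl⟩ := hη
  obtain ⟨b, _, rfl⟩ := hη'
  rwa [cls_cls le_rfl, cls_cls le_rfl] at h

lemma Dt_rep {n s e t : ℕ} (hst : s ≤ t) (hte : t ≤ e) (he : e ≤ n) (Ξ : Finset (Fin n → Bool))
    (hinj : ∀ η ∈ Ξ.image (cls s), ∀ η' ∈ Ξ.image (cls s), cls e η = cls e η' → η = η')
    (m : (Fin n → Bool) → ℝ) (hm : ∀ ξ η, cls t ξ = cls t η → m ξ = m η)
    (f : (Fin n → Bool) → ℝ) (x : Fin n → Bool) :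
    Tm (fun ξ => m ξ * ind Ξ t ξ) f x =
      ∑ η ∈ Ξ.image (cls s), m η * Et t (fun y => chi η y * f y) x * chi η x := by
  rw [Tm_rep (hte.trans he) (fun ξ => m ξ * ind Ξ t ξ) f (Ξ.image (cls s))]
  · refine Finset.sum_congr rfl fun η hη => ?_
    rw [ind_one Ξ hst hη]; ring
  · intro ξ η h; rw [hm ξ η h, ind_congr Ξ h]
  · intro ξ hξ
    have h1 : cls t ξ ∈ Ξ.image (cls t) := by
      by_contra h; exact hξ (by simp [ind, h])
    rw [Finset.mem_image] at h1
    obtain ⟨a, ha, hb⟩ := h1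
    exact ⟨cls s a, Finset.mem_image_of_mem _ ha, by rw [cls_cls hst, hb]⟩
  · intro η hη η' hη' h
    apply hinj η hη η' hη'
    rw [← cls_cls hte η, h, cls_cls hte]

/-- Number of frequency classes of level `t`. -/
def bet {n : ℕ} (Ξ : Finset (Fin n → Bool)) (t : ℕ) : ℕ := (Ξ.image (cls t)).card

lemma image_image_cls {n : ℕ} (Ξ : Finset (Fin n → Bool)) {s t : ℕ} (h : s ≤ t) :
    (Ξ.image (cls s)).image (cls t) = Ξ.image (cls t) := by
  rw [Finset.image_image]
  exact Finset.image_congr fun x _ => cls_cls h x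

lemma bet_anti {n : ℕ} (Ξ : Finset (Fin n → Bool)) {s t : ℕ} (h : s ≤ t) : bet Ξ t ≤ bet Ξ s := by
  unfold bet; rw [← image_image_cls Ξ h]; exact Finset.card_image_le

lemma N2_proj {n : ℕ} (Ξ : Finset (Fin n → Bool)) (k : ℕ) (f : (Fin n → Bool) → ℝ) :
    N2 (Tm (ind Ξ k) f) ^ 2 + N2 (fun x => f x - Tm (ind Ξ k) f x) ^ 2 = N2 f ^ 2 := by
  have h : (fun x => f x - Tm (ind Ξ k) f x) = Tm (fun ξ => 1 - ind Ξ k ξ) f := by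
    funext x; rw [Tm_msub, Tm_one]
  have h0 : ∑ x, Tm (fun _ => 1) f x ^ 2 = ∑ x, f x ^ 2 := by simp only [Tm_one]
  rw [h, N2_sq, N2_sq, N2_sq, ← h0, Tm_sq, Tm_sq, Tm_sq, ← mul_add, ← Finset.sum_add_distrib]
  congr 1
  refine Finset.sum_congr rfl fun ξ _ => ?_
  have := ind_sq Ξ k ξ
  rw [← add_mul]
  congr 1
  nlinarith

lemma recursion {n l : ℕ} {r : ℝ} (hr : 2 < r) (Ξ : Finset (Fin n → Bool)) (hΞ : Ξ.card ≤ 2 ^ l)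
    (m : ℕ → (Fin n → Bool) → ℝ) (h1 : ∀ t ξ η, cls t ξ = cls t η → m t ξ = m t η)
    (h3 : ∀ ξ, VB r fun t => m t ξ) (j : ℕ) :
    ∀ s e : ℕ, s ≤ e → e ≤ n → bet Ξ s - bet Ξ e < 2 ^ j →
    ∀ (f : (Fin n → Bool) → ℝ) (τ : (Fin n → Bool) → ℕ), (∀ x, s ≤ τ x ∧ τ x ≤ e) →
    N2 (fun x => Tm (fun ξ => m (τ x) ξ * ind Ξ (τ x) ξ) f x) ≤
      (15 * ((l:ℝ)+1) * Real.sqrt (Ksq r l) + j * Real.sqrt (Ksq r l)) * N2 f := by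
  have hK1 := Ksq_ge hr l
  set K := Real.sqrt (Ksq r l) with hK
  have hKsq : K ^ 2 = Ksq r l := Real.sq_sqrt (by linarith)
  have hK0 : 0 ≤ K := Real.sqrt_nonneg _
  have hcard : ∀ s, (Ξ.image (cls s)).card ≤ 2 ^ l := fun s => Finset.card_image_le.trans hΞ
  induction j with
  | zero =>
    intro s e hse he hb f τ hτ
    have hb' : bet Ξ e = bet Ξ s := by have := bet_anti Ξ hse; omega
    have hinj : ∀ η ∈ Ξ.image (cls s), ∀ η' ∈ Ξ.image (cls s), cls e η = cls e η' → η = η' := by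
      unfold bet at hb'
      rw [← image_image_cls Ξ hse, Finset.card_image_iff] at hb'
      intro η hη η' hη' h
      exact hb' hη hη' h
    apply N2_le_of_sq (by positivity)
    have hB := base_case hse he hr (Ξ.image (cls s)) (hcard s) hinj m (fun i _ => h3 i) f τ hτ
    have hrep : ∀ x, Tm (fun ξ => m (τ x) ξ * ind Ξ (τ x) ξ) f x =
        ∑ η ∈ Ξ.image (cls s), m (τ x) η * Et (τ x) (fun y => chi η y * f y) x * chi η x :=
      fun x => Dt_rep (hτ x).1 (hτ x).2 he Ξ hinj (m (τ x)) (h1 _) f x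
    simp only [hrep]
    refine hB.trans ?_
    rw [← hKsq]
    refine mul_le_mul_of_nonneg_right ?_ (Finset.sum_nonneg fun _ _ => sq_nonneg _)
    push_cast
    have : 0 ≤ ((l:ℝ)+1)^2 * K^2 := by positivity
    nlinarith
  | succ j ih =>
    intro s e hse he hb f τ hτ
    have hpow : 2 ^ (j+1) = 2 * 2 ^ j := by ring
    set B := 15 * ((l:ℝ)+1) * K + j * K with hBd
    have hB0 : 0 ≤ B := by positivity
    -- the splitting level
    obtain ⟨k, hsk, hke, hk1, hk2⟩ : ∃ k, s ≤ k ∧ k ≤ e ∧ bet Ξ s + bet Ξ e ≤ 2 * bet Ξ k ∧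
        (k < e → 2 * bet Ξ (k+1) < bet Ξ s + bet Ξ e) := by
      let Q : ℕ → Prop := fun k => s ≤ k ∧ bet Ξ s + bet Ξ e ≤ 2 * bet Ξ k
      have hQs : Q s := ⟨le_rfl, by have := bet_anti Ξ hse; omega⟩
      refine ⟨Nat.findGreatest Q e, ?_, Nat.findGreatest_le e, ?_, ?_⟩
      · exact (Nat.findGreatest_spec (P := Q) hse hQs).1
      · exact (Nat.findGreatest_spec (P := Q) hse hQs).2
      · intro hlt
        by_contra hcon
        have hQ : Q (Nat.findGreatest Q e + 1) :=
          ⟨((Nat.findGreatest_spec (P := Q) hse hQs).1).trans (Nat.le_succ _), not_lt.1 hcon⟩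
        have := Nat.le_findGreatest (P := Q) (n := e) hlt hQ
        omega
    have hbk := bet_anti Ξ hsk
    have hbk2 := bet_anti Ξ hke
    set f1 := Tm (ind Ξ k) f with hf1
    set f2 : (Fin n → Bool) → ℝ := fun x => f x - f1 x with hf2
    have hpy : N2 f1 ^ 2 + N2 f2 ^ 2 = N2 f ^ 2 := N2_proj Ξ k f
    have e0 : ∀ t x, Tm (fun ξ => m t ξ * ind Ξ t ξ) f x =
        Tm (fun ξ => m t ξ * ind Ξ t ξ) f1 x + Tm (fun ξ => m t ξ * ind Ξ t ξ) f2 x := by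
      intro t x; rw [← Tm_add]; congr 1; funext y; simp only [hf2]; ring
    have e1 : ∀ t ≤ k, ∀ x, Tm (fun ξ => m t ξ * ind Ξ t ξ) f x =
        Tm (fun ξ => m t ξ * ind Ξ t ξ) f1 x := by
      intro t ht x
      rw [hf1, Tm_Tm]
      congr 1; funext ξ; rw [mul_assoc, mul_comm (ind Ξ t ξ), ind_mul Ξ ht]
    -- first piece
    have b1 : N2 (fun x => Tm (fun ξ => m (min (τ x) k) ξ * ind Ξ (min (τ x) k) ξ) f1 x) ≤
        B * N2 f1 := by
      apply ih s k hsk (hke.trans he) (by omega)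
      intro x; have := hτ x; omega
    by_cases hlt : k < e
    · have hk3 := hk2 hlt
      have b2 : N2 (fun x => Tm (fun ξ => m (max (τ x) (k+1)) ξ *
          ind Ξ (max (τ x) (k+1)) ξ) f2 x) ≤ B * N2 f2 := by
        apply ih (k+1) e hlt he (by have := bet_anti Ξ (show k+1 ≤ e from hlt); omega)
        intro x; have := hτ x; omega
      have b3 : N2 (fun x => Tm (fun ξ => m (max (τ x) (k+1)) ξ *
          ind Ξ (max (τ x) (k+1)) ξ) f1 x) ≤ K * N2 f := by
        apply N2_le_of_sq hK0
        have hkn : k ≤ n := hke.trans he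
        have hrep : ∀ x, Tm (fun ξ => m (max (τ x) (k+1)) ξ * ind Ξ (max (τ x) (k+1)) ξ) f1 x =
            ∑ η ∈ Ξ.image (cls k), m (max (τ x) (k+1)) η *
              Et k (fun y => chi η y * f y) x * chi η x := by
          intro x
          have hkt : k ≤ max (τ x) (k+1) := by omega
          rw [← Dt_rep le_rfl le_rfl hkn Ξ (inj_self Ξ k) (m (max (τ x) (k+1))) (by
            intro ξ η h; apply h1; rw [← cls_cls hkt ξ, h, cls_cls hkt]) f x, hf1, Tm_Tm]
          congr 1; funext ξ; rw [mul_assoc, ind_mul Ξ hkt]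
        simp only [hrep]
        refine (K_glob hkn hr (Ξ.image (cls k)) (hcard k) (inj_self Ξ k) m (fun i _ => h3 i)
          (fun η => Et k (fun y => chi η y * f y)) (fun η x y h => Et_congr _ h) _).trans ?_
        rw [hKsq]
        exact mul_le_mul_of_nonneg_left (bessel hkn _ (inj_self Ξ k) f) (by linarith)
      set g1 := fun x => Tm (fun ξ => m (min (τ x) k) ξ * ind Ξ (min (τ x) k) ξ) f1 x with hg1
      set g2 := fun x => Tm (fun ξ => m (max (τ x) (k+1)) ξ * ind Ξ (max (τ x) (k+1)) ξ) f2 x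
        with hg2
      set g3 := fun x => Tm (fun ξ => m (max (τ x) (k+1)) ξ * ind Ξ (max (τ x) (k+1)) ξ) f1 x
        with hg3
      have hdec : (fun x => Tm (fun ξ => m (τ x) ξ * ind Ξ (τ x) ξ) f x) =
          fun x => (if τ x ≤ k then g1 x else g2 x) + (if τ x ≤ k then 0 else g3 x) := by
        funext x
        split_ifs with h
        · simp only [hg1, min_eq_left h, add_zero]; exact e1 _ h x
        · have : max (τ x) (k+1) = τ x := by omega
          simp only [hg2, hg3, this]; rw [e0, add_comm]
      rw [hdec]
      refine (N2_add _ _).trans ?_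
      have c1 : N2 (fun x => if τ x ≤ k then g1 x else g2 x) ≤ B * N2 f := by
        have : N2 (fun x => if τ x ≤ k then g1 x else g2 x) ^ 2 ≤ (B * N2 f) ^ 2 := by
          have : N2 (fun x => if τ x ≤ k then g1 x else g2 x) ^ 2 ≤ N2 g1 ^ 2 + N2 g2 ^ 2 := by
            rw [N2_sq, N2_sq, N2_sq, ← Finset.sum_add_distrib]
            refine Finset.sum_le_sum fun x _ => ?_
            have := sq_nonneg (g1 x)
            have := sq_nonneg (g2 x)
            split_ifs <;> linarith
          have c2 := pow_le_pow_left₀ (N2_nonneg _) b1 2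
          have c3 := pow_le_pow_left₀ (N2_nonneg _) b2 2
          rw [mul_pow] at c2 c3 ⊢
          rw [← hpy, mul_add]
          linarith
        exact (pow_le_pow_iff_left₀ (N2_nonneg _) (mul_nonneg hB0 (N2_nonneg _)) two_ne_zero).1 this
      have c4 : N2 (fun x => if τ x ≤ k then 0 else g3 x) ≤ N2 g3 := by
        apply N2_mono; intro x; split_ifs
        · simpa using sq_nonneg (g3 x)
        · exact le_rfl
      push_cast
      calc _ ≤ B * N2 f + K * N2 f := add_le_add c1 (c4.trans b3)
        _ = _ := by rw [hBd]; ring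
    · have hke' : k = e := le_antisymm hke (not_lt.1 hlt)
      have hdec : (fun x => Tm (fun ξ => m (τ x) ξ * ind Ξ (τ x) ξ) f x) =
          fun x => Tm (fun ξ => m (min (τ x) k) ξ * ind Ξ (min (τ x) k) ξ) f1 x := by
        funext x
        have h : τ x ≤ k := by rw [hke']; exact (hτ x).2
        rw [min_eq_left h]; exact e1 _ h x
      rw [hdec]
      have c5 : N2 f1 ≤ N2 f := by
        have : N2 f1 ^ 2 ≤ N2 f ^ 2 := by have := sq_nonneg (N2 f2); linarith
        exact (pow_le_pow_iff_left₀ (N2_nonneg _) (N2_nonneg _) two_ne_zero).1 this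
      push_cast
      calc _ ≤ B * N2 f := b1.trans (mul_le_mul_of_nonneg_left c5 hB0)
        _ ≤ B * N2 f + K * N2 f := le_add_of_nonneg_right (mul_nonneg hK0 (N2_nonneg _))
        _ = _ := by rw [hBd]; ring

/-- Data of the finite model. -/
structure Sys (n l : ℕ) (r : ℝ) (Ξ : Finset (Fin n → Bool)) (m : ℕ → (Fin n → Bool) → ℝ) :
    Prop where
  card : Ξ.card ≤ 2 ^ l
  loc : ∀ t ξ η, cls t ξ = cls t η → m t ξ = m t η
  stab : ∀ s t, s ≤ t → t ≤ n → ∀ ξ, cls t ξ ∉ Ξ.image (cls t) → m s ξ = m t ξ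
  var : ∀ ξ, VB r fun t => m t ξ

/-- The `L²` constant. -/
def Bc (r : ℝ) (l : ℕ) : ℝ := 33 * ((l:ℝ)+1) * Real.sqrt (Ksq r l)

lemma VB_one {r : ℝ} (hr : 2 < r) : VB r fun _ => 1 := by
  refine ⟨fun _ => by simp, fun u _ M => ?_⟩
  have : r ≠ 0 := by linarith
  simp [Real.zero_rpow this]

lemma Bc_ge {r : ℝ} (hr : 2 < r) (l : ℕ) : 1 ≤ Bc r l := by
  unfold Bc
  have : 1 ≤ Real.sqrt (Ksq r l) := Real.one_le_sqrt.2 (Ksq_ge hr l)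
  have h2 : (0:ℝ) ≤ l := by positivity
  nlinarith

lemma L2_bound {n l : ℕ} {r : ℝ} (hr : 2 < r) {Ξ : Finset (Fin n → Bool)}
    {m : ℕ → (Fin n → Bool) → ℝ} (hS : Sys n l r Ξ m) (f : (Fin n → Bool) → ℝ)
    (τ : (Fin n → Bool) → ℕ) (hτ : ∀ x, τ x ≤ n) :
    N2 (fun x => Tm (m (τ x)) f x) ≤ Bc r l * N2 f := by
  have hb : bet Ξ 0 - bet Ξ n < 2 ^ (l+1) := by
    have h1 : bet Ξ 0 ≤ 2 ^ l := Finset.card_image_le.trans hS.card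
    have : 2 ^ (l+1) = 2 * 2 ^ l := by ring
    have : 0 < 2 ^ l := by positivity
    omega
  have hK1 : 1 ≤ Real.sqrt (Ksq r l) := Real.one_le_sqrt.2 (Ksq_ge hr l)
  have r1 := recursion hr Ξ hS.card m hS.loc hS.var (l+1) 0 n (Nat.zero_le _) le_rfl hb f τ
    (fun x => ⟨Nat.zero_le _, hτ x⟩)
  have r2 := recursion hr Ξ hS.card (fun _ _ => 1) (fun _ _ _ _ => rfl) (fun _ => VB_one hr)
    (l+1) 0 n (Nat.zero_le _) le_rfl hb (Tm (m 0) f) τ (fun x => ⟨Nat.zero_le _, hτ x⟩)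
  have r3 : N2 (Tm (m 0) f) ≤ N2 f :=
    Real.sqrt_le_sqrt (Tm_bound (fun ξ => (hS.var ξ).1 0) f)
  have hdec : (fun x => Tm (m (τ x)) f x) = fun x => (Tm (m 0) f x -
      Tm (fun ξ => 1 * ind Ξ (τ x) ξ) (Tm (m 0) f) x) +
      Tm (fun ξ => m (τ x) ξ * ind Ξ (τ x) ξ) f x := by
    funext x
    rw [Tm_Tm, ← Tm_msub, ← Tm_madd]
    congr 1; funext ξ
    by_cases h : cls (τ x) ξ ∈ Ξ.image (cls (τ x))
    · simp [ind, h]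
    · simp [ind, h, hS.stab 0 (τ x) (Nat.zero_le _) (hτ x) ξ h]
  rw [hdec]
  refine (N2_add _ _).trans ((add_le_add_left (N2_sub _ _) _).trans ?_)
  set K := Real.sqrt (Ksq r l)
  unfold Bc
  set C := 15 * ((l:ℝ)+1) * K + ((l+1 : ℕ):ℝ) * K with hC
  have hl : (0:ℝ) ≤ l := by positivity
  have hC0 : 0 ≤ C := by positivity
  have h5 := r2.trans (mul_le_mul_of_nonneg_left r3 hC0)
  have hC2 : 1 + C + C ≤ 33 * ((l:ℝ)+1) * K := by
    rw [hC]; push_cast; nlinarith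
  calc _ ≤ N2 f + C * N2 f + C * N2 f := by linarith
    _ = (1 + C + C) * N2 f := by ring
    _ ≤ _ := mul_le_mul_of_nonneg_right hC2 (N2_nonneg _)

end SMM

namespace SMM

/-- Calderon-Zygmund selection function: `s` is the first level with large average. -/
def sel {n : ℕ} (f : (Fin n → Bool) → ℝ) (α : ℝ) (s : ℕ) (x : Fin n → Bool) : ℝ :=
  if α < Et s (fun y => |f y|) x ∧ ∀ t < s, Et t (fun y => |f y|) x ≤ α then 1 else 0

lemma sel_congr {n : ℕ} (f : (Fin n → Bool) → ℝ) (α : ℝ) (s : ℕ) (x y : Fin n → Bool)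
    (h : Sx s x y) : sel f α s x = sel f α s y := by
  unfold sel
  refine ite_ext _ _ ?_ _ _
  rw [Et_congr _ h]
  refine and_congr Iff.rfl (forall_congr' fun t => forall_congr' fun ht => ?_)
  rw [Et_congr _ (h.mono ht.le)]

lemma sel_cases {n : ℕ} (f : (Fin n → Bool) → ℝ) (α : ℝ) (x : Fin n → Bool) :
    (∃ s ≤ n, (∀ t, sel f α t x = if t = s then 1 else 0) ∧ α < Et s (fun y => |f y|) x ∧
      ∀ t < s, Et t (fun y => |f y|) x ≤ α) ∨
    ((∀ t ≤ n, sel f α t x = 0) ∧ |f x| ≤ α) := by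
  by_cases h : ∃ s, s ≤ n ∧ α < Et s (fun y => |f y|) x
  · left
    have hs := Nat.find_spec h
    have hm : ∀ t < Nat.find h, Et t (fun y => |f y|) x ≤ α := by
      intro t ht
      have := Nat.find_min h ht
      by_contra h2
      exact this ⟨(ht.le.trans hs.1), not_le.1 h2⟩
    refine ⟨Nat.find h, hs.1, ?_, hs.2, hm⟩
    intro t
    unfold sel
    refine ite_ext _ _ ⟨fun h1 => ?_, fun h1 => ?_⟩ _ _
    · rcases lt_trichotomy t (Nat.find h) with h2 | h2 | h2
      · exact absurd h1.1 (not_lt.2 (hm t h2))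
      · exact h2
      · exact absurd hs.2 (not_lt.2 (h1.2 _ h2))
    · subst h1; exact ⟨hs.2, hm⟩
  · right
    push Not at h
    refine ⟨fun t ht => ?_, ?_⟩
    · unfold sel; rw [if_neg]
      intro h1; exact absurd h1.1 (not_lt.2 (h t ht))
    · have := h n le_rfl
      rwa [Et_full] at this

lemma cz {n l : ℕ} {r : ℝ} {Ξ : Finset (Fin n → Bool)}
    {m : ℕ → (Fin n → Bool) → ℝ} (hS : Sys n l r Ξ m) (f : (Fin n → Bool) → ℝ) (α : ℝ) (hα : 0 < α)
    (h0 : ∀ x, Et 0 (fun y => |f y|) x ≤ α) :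
    ∃ (U : Finset (Fin n → Bool)) (g : (Fin n → Bool) → ℝ),
      α * U.card ≤ ∑ x, |f x| ∧
      ∑ x, g x ^ 2 ≤ α * ∑ x, |f x| + 4 * 2 ^ l * α ^ 2 * U.card ∧
      ∀ x, x ∉ U → ∀ t ≤ n, Tm (m t) f x = Tm (m t) g x := by
  set φ := sel f α with hφ
  have hφc : ∀ s x y, Sx s x y → φ s x = φ s y := fun s x y h => sel_congr f α s x y h
  set P : ℕ → (Fin n → Bool) → ℝ := fun s => Tm (ind Ξ s) f with hP
  set R := Finset.range (n+1) with hR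
  have hsum : ∀ x, (∀ s ∈ R, φ s x = 0) ∧ |f x| ≤ α ∨ ∃ s ∈ R, φ s x = 1 ∧
      (∀ t, φ t x = if t = s then 1 else 0) ∧ α < Et s (fun y => |f y|) x ∧
      ∀ t < s, Et t (fun y => |f y|) x ≤ α := by
    intro x
    rcases sel_cases f α x with ⟨s, hs, h1, h2, h3⟩ | ⟨h1, h2⟩
    · right
      exact ⟨s, by simp [hR]; omega, by rw [hφ, h1, if_pos rfl], h1, h2, h3⟩
    · left
      exact ⟨fun s hs => h1 s (by simp [hR] at hs; omega), h2⟩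
  -- the exceptional set
  refine ⟨Finset.univ.filter fun x => ∃ s ∈ R, φ s x ≠ 0,
    fun x => f x - ∑ s ∈ R, φ s x * (f x - P s x), ?_, ?_, ?_⟩
  · have e1 : α * ((Finset.univ.filter fun x => ∃ s ∈ R, φ s x ≠ 0).card : ℝ) ≤
        ∑ x, ∑ s ∈ R, φ s x * Et s (fun y => |f y|) x := by
      rw [Finset.card_filter, Nat.cast_sum, Finset.mul_sum]
      refine Finset.sum_le_sum fun x _ => ?_
      rcases hsum x with ⟨h1, h2⟩ | ⟨s, hs, h1, h2, h3, h4⟩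
      · rw [if_neg (by push Not; exact h1), Finset.sum_eq_zero (fun s hs => by rw [h1 s hs, zero_mul])]
        simp
      · rw [if_pos ⟨s, hs, by rw [h1]; norm_num⟩, Finset.sum_eq_single s]
        · rw [h1]; push_cast; linarith
        · intro t _ hts; rw [h2, if_neg hts, zero_mul]
        · intro h; exact absurd hs h
    refine e1.trans ?_
    rw [Finset.sum_comm]
    have e2 : ∀ s ∈ R, ∑ x, φ s x * Et s (fun y => |f y|) x = ∑ x, φ s x * |f x| := by
      intro s hs
      exact sum_Et_mul (by simp [hR] at hs; omega) _ _ (hφc s)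
    rw [Finset.sum_congr rfl e2, Finset.sum_comm]
    refine Finset.sum_le_sum fun x _ => ?_
    rcases hsum x with ⟨h1, h2⟩ | ⟨s, hs, h1, h2, h3, h4⟩
    · rw [Finset.sum_eq_zero (fun s hs => by rw [h1 s hs, zero_mul])]; positivity
    · rw [Finset.sum_eq_single s]
      · rw [h1, one_mul]
      · intro t _ hts; rw [h2, if_neg hts, zero_mul]
      · intro h; exact absurd hs h
  · have e1 : ∀ x, (f x - ∑ s ∈ R, φ s x * (f x - P s x)) ^ 2 ≤
        α * |f x| + ∑ s ∈ R, (φ s x * P s x) ^ 2 := by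
      intro x
      rcases hsum x with ⟨h1, h2⟩ | ⟨s, hs, h1, h2, h3, h4⟩
      · rw [Finset.sum_eq_zero (fun s hs => by rw [h1 s hs, zero_mul]),
          Finset.sum_eq_zero (fun s hs => by rw [h1 s hs, zero_mul, sq, zero_mul]), sub_zero, add_zero,
          ← sq_abs]
        nlinarith [abs_nonneg (f x)]
      · rw [Finset.sum_eq_single s, Finset.sum_eq_single s]
        · rw [h1]
          have : 0 ≤ α * |f x| := by positivity
          ring_nf; linarith
        · intro t _ hts; rw [h2, if_neg hts]; ring
        · intro h; exact absurd hs h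
        · intro t _ hts; rw [h2, if_neg hts]; ring
        · intro h; exact absurd hs h
    refine (Finset.sum_le_sum fun x _ => e1 x).trans ?_
    rw [Finset.sum_add_distrib, ← Finset.mul_sum]
    refine add_le_add le_rfl ?_
    rw [Finset.sum_comm]
    have e2 : ∀ s ∈ R, ∑ x, (φ s x * P s x) ^ 2 ≤ ∑ x, 4 * 2 ^ l * α ^ 2 * φ s x := by
      intro s hs
      have hsn : s ≤ n := by simp [hR] at hs; omega
      have e3 : ∀ x, φ s x * P s x = ∑ η ∈ Ξ.image (cls s),
          (φ s x * Et s (fun y => chi η y * f y) x) * chi η x := by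
        intro x
        rw [hP]; simp only
        rw [Tm_rep hsn (ind Ξ s) f (Ξ.image (cls s)) (fun ξ η h => ind_congr Ξ h) ?_ (inj_self Ξ s),
          Finset.mul_sum]
        · refine Finset.sum_congr rfl fun η hη => ?_
          rw [ind_one Ξ le_rfl hη]; ring
        · intro ξ h
          unfold ind at h
          have h' : cls s ξ ∈ Ξ.image (cls s) := by
            by_contra h2; rw [if_neg h2] at h; exact h rfl
          exact ⟨_, h', (cls_cls le_rfl ξ).symm⟩
      simp only [e3]
      rw [cell_orth hsn _ (inj_self Ξ s) (fun η x => φ s x * Et s (fun y => chi η y * f y) x)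
        (fun η x y h => by rw [hφc s x y h, Et_congr _ h])]
      refine Finset.sum_le_sum fun x _ => ?_
      rcases hsum x with ⟨h1, h2⟩ | ⟨s', hs', h1, h2, h3, h4⟩
      · rw [h1 s hs]; simp
      · rw [h2]
        split_ifs with hss
        · subst hss
          have e4 : ∀ η, Et s (fun y => chi η y * f y) x ^ 2 ≤ 4 * α ^ 2 := by
            intro η
            have a1 := abs_Et_le (t := s) (fun y => chi η y * f y) x
            simp only [abs_mul, abs_chi, one_mul] at a1
            have a2 : Et s (fun y => |f y|) x ≤ 2 * α := by
              rcases Nat.eq_zero_or_pos s with hz | hz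
              · subst hz; have := h0 x; linarith
              · obtain ⟨s', rfl⟩ : ∃ s', s = s' + 1 := ⟨s - 1, by omega⟩
                have := Et_succ_le (t := s') (by omega) (fun y => abs_nonneg (f y)) x
                have := h4 s' (by omega)
                linarith
            have a3 := a1.trans a2
            rw [← sq_abs]
            nlinarith [abs_nonneg (Et s (fun y => chi η y * f y) x)]
          calc ∑ η ∈ Ξ.image (cls s), (1 * Et s (fun y => chi η y * f y) x) ^ 2 ≤
              ∑ η ∈ Ξ.image (cls s), 4 * α ^ 2 := by
                refine Finset.sum_le_sum fun η _ => ?_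
                rw [one_mul]; exact e4 η
            _ = (Ξ.image (cls s)).card * (4 * α ^ 2) := by simp
            _ ≤ (2 : ℝ) ^ l * (4 * α ^ 2) := by
                refine mul_le_mul_of_nonneg_right ?_ (by positivity)
                exact_mod_cast Finset.card_image_le.trans hS.card
            _ = _ := by ring
        · simp
    refine (Finset.sum_le_sum e2).trans ?_
    rw [Finset.sum_comm, Finset.card_filter, Nat.cast_sum, Finset.mul_sum]
    refine Finset.sum_le_sum fun x _ => ?_
    rw [← Finset.mul_sum]
    refine mul_le_mul_of_nonneg_left ?_ (by positivity)
    rcases hsum x with ⟨h1, h2⟩ | ⟨s, hs, h1, h2, h3, h4⟩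
    · rw [Finset.sum_eq_zero h1]; positivity
    · rw [if_pos ⟨s, hs, by rw [h1]; norm_num⟩, Finset.sum_eq_single s]
      · rw [h1]; simp
      · intro t _ hts; rw [h2, if_neg hts]
      · intro h; exact absurd hs h
  · intro x hx t ht
    have hx0 : ∀ s ∈ R, φ s x = 0 := by
      simp only [Finset.mem_filter, Finset.mem_univ, true_and] at hx
      push Not at hx; exact hx
    set g := fun x => f x - ∑ s ∈ R, φ s x * (f x - P s x) with hg
    have hfg : f = fun y => g y + ∑ s ∈ R, φ s y * (f y - P s y) := by
      funext y; rw [hg]; ring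
    have hz : Tm (m t) (fun y => ∑ s ∈ R, φ s y * (f y - P s y)) x = 0 := by
      have key : ∀ s ∈ R, Tm (m t) (fun y => φ s y * (f y - P s y)) x = 0 := by
        intro s hs
        have hsn : s ≤ n := by simp [hR] at hs; omega
        have k1 : (fun y => φ s y * (f y - P s y)) =
            Tm (fun ξ => 1 - ind Ξ s ξ) (fun y => φ s y * f y) := by
          funext y
          rw [Tm_local hsn _ f (φ s) (fun ξ η h => by rw [ind_congr Ξ h]) (hφc s), Tm_msub, Tm_one]
        rw [k1, Tm_Tm, Tm_local hsn _ f (φ s) ?_ (hφc s), hx0 s hs, zero_mul]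
        intro ξ η h
        rcases le_total s t with hst | hst
        · rw [ind_congr Ξ h, hS.loc t ξ η (by rw [← cls_cls hst ξ, h, cls_cls hst])]
        · rw [ind_congr Ξ h]
          by_cases h5 : cls s η ∈ Ξ.image (cls s)
          · simp [ind, h5]
          · rw [hS.stab t s hst hsn ξ (by rw [h]; exact h5), hS.stab t s hst hsn η h5,
              hS.loc s ξ η h]
      have gen : ∀ Q : Finset ℕ, (∀ s ∈ Q, Tm (m t) (fun y => φ s y * (f y - P s y)) x = 0) →
          Tm (m t) (fun y => ∑ s ∈ Q, φ s y * (f y - P s y)) x = 0 := by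
        intro Q
        induction Q using Finset.induction_on with
        | empty => intro _; simp [Tm, hat]
        | insert a Q ha ih =>
          intro h
          simp only [Finset.sum_insert ha]
          rw [Tm_add, h a (Finset.mem_insert_self _ _),
            ih (fun s hs => h s (Finset.mem_insert_of_mem hs)), add_zero]
      exact gen R key
    calc Tm (m t) f x = Tm (m t) (fun y => g y + ∑ s ∈ R, φ s y * (f y - P s y)) x := by rw [← hfg]
      _ = _ := by rw [Tm_add, hz, add_zero]

/-- Weak type (1,1). -/
lemma weak11 {n l : ℕ} {r : ℝ} (hr : 2 < r) {Ξ : Finset (Fin n → Bool)}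
    {m : ℕ → (Fin n → Bool) → ℝ} (hS : Sys n l r Ξ m) (f : (Fin n → Bool) → ℝ)
    (τ : (Fin n → Bool) → ℕ) (hτ : ∀ x, τ x ≤ n) (lam : ℝ) (hl : 0 < lam) :
    ((Finset.univ.filter fun x => lam < |Tm (m (τ x)) f x|).card : ℝ) * lam ≤
      6 * Bc r l * Real.sqrt (2 ^ l) * ∑ x, |f x| := by
  have hB := Bc_ge hr l
  set B := Bc r l
  set N := Real.sqrt (2 ^ l) with hN
  have hNsq : N ^ 2 = 2 ^ l := Real.sq_sqrt (by positivity)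
  have hN0 : 0 < N := by positivity
  set S := ∑ x, |f x| with hSd
  have hS0 : 0 ≤ S := Finset.sum_nonneg fun x _ => abs_nonneg _
  have hB0 : 0 < B := by linarith
  set α := lam / (B * N) with hαd
  have hα : 0 < α := by positivity
  have hlam : lam = α * (B * N) := by rw [hαd]; field_simp
  by_cases h0 : ∀ x, Et 0 (fun y => |f y|) x ≤ α
  · obtain ⟨U, g, hU, hg, hoff⟩ := cz hS f α hα h0
    have hL2 := L2_bound hr hS g τ hτ
    have hL2s : ∑ x, Tm (m (τ x)) g x ^ 2 ≤ B ^ 2 * ∑ x, g x ^ 2 := by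
      rw [← N2_sq, ← N2_sq, ← mul_pow]
      exact pow_le_pow_left₀ (N2_nonneg _) hL2 2
    have hc : ((Finset.univ.filter fun x => lam < |Tm (m (τ x)) f x|).card : ℝ) * lam ^ 2 ≤
        U.card * lam ^ 2 + ∑ x, Tm (m (τ x)) g x ^ 2 := by
      have : ((U.card : ℕ) : ℝ) = ∑ x, if x ∈ U then (1:ℝ) else 0 := by simp
      rw [this, Finset.card_filter, Nat.cast_sum, Finset.sum_mul, Finset.sum_mul,
        ← Finset.sum_add_distrib]
      refine Finset.sum_le_sum fun x _ => ?_
      by_cases hx : x ∈ U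
      · rw [if_pos hx]
        have := sq_nonneg (Tm (m (τ x)) g x)
        have := sq_nonneg lam
        split_ifs <;> push_cast <;> linarith
      · rw [if_neg hx, hoff x hx _ (hτ x)]
        split_ifs with h1
        · push_cast
          rw [← sq_abs (Tm (m (τ x)) g x)]
          nlinarith
        · push_cast
          have := sq_nonneg (Tm (m (τ x)) g x)
          linarith
    set K := ((Finset.univ.filter fun x => lam < |Tm (m (τ x)) f x|).card : ℝ) with hK
    have hfin : K * lam ^ 2 ≤ (6 * B * N * S) * lam := by
      have a1 : (U.card:ℝ) * lam ^ 2 ≤ lam * (B * N * S) := by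
        have : (U.card:ℝ) * lam ^ 2 = lam * (B * N) * (α * U.card) := by rw [hlam]; ring
        rw [this]
        calc _ ≤ lam * (B * N) * S := mul_le_mul_of_nonneg_left hU (by positivity)
          _ = _ := by ring
      have a2 : B ^ 2 * ∑ x, g x ^ 2 ≤ B ^ 2 * (5 * N ^ 2 * α * S) := by
        refine mul_le_mul_of_nonneg_left (hg.trans ?_) (by positivity)
        rw [← hNsq]
        have hN1 : 1 ≤ N ^ 2 := by rw [hNsq]; exact one_le_pow₀ (by norm_num)
        have b1 : α * S ≤ N ^ 2 * (α * S) := le_mul_of_one_le_left (by positivity) hN1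
        have b2 : 4 * N ^ 2 * α ^ 2 * U.card ≤ 4 * N ^ 2 * α * S := by
          calc _ = 4 * N ^ 2 * α * (α * U.card) := by ring
            _ ≤ _ := mul_le_mul_of_nonneg_left hU (by positivity)
        nlinarith
      have a3 : B ^ 2 * (5 * N ^ 2 * α * S) = 5 * B * N * S * lam := by rw [hlam]; ring
      nlinarith
    have : (K * lam) * lam ≤ (6 * B * N * S) * lam := by nlinarith
    exact le_of_mul_le_mul_right this hl
  · push Not at h0
    obtain ⟨x, hx⟩ := h0
    have h1 : Et 0 (fun y => |f y|) x = ((2:ℝ) ^ n)⁻¹ * S := by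
      unfold Et
      have : ∀ y, Sx 0 x y := fun y i hi => absurd hi (Nat.not_lt_zero _)
      simp [this, hSd]
    rw [h1] at hx
    have h2 : α * 2 ^ n ≤ S := by
      have : (0:ℝ) < 2 ^ n := by positivity
      rw [inv_mul_eq_div, lt_div_iff₀ this] at hx
      exact hx.le
    have h3 : ((Finset.univ.filter fun x => lam < |Tm (m (τ x)) f x|).card : ℝ) ≤ 2 ^ n := by
      have := Finset.card_le_univ (Finset.univ.filter fun x => lam < |Tm (m (τ x)) f x|)
      simp only [Fintype.card_pi, Fintype.card_bool, Finset.prod_const, Finset.card_univ,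
        Fintype.card_fin] at this
      exact_mod_cast this
    calc _ ≤ 2 ^ n * lam := mul_le_mul_of_nonneg_right h3 hl.le
      _ = (B * N) * (α * 2 ^ n) := by rw [hlam]; ring
      _ ≤ (B * N) * S := mul_le_mul_of_nonneg_left h2 (by positivity)
      _ ≤ _ := by
        have : 0 ≤ B * N * S := by positivity
        linarith

end SMM

namespace SMM

lemma int_low {p a : ℝ} (hp : -1 < p) (ha : 0 ≤ a) :
    Integrable ((Set.Ioc 0 a).indicator fun t : ℝ => t ^ p) ∧
      ∫ t, (Set.Ioc 0 a).indicator (fun t : ℝ => t ^ p) t = a ^ (p+1) / (p+1) := by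
  have h := intervalIntegral.intervalIntegrable_rpow' (a := 0) (b := a) hp
  rw [intervalIntegrable_iff_integrableOn_Ioc_of_le ha] at h
  refine ⟨(integrable_indicator_iff measurableSet_Ioc).2 h, ?_⟩
  rw [integral_indicator measurableSet_Ioc, ← intervalIntegral.integral_of_le ha,
    integral_rpow (Or.inl hp), Real.zero_rpow (by linarith), sub_zero]

lemma int_high {p a : ℝ} (hp : p < -1) (ha : 0 < a) :
    Integrable ((Set.Ioi a).indicator fun t : ℝ => t ^ p) ∧
      ∫ t, (Set.Ioi a).indicator (fun t : ℝ => t ^ p) t = -a ^ (p+1) / (p+1) := by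
  refine ⟨(integrable_indicator_iff measurableSet_Ioi).2 (integrableOn_Ioi_rpow_of_lt hp ha), ?_⟩
  rw [integral_indicator measurableSet_Ioi, integral_Ioi_rpow_of_lt hp ha]

/-- Marcinkiewicz interpolation on a finite set. -/
lemma marc {ι : Type*} [Fintype ι] {q : ℝ} (hq1 : 1 < q) (hq2 : q < 2) (f F : ι → ℝ)
    (hF : ∀ x, 0 ≤ F x) (A1 A2 δ : ℝ) (hA1 : 0 ≤ A1) (hA2 : 0 ≤ A2) (hδ : 0 < δ)
    (h : ∀ lam : ℝ, 0 < lam → ((Finset.univ.filter fun x => lam < F x).card : ℝ) * lam ^ 2 ≤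
      A1 * lam * (∑ x, if δ * lam < |f x| then |f x| else 0) +
        A2 * ∑ x, if δ * lam < |f x| then 0 else f x ^ 2) :
    ∑ x, F x ^ q ≤ q * (A1 * δ ^ (1 - q) / (q - 1) + A2 * δ ^ (2 - q) / (2 - q)) *
      ∑ x, |f x| ^ q := by
  have hq0 : 0 < q := by linarith
  set H : ι → ℝ → ℝ := fun x t => A1 * |f x| * (Set.Ioc 0 (|f x| / δ)).indicator (fun t => t ^ (q-2)) t +
    A2 * f x ^ 2 * (Set.Ioi (|f x| / δ)).indicator (fun t => t ^ (q-3)) t with hH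
  set L : ι → ℝ → ℝ := fun x t => (Set.Ioc 0 (F x)).indicator (fun t => t ^ (q-1)) t with hL
  have hLi : ∀ x, Integrable (L x) ∧ ∫ t, L x t = F x ^ q / q := by
    intro x
    have := int_low (p := q - 1) (by linarith) (hF x)
    rwa [sub_add_cancel] at this
  have hHi : ∀ x, Integrable (H x) ∧ ∫ t, H x t =
      (A1 * δ ^ (1 - q) / (q - 1) + A2 * δ ^ (2 - q) / (2 - q)) * |f x| ^ q := by
    intro x
    by_cases h0 : f x = 0
    · have : H x = fun _ => 0 := by funext t; simp [hH, h0]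
      rw [this, h0]
      simp [Real.zero_rpow hq0.ne']
    · have hp : 0 < |f x| := abs_pos.2 h0
      have hd : 0 < |f x| / δ := by positivity
      have i1 := int_low (p := q - 2) (by linarith) hd.le
      have i2 := int_high (p := q - 3) (by linarith) hd
      refine ⟨(i1.1.const_mul _).add (i2.1.const_mul _), ?_⟩
      rw [hH]; simp only
      rw [integral_add (i1.1.const_mul _) (i2.1.const_mul _), integral_const_mul,
        integral_const_mul, i1.2, i2.2]
      have e1 : |f x| * (|f x| / δ) ^ (q - 2 + 1) = δ ^ (1 - q) * |f x| ^ q := by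
        have g1 : |f x| ^ q = |f x| * |f x| ^ (q - 2 + 1) := by
          conv_lhs => rw [show q = 1 + (q-2+1) by ring, Real.rpow_add hp, Real.rpow_one]
        rw [Real.div_rpow hp.le hδ.le, show (1 - q) = -(q-2+1) by ring, Real.rpow_neg hδ.le, g1]
        ring
      have e2 : f x ^ 2 * (|f x| / δ) ^ (q - 3 + 1) = δ ^ (2 - q) * |f x| ^ q := by
        have g1 : |f x| ^ q = f x ^ 2 * |f x| ^ (q - 3 + 1) := by
          conv_lhs => rw [show q = 2 + (q-3+1) by ring, Real.rpow_add hp, Real.rpow_two, sq_abs]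
        rw [Real.div_rpow hp.le hδ.le, show (2 - q) = -(q-3+1) by ring, Real.rpow_neg hδ.le, g1]
        ring
      have e3 : q - 2 + 1 ≠ 0 := by intro h; linarith
      have e4 : q - 3 + 1 = -(2 - q) := by ring
      calc _ = A1 * (|f x| * (|f x| / δ) ^ (q - 2 + 1)) / (q - 2 + 1) +
            A2 * (f x ^ 2 * (|f x| / δ) ^ (q - 3 + 1)) / (-(q-3+1)) := by
              rw [div_neg]; ring
        _ = _ := by rw [e1, e2, e4, neg_neg, show q - 2 + 1 = q - 1 by ring]; ring
  have hmono : ∫ t, ∑ x, L x t ≤ ∫ t, ∑ x, H x t := by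
    refine integral_mono_ae (integrable_finsetSum _ fun x _ => (hLi x).1)
      (integrable_finsetSum _ fun x _ => (hHi x).1) ?_
    have hnull : ∀ᵐ t : ℝ, t ∉ Set.range F ∪ Set.range (fun x => |f x| / δ) := by
      refine measure_eq_zero_iff_ae_notMem.1 ?_
      exact ((Set.finite_range F).union (Set.finite_range _)).measure_zero volume
    filter_upwards [hnull] with t ht
    simp only [Set.mem_union, Set.mem_range, not_or, not_exists] at ht
    by_cases ht0 : 0 < t
    · have hh := h t ht0
      have s1 : ∑ x, L x t = ((Finset.univ.filter fun x => t < F x).card : ℝ) * t ^ (q-1) := by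
        rw [Finset.card_filter, Nat.cast_sum, Finset.sum_mul]
        refine Finset.sum_congr rfl fun x _ => ?_
        rw [hL]; simp only [Set.indicator_apply, Set.mem_Ioc]
        rcases lt_or_ge t (F x) with h1 | h1
        · rw [if_pos ⟨ht0, h1.le⟩, if_pos h1]; simp
        · have : ¬ t ≤ F x := fun h2 => ht.1 x (le_antisymm h1 h2)
          rw [if_neg (fun h => this h.2), if_neg (not_lt.2 h1)]; simp
      have s2 : ∑ x, H x t = t ^ (q-3) * (A1 * t * (∑ x, if δ * t < |f x| then |f x| else 0) +
        A2 * ∑ x, if δ * t < |f x| then 0 else f x ^ 2) := by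
        have t1 : t ^ (q-2) = t ^ (q-3) * t := by
          rw [show q - 2 = (q-3) + 1 by ring, Real.rpow_add ht0, Real.rpow_one]
        rw [mul_add, Finset.mul_sum, Finset.mul_sum, Finset.mul_sum, Finset.mul_sum,
          ← Finset.sum_add_distrib]
        refine Finset.sum_congr rfl fun x _ => ?_
        rw [hH]; simp only [Set.indicator_apply, Set.mem_Ioc, Set.mem_Ioi]
        have hiff : δ * t < |f x| ↔ t < |f x| / δ := by rw [lt_div_iff₀ hδ, mul_comm]
        rcases lt_or_ge t (|f x| / δ) with h1 | h1
        · rw [if_pos ⟨ht0, h1.le⟩, if_neg (not_lt.2 h1.le), if_pos (hiff.2 h1), if_pos (hiff.2 h1), t1]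
          ring
        · have h2 : |f x| / δ < t := lt_of_le_of_ne h1 (ht.2 x)
          rw [if_neg (fun h => absurd h.2 (not_le.2 h2)), if_pos h2, if_neg (fun h => absurd (hiff.1 h) (not_lt.2 h1)),
            if_neg (fun h => absurd (hiff.1 h) (not_lt.2 h1))]
          ring
      rw [s1, s2]
      have t2 : t ^ (q-1) = t ^ (q-3) * t ^ 2 := by
        rw [show q - 1 = (q-3) + 2 by ring, Real.rpow_add ht0, Real.rpow_two]
      rw [t2]
      have := mul_le_mul_of_nonneg_left hh (Real.rpow_nonneg ht0.le (q-3))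
      linarith
    · have s1 : ∑ x, L x t = 0 := by
        refine Finset.sum_eq_zero fun x _ => ?_
        rw [hL]; simp only [Set.indicator_apply, Set.mem_Ioc]
        rw [if_neg (fun h => ht0 h.1)]
      rw [s1]
      refine Finset.sum_nonneg fun x _ => ?_
      rw [hH]; simp only [Set.indicator_apply, Set.mem_Ioc, Set.mem_Ioi]
      have h1 : ¬ (|f x| / δ < t) := by
        have : 0 ≤ |f x| / δ := by positivity
        push Not at ht0 ⊢; linarith
      rw [if_neg (fun h => ht0 h.1), if_neg h1]; simp
  rw [integral_finsetSum _ fun x _ => (hLi x).1, integral_finsetSum _ fun x _ => (hHi x).1] at hmono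
  simp only [(hLi _).2, (hHi _).2] at hmono
  rw [← Finset.sum_div, ← Finset.mul_sum, div_le_iff₀ hq0] at hmono
  linarith

/-- Interpolated constant. -/
lemma strong_q {n l : ℕ} {q r : ℝ} (hq1 : 1 < q) (hq2 : q < 2) (hr : 2 < r)
    {Ξ : Finset (Fin n → Bool)}
    {m : ℕ → (Fin n → Bool) → ℝ} (hS : Sys n l r Ξ m) (f : (Fin n → Bool) → ℝ)
    (τ : (Fin n → Bool) → ℕ) (hτ : ∀ x, τ x ≤ n) :
    ∑ x, |Tm (m (τ x)) f x| ^ q ≤ q * (12 / (q-1) + 4 / (2-q)) * (Bc r l ^ q * ((2:ℝ) ^ l) ^ (1 - q/2)) *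
      ∑ x, |f x| ^ q := by
  have hB := Bc_ge hr l
  set B := Bc r l
  have hB0 : 0 < B := by linarith
  set N := Real.sqrt (2 ^ l) with hN
  have hNsq : N ^ 2 = 2 ^ l := Real.sq_sqrt (by positivity)
  have hN0 : 0 < N := by positivity
  have key := marc hq1 hq2 f (fun x => |Tm (m (τ x)) f x|) (fun x => abs_nonneg _)
    (12 * B * N) (4 * B ^ 2) (N / B) (by positivity) (by positivity) (by positivity) ?_
  · refine key.trans (le_of_eq ?_)
    congr 1
    rw [mul_assoc q]
    congr 1
    have e0 : ((2:ℝ) ^ l) ^ (1 - q/2) = N ^ (2 - q) := by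
      rw [← hNsq, ← Real.rpow_natCast N 2, ← Real.rpow_mul hN0.le]
      congr 1; push_cast; ring
    have e1 : B * N * (N / B) ^ (1-q) = B ^ q * N ^ (2-q) := by
      have g1 : B ^ q = B / B ^ (1-q) := by
        nth_rewrite 2 [← Real.rpow_one B]
        rw [← Real.rpow_sub hB0]; congr 1; ring
      have g2 : N ^ (2-q) = N * N ^ (1-q) := by
        rw [show 2 - q = 1 + (1-q) by ring, Real.rpow_add hN0, Real.rpow_one]
      rw [Real.div_rpow hN0.le hB0.le, g1, g2]
      ring
    have e2 : B ^ 2 * (N / B) ^ (2-q) = B ^ q * N ^ (2-q) := by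
      rw [Real.div_rpow hN0.le hB0.le]
      have : B ^ q = B ^ 2 / B ^ (2-q) := by
        rw [← Real.rpow_two, ← Real.rpow_sub hB0]; congr 1; ring
      rw [this]; ring
    rw [e0]
    calc _ = 12 * (B * N * (N / B) ^ (1-q)) / (q-1) + 4 * (B ^ 2 * (N / B) ^ (2-q)) / (2-q) := by ring
      _ = 12 * (B ^ q * N ^ (2-q)) / (q-1) + 4 * (B ^ q * N ^ (2-q)) / (2-q) := by rw [e1, e2]
      _ = _ := by ring
  · intro lam hl
    set δ := N / B
    set f1 : (Fin n → Bool) → ℝ := fun x => if δ * lam < |f x| then f x else 0 with hf1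
    set f2 : (Fin n → Bool) → ℝ := fun x => if δ * lam < |f x| then 0 else f x with hf2
    have hsum : f = fun x => f1 x + f2 x := by
      funext x; simp only [hf1, hf2]; split_ifs <;> simp
    have w := weak11 hr hS f1 τ hτ (lam/2) (by positivity)
    have hL2 := L2_bound hr hS f2 τ hτ
    have hL2s : ∑ x, Tm (m (τ x)) f2 x ^ 2 ≤ B ^ 2 * ∑ x, f2 x ^ 2 := by
      rw [← N2_sq, ← N2_sq, ← mul_pow]
      exact pow_le_pow_left₀ (N2_nonneg _) hL2 2
    have hc : ((Finset.univ.filter fun x => lam < |Tm (m (τ x)) f x|).card : ℝ) * lam ^ 2 ≤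
        ((Finset.univ.filter fun x => lam/2 < |Tm (m (τ x)) f1 x|).card : ℝ) * lam ^ 2 +
          4 * ∑ x, Tm (m (τ x)) f2 x ^ 2 := by
      rw [Finset.card_filter, Finset.card_filter, Nat.cast_sum, Nat.cast_sum, Finset.sum_mul,
        Finset.sum_mul, Finset.mul_sum, ← Finset.sum_add_distrib]
      refine Finset.sum_le_sum fun x _ => ?_
      have hsq := sq_nonneg (Tm (m (τ x)) f2 x)
      have hlq := sq_nonneg lam
      have hT : Tm (m (τ x)) f x = Tm (m (τ x)) f1 x + Tm (m (τ x)) f2 x := by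
        conv_lhs => rw [hsum]
        exact Tm_add _ _ _ _
      by_cases h1 : lam / 2 < |Tm (m (τ x)) f1 x|
      · rw [if_pos h1]
        split_ifs <;> push_cast <;> linarith
      · rw [if_neg h1]
        split_ifs with h2
        · have h3 : lam / 2 < |Tm (m (τ x)) f2 x| := by
            have := abs_add_le (Tm (m (τ x)) f1 x) (Tm (m (τ x)) f2 x)
            rw [← hT] at this
            push Not at h1
            linarith
          push_cast
          rw [← sq_abs (Tm (m (τ x)) f2 x)]
          nlinarith
        · push_cast; linarith
    have a1 : ∑ x, |f1 x| = ∑ x, if δ * lam < |f x| then |f x| else 0 := by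
      refine Finset.sum_congr rfl fun x _ => ?_
      simp only [hf1]; split_ifs <;> simp
    have a2 : ∑ x, f2 x ^ 2 = ∑ x, if δ * lam < |f x| then 0 else f x ^ 2 := by
      refine Finset.sum_congr rfl fun x _ => ?_
      simp only [hf2]; split_ifs <;> simp
    rw [← a1, ← a2]
    refine hc.trans (add_le_add ?_ ?_)
    · have := mul_le_mul_of_nonneg_left w (show 0 ≤ 2 * lam by positivity)
      calc _ = _ := by ring
        _ ≤ _ := this
        _ = _ := by ring
    · linarith

lemma poly_exp (ε : ℝ) (hε : 0 < ε) : ∃ K : ℝ, 1 ≤ K ∧ ∀ l : ℕ,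
    ((l:ℝ)+1) ^ 2 ≤ K * ((2:ℝ) ^ l) ^ ε := by
  set c := min 1 (ε / 2 * Real.log 2) with hc
  have hc0 : 0 < c := lt_min one_pos (by have := Real.log_pos (show (1:ℝ) < 2 by norm_num); positivity)
  have hc1 : c ≤ 1 := min_le_left _ _
  refine ⟨c⁻¹ ^ 2, one_le_pow₀ ((one_le_inv₀ hc0).2 hc1), fun l => ?_⟩
  have h1 : ((2:ℝ) ^ l) ^ ε = (Real.exp (ε / 2 * Real.log 2 * l)) ^ 2 := by
    rw [← Real.rpow_natCast 2 l, ← Real.rpow_mul (by norm_num), Real.rpow_def_of_pos (by norm_num),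
      ← Real.exp_nat_mul]
    congr 1; push_cast; ring
  have h2 : c * ((l:ℝ)+1) ≤ Real.exp (ε / 2 * Real.log 2 * l) := by
    have a := Real.add_one_le_exp (ε / 2 * Real.log 2 * l)
    have b : c * l ≤ ε / 2 * Real.log 2 * l :=
      mul_le_mul_of_nonneg_right (min_le_right _ _) (by positivity)
    nlinarith
  rw [h1, ← mul_pow]
  refine pow_le_pow_left₀ (by positivity) ?_ 2
  rw [inv_mul_eq_div, le_div_iff₀ hc0]
  linarith

/-- The finite model theorem. -/
lemma finite_model (q r ε : ℝ) (hq1 : 1 < q) (hq2 : q ≤ 2) (hr : 2 < r) (hε : 0 < ε) :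
    ∃ C : ℝ, 0 < C ∧ ∀ (n l : ℕ) (Ξ : Finset (Fin n → Bool)) (m : ℕ → (Fin n → Bool) → ℝ),
      Sys n l r Ξ m → ∀ (f : (Fin n → Bool) → ℝ) (τ : (Fin n → Bool) → ℕ), (∀ x, τ x ≤ n) →
      ∑ x, |Tm (m (τ x)) f x| ^ q ≤ (C * ((2:ℝ) ^ l) ^ (1/q - 1/r + ε)) ^ q * ∑ x, |f x| ^ q := by
  obtain ⟨K, hK1, hK⟩ := poly_exp ε hε
  have hq0 : 0 < q := by linarith
  -- bound on the constant
  have hB : ∀ l : ℕ, Bc r l ≤ 33 * Real.sqrt 6 * K * ((2:ℝ) ^ l) ^ (1/2 - 1/r + ε) := by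
    intro l
    unfold Bc Ksq
    have hP : (0:ℝ) < 2 ^ l := by positivity
    rw [Real.sqrt_mul (by positivity), Real.sqrt_mul (by norm_num), Real.sqrt_sq (by positivity),
      Real.sqrt_eq_rpow (_ ^ (1 - 2/r)), ← Real.rpow_mul hP.le]
    rw [Real.rpow_add hP, show (1 - 2/r) * (1/2) = 1/2 - 1/r by ring]
    have := mul_le_mul_of_nonneg_left (hK l) (show 0 ≤ 33 * Real.sqrt 6 * ((2:ℝ)^l) ^ (1/2 - 1/r) by positivity)
    calc _ = 33 * Real.sqrt 6 * ((2:ℝ)^l) ^ (1/2 - 1/r) * ((l:ℝ)+1) ^ 2 := by ring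
      _ ≤ _ := this
      _ = _ := by ring
  set C0 := 33 * Real.sqrt 6 * K with hC0
  have hC0p : 0 < C0 := by positivity
  rcases hq2.lt_or_eq with hq | hq
  · set D := q * (12 / (q-1) + 4 / (2-q)) with hD
    have hD0 : 0 < D := by
      have : 0 < q - 1 := by linarith
      have : 0 < 2 - q := by linarith
      positivity
    refine ⟨D ^ (1/q) * C0, by positivity, fun n l Ξ m hS f τ hτ => ?_⟩
    refine (strong_q hq1 hq hr hS f τ hτ).trans ?_
    refine mul_le_mul_of_nonneg_right ?_ (Finset.sum_nonneg fun x _ => by positivity)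
    have hP : (0:ℝ) < 2 ^ l := by positivity
    have hB0 : 0 ≤ Bc r l := by have := Bc_ge hr l; linarith
    rw [Real.mul_rpow (by positivity) (by positivity), Real.mul_rpow (by positivity) (by positivity),
      ← Real.rpow_mul hD0.le, one_div_mul_cancel hq0.ne', Real.rpow_one]
    have h1 := Real.rpow_le_rpow hB0 (hB l) hq0.le
    rw [Real.mul_rpow (by positivity) (by positivity)] at h1
    rw [← hD, mul_assoc D]
    refine mul_le_mul_of_nonneg_left ?_ hD0.le
    calc _ ≤ C0 ^ q * (((2:ℝ) ^ l) ^ (1/2 - 1/r + ε)) ^ q * ((2:ℝ)^l) ^ (1 - q/2) :=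
          mul_le_mul_of_nonneg_right h1 (by positivity)
      _ = _ := by
        rw [← Real.rpow_mul hP.le, ← Real.rpow_mul hP.le, mul_assoc, ← Real.rpow_add hP]
        congr 2; field_simp; ring
  · subst hq
    refine ⟨C0, hC0p, fun n l Ξ m hS f τ hτ => ?_⟩
    have h := L2_bound hr hS f τ hτ
    have h2 := h.trans (mul_le_mul_of_nonneg_right (hB l) (N2_nonneg f))
    have h3 := pow_le_pow_left₀ (N2_nonneg _) h2 2
    rw [mul_pow, N2_sq, N2_sq] at h3
    simpa only [Real.rpow_two, sq_abs] using h3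

end SMM

namespace SMM

lemma digit01 (n : ℤ) (x : ℝ) : digit n x = 0 ∨ digit n x = 1 := Int.emod_two_eq_zero_or_one _

lemma floor_half (y : ℝ) : ⌊y / 2⌋ = ⌊y⌋ / 2 := by
  have := Int.floor_div_natCast y 2
  simpa using this

lemma floor_succ (k : ℤ) (x : ℝ) : ⌊x / 2 ^ (k+1)⌋ = ⌊x / 2 ^ k⌋ / 2 := by
  rw [← floor_half, zpow_add_one₀ (by norm_num), div_div]

lemma floor_step (k : ℤ) (x : ℝ) : ⌊x / 2 ^ k⌋ = 2 * ⌊x / 2 ^ (k+1)⌋ + digit k x := by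
  rw [floor_succ]; unfold digit; omega

lemma floor_up {k k' : ℤ} (h : k ≤ k') {x y : ℝ} (hxy : ⌊x / 2 ^ k⌋ = ⌊y / 2 ^ k⌋) :
    ⌊x / 2 ^ k'⌋ = ⌊y / 2 ^ k'⌋ := by
  induction k', h using Int.leInduction with
  | base => exact hxy
  | succ m _ ih => rw [floor_succ, floor_succ, ih]

lemma floor_zero {k : ℤ} {x : ℝ} (h0 : 0 ≤ x) (h1 : x < 2 ^ k) : ⌊x / 2 ^ k⌋ = 0 := by
  have : (0:ℝ) < 2 ^ k := by positivity
  rw [Int.floor_eq_zero_iff]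
  exact ⟨by positivity, (div_lt_one this).2 h1⟩

lemma digit_zero {k n : ℤ} {x : ℝ} (h0 : 0 ≤ x) (h1 : x < 2 ^ k) (h : k ≤ n) : digit n x = 0 := by
  unfold digit
  rw [floor_zero h0 (h1.trans_le (zpow_le_zpow_right₀ (by norm_num) h))]; rfl

/-- Equal digits imply equal floors. -/
lemma floor_of_digits {k K : ℤ} (h : k ≤ K) {x y : ℝ} (hK : ⌊x / 2 ^ K⌋ = ⌊y / 2 ^ K⌋)
    (hd : ∀ i, k ≤ i → i < K → digit i x = digit i y) : ⌊x / 2 ^ k⌋ = ⌊y / 2 ^ k⌋ := by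
  obtain ⟨j, rfl⟩ : ∃ j : ℕ, k = K - j := ⟨(K - k).toNat, by omega⟩
  clear h
  induction j with
  | zero => simpa using hK
  | succ j ih =>
    rw [floor_step, floor_step (K - ((j+1 : ℕ):ℤ)) y]
    have e : K - ((j+1:ℕ):ℤ) + 1 = K - j := by push_cast; ring
    rw [e, ih (fun i h1 h2 => hd i (by push_cast; omega) h2), hd _ le_rfl (by push_cast; omega)]

lemma eq_of_floors {x y : ℝ} (K : ℤ) (h : ∀ k ≤ K, ⌊x / 2 ^ k⌋ = ⌊y / 2 ^ k⌋) : x = y := by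
  have key : ∀ j : ℕ, |x - y| ≤ 2 ^ K * (1/2) ^ j := by
    intro j
    have h1 := h (K - j) (by omega)
    have h2 := (Int.abs_sub_lt_one_of_floor_eq_floor h1).le
    have hp : (0:ℝ) < 2 ^ (K - (j:ℤ)) := by positivity
    rw [← sub_div, abs_div, abs_of_pos hp, div_le_one hp] at h2
    refine h2.trans (le_of_eq ?_)
    rw [zpow_sub₀ (by norm_num), zpow_natCast]; simp [div_eq_mul_inv]
  have hlim : Tendsto (fun j : ℕ => (2:ℝ) ^ K * (1/2) ^ j) atTop (nhds (2 ^ K * 0)) :=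
    (tendsto_pow_atTop_nhds_zero_of_lt_one (by norm_num) (by norm_num)).const_mul _
  rw [mul_zero] at hlim
  have := ge_of_tendsto' hlim key
  have h3 := abs_nonneg (x - y)
  exact sub_eq_zero.1 (abs_eq_zero.1 (le_antisymm this h3))

/-- Reading off the digit at position `-1` of a binary series. -/
lemma digit_series (e : ℤ → ℤ) (he : ∀ n, e n = 0 ∨ e n = 1) (N : ℕ) (hN : ∀ n : ℤ, (N:ℤ) ≤ n → e n = 0)
    (hb : ∃ n ≤ -2, e n = 0) : digit (-1) (∑' n : ℤ, ((e n : ℤ) : ℝ) * 2 ^ n) = e (-1) := by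
  set F : ℤ → ℝ := fun n => ((e (n - 1) : ℤ) : ℝ) * 2 ^ (n - 1) with hF
  have h1 : ∑' n : ℤ, ((e n : ℤ) : ℝ) * 2 ^ n = ∑' n, F n :=
    ((Equiv.subRight (1:ℤ)).tsum_eq (fun n : ℤ => ((e n : ℤ) : ℝ) * 2 ^ n)).symm
  have he1 : ∀ n, (0:ℝ) ≤ e n ∧ (e n : ℝ) ≤ 1 := by
    intro n; rcases he n with h | h <;> rw [h] <;> norm_num
  have hz : ∀ j : ℕ, j ∉ Finset.range (N+1) → F (j:ℤ) = 0 := by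
    intro j hj
    simp only [Finset.mem_range] at hj
    rw [hF]; simp only; rw [hN _ (by omega)]; simp
  have hs1 : HasSum (fun j : ℕ => F (j:ℤ)) (∑ j ∈ Finset.range (N+1), F (j:ℤ)) :=
    hasSum_sum_of_ne_finset_zero hz
  have hFneg : ∀ j : ℕ, F (-((j:ℤ)+1)) = (e (-2 - j) : ℝ) * ((1/2) / 2 * (1/2) ^ j) := by
    intro j
    rw [hF]; simp only
    rw [show -((j:ℤ)+1) - 1 = -2 - j by ring, zpow_sub₀ (by norm_num), zpow_natCast]
    congr 1
    rw [one_div, inv_pow, div_eq_mul_inv]; norm_num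
  have hgs : HasSum (fun j : ℕ => (1/2 : ℝ) / 2 * (1/2) ^ j) ((1/2)/2 * 2) := hasSum_geometric_two.mul_left _
  have hle : ∀ j : ℕ, F (-((j:ℤ)+1)) ≤ (1/2 : ℝ) / 2 * (1/2) ^ j := by
    intro j; rw [hFneg]
    exact mul_le_of_le_one_left (by positivity) (he1 _).2
  have hnn : ∀ j : ℕ, 0 ≤ F (-((j:ℤ)+1)) := by
    intro j; rw [hFneg]; exact mul_nonneg (he1 _).1 (by positivity)
  have hsum2 : Summable fun j : ℕ => F (-((j:ℤ)+1)) := Summable.of_nonneg_of_le hnn hle hgs.summable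
  set θ := ∑' j : ℕ, F (-((j:ℤ)+1)) with hθ
  have hθ0 : 0 ≤ θ := tsum_nonneg hnn
  have hθ1 : θ < 1/2 := by
    obtain ⟨n, hn, hn0⟩ := hb
    have : θ < ∑' j : ℕ, (1/2 : ℝ) / 2 * (1/2) ^ j := by
      refine Summable.tsum_lt_tsum (i := (-2 - n).toNat) hle ?_ hsum2 hgs.summable
      rw [hFneg]
      have : -2 - (((-2 - n).toNat : ℕ) : ℤ) = n := by omega
      rw [this, hn0]
      simp
    rw [hgs.tsum_eq] at this
    linarith
  have htot : ∑' n, F n = (∑ j ∈ Finset.range (N+1), F (j:ℤ)) + θ :=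
    (hs1.of_nat_of_neg_add_one hsum2.hasSum).tsum_eq
  rw [h1, htot]
  have hSumTwo : (∑ j ∈ Finset.range (N+1), F (j:ℤ)) * 2 =
      ((2 * (∑ j ∈ Finset.range N, e j * 2 ^ j) + e (-1) : ℤ) : ℝ) := by
    rw [Finset.sum_range_succ', add_mul, Finset.sum_mul]
    push_cast
    rw [Finset.mul_sum]
    congr 1
    · refine Finset.sum_congr rfl fun j _ => ?_
      rw [hF]; simp only
      rw [show ((j:ℤ)+1-1) = j by ring, zpow_natCast]; ring
    · rw [hF]; simp
  unfold digit
  have : ((∑ j ∈ Finset.range (N+1), F (j:ℤ)) + θ) / 2 ^ (-1:ℤ) =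
      ((2 * (∑ j ∈ Finset.range N, e j * 2 ^ j) + e (-1) : ℤ) : ℝ) + θ * 2 := by
    rw [← hSumTwo]; simp; ring
  rw [this, Int.floor_intCast_add, Int.floor_eq_zero_iff.2 ⟨by positivity, by linarith⟩]
  rcases he (-1) with h | h <;> rw [h] <;> omega

end SMM

namespace SMM

lemma exists_bd (x : ℝ) (K : ℤ) : ∃ a : ℤ, x < 2 ^ a ∧ K ≤ a := by
  obtain ⟨n, hn⟩ := pow_unbounded_of_one_lt x (show (1:ℝ) < 2 by norm_num)
  refine ⟨max n K, hn.trans_le ?_, le_max_right _ _⟩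
  rw [← zpow_natCast]
  exact zpow_le_zpow_right₀ (by norm_num) (le_max_left _ _)

lemma wMulDigit_eq {a b : ℤ} {x y : ℝ} (hx0 : 0 ≤ x) (hx : x < 2 ^ a) (hy0 : 0 ≤ y) (hy : y < 2 ^ b)
    (n : ℤ) : wMulDigit n x y = (∑ m ∈ Finset.Ioo (n - a) b, digit (n - m) x * digit m y) % 2 := by
  unfold wMulDigit
  rw [tsum_eq_sum (s := Finset.Ioo (n - a) b)]
  · rw [← Int.cast_sum, Int.floor_intCast]
  · intro m hm
    rw [Finset.mem_Ioo] at hm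
    by_cases h : n - a < m
    · have : b ≤ m := by by_contra h2; exact hm ⟨h, not_le.1 h2⟩
      rw [digit_zero hy0 hy this]; simp
    · rw [digit_zero hx0 hx (show a ≤ n - m by omega)]; simp

lemma wMulDigit01 (n : ℤ) (x y : ℝ) : wMulDigit n x y = 0 ∨ wMulDigit n x y = 1 :=
  Int.emod_two_eq_zero_or_one _

lemma wMulDigit_comm (n : ℤ) (x y : ℝ) : wMulDigit n x y = wMulDigit n y x := by
  unfold wMulDigit
  rw [← (Equiv.subLeft n).tsum_eq]
  simp only [Equiv.subLeft_apply, sub_sub_cancel, mul_comm]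

/-- The Walsh kernel. -/
def Bd (ξ x : ℝ) : ℝ := (-1 : ℝ) ^ (wMulDigit (-1) ξ x)

lemma walshe_good {ξ x : ℝ} (hξ : 0 ≤ ξ) (hx : 0 ≤ x) (h : ∃ n ≤ -2, wMulDigit n ξ x = 0) :
    walshe (wMul ξ x) = Bd ξ x := by
  unfold walshe Bd wMul
  obtain ⟨a, ha, ha0⟩ := exists_bd ξ 0
  obtain ⟨b, hb, hb0⟩ := exists_bd x 0
  rw [digit_series (fun n => wMulDigit n ξ x) (fun n => wMulDigit01 n ξ x) (a+b).toNat ?_ h]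
  intro n hn
  rw [wMulDigit_eq hξ ha hx hb, Finset.Ioo_eq_empty (by omega)]; rfl

lemma bad_countable {x : ℝ} (hx : 0 ≤ x) :
    {ξ : ℝ | 0 ≤ ξ ∧ ∀ n ≤ -2, wMulDigit n ξ x = 1}.Countable := by
  rcases hx.eq_or_lt with h0 | h0
  · subst h0
    convert Set.countable_empty
    ext ξ; simp only [Set.mem_setOf_eq, Set.mem_empty_iff_false, iff_false, not_and]
    intro _ h
    have := h (-2) le_rfl
    simp [wMulDigit, digit] at this
  · set p := Int.log 2 x with hp
    have hp1 : (2:ℝ) ^ p ≤ x := by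
      have := Int.zpow_log_le_self (b := 2) (r := x) (by norm_num) h0
      exact_mod_cast this
    have hp2 : x < (2:ℝ) ^ (p+1) := by
      have := Int.lt_zpow_succ_log_self (b := 2) (by norm_num) x
      exact_mod_cast this
    have hP : (0:ℝ) < 2 ^ p := by positivity
    have hdp : digit p x = 1 := by
      unfold digit
      have : ⌊x / 2 ^ p⌋ = 1 := by
        rw [Int.floor_eq_iff]
        push_cast
        rw [zpow_add_one₀ (by norm_num)] at hp2
        exact ⟨(one_le_div hP).2 hp1, by rw [div_lt_iff₀ hP]; linarith⟩
      rw [this]; rfl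
    refine Set.MapsTo.countable_of_injOn (f := fun ξ : ℝ => ⌊ξ / 2 ^ (-1-p)⌋) (t := Set.univ)
      (Set.mapsTo_univ _ _) ?_ Set.countable_univ
    rintro ξ ⟨hξ0, hξ⟩ ξ' ⟨hξ0', hξ'⟩ hfl
    simp only at hfl
    refine eq_of_floors (-1-p) fun k hk => ?_
    obtain ⟨j, rfl⟩ : ∃ j : ℕ, k = (-1-p) - j := ⟨((-1-p) - k).toNat, by omega⟩
    clear hk
    induction j with
    | zero => simpa using hfl
    | succ j ih =>
      rw [floor_step, floor_step _ ξ']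
      rw [show (-1-p) - ((j+1:ℕ):ℤ) + 1 = (-1-p) - j by push_cast; ring, ih]
      congr 1
      set k := (-1-p) - (j:ℤ) with hk
      rw [show (-1-p) - ((j+1:ℕ):ℤ) = k - 1 by push_cast; ring]
      obtain ⟨a1, ha1, ha2⟩ := exists_bd ξ k
      obtain ⟨a2, hb1, hb2⟩ := exists_bd ξ' a1
      have hc1 : ξ < 2 ^ a2 := ha1.trans_le (zpow_le_zpow_right₀ (by norm_num) hb2)
      have q1 := hξ (k - 1 + p) (by omega)
      have q2 := hξ' (k - 1 + p) (by omega)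
      rw [wMulDigit_eq hξ0 hc1 hx hp2] at q1
      rw [wMulDigit_eq hξ0' hb1 hx hp2] at q2
      have hmem : p ∈ Finset.Ioo (k - 1 + p - a2) (p+1) := by rw [Finset.mem_Ioo]; omega
      rw [← Finset.add_sum_erase _ _ hmem] at q1 q2
      have hrest : ∑ m ∈ (Finset.Ioo (k - 1 + p - a2) (p+1)).erase p, digit (k - 1 + p - m) ξ * digit m x =
          ∑ m ∈ (Finset.Ioo (k - 1 + p - a2) (p+1)).erase p, digit (k - 1 + p - m) ξ' * digit m x := by
        refine Finset.sum_congr rfl fun m hm => ?_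
        rw [Finset.mem_erase, Finset.mem_Ioo] at hm
        congr 1
        unfold digit
        rw [floor_up (show k ≤ k - 1 + p - m by omega) ih]
      rw [hrest, hdp, show k - 1 + p - p = k - 1 by ring] at q1
      rw [hdp, show k - 1 + p - p = k - 1 by ring] at q2
      generalize ∑ m ∈ (Finset.Ioo (k - 1 + p - a2) (p+1)).erase p, digit (k - 1 + p - m) ξ' * digit m x = S at q1 q2
      rcases digit01 (k-1) ξ with h | h <;> rcases digit01 (k-1) ξ' with h' | h' <;>
        rw [h] at q1 ⊢ <;> rw [h'] at q2 ⊢ <;> omega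

lemma walshe_ae {a : ℝ} (ha : 0 ≤ a) :
    ∀ᵐ b ∂(volume.restrict (Set.Ici (0:ℝ))), walshe (wMul a b) = Bd a b := by
  rw [ae_restrict_iff' measurableSet_Ici]
  have hc := (bad_countable ha).ae_notMem volume
  filter_upwards [hc] with b hb hb0
  refine walshe_good ha hb0 ?_
  by_contra hcon
  push Not at hcon
  refine hb ⟨hb0, fun n hn => ?_⟩
  rw [wMulDigit_comm]
  exact (wMulDigit01 n a b).resolve_left (hcon n hn)

lemma Bd_comm (a b : ℝ) : Bd a b = Bd b a := by unfold Bd; rw [wMulDigit_comm]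

/-- The digits of `ξ` at positions `i - L`. -/
def dd (n L : ℕ) (ξ : ℝ) : Fin n → Bool := fun i => decide (digit ((i:ℤ) - L) ξ = 1)

lemma negone_zpow_mod (s : ℤ) : (-1:ℝ) ^ (s % 2) = (-1:ℝ) ^ s := by
  conv_rhs => rw [← Int.emod_add_mul_ediv s 2, zpow_add₀ (by norm_num), zpow_mul]
  simp

lemma negone_zpow_sum {ι : Type*} (S : Finset ι) (f : ι → ℤ) :
    (-1:ℝ) ^ (∑ i ∈ S, f i) = ∏ i ∈ S, (-1:ℝ) ^ (f i) := by
  induction S using Finset.induction_on with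
  | empty => simp
  | insert a S ha ih => rw [Finset.sum_insert ha, Finset.prod_insert ha, zpow_add₀ (by norm_num), ih]

lemma Bd_chi (L M : ℕ) {ξ x : ℝ} (hξ0 : 0 ≤ ξ) (hξ : ξ < 2 ^ (M:ℤ)) (hx0 : 0 ≤ x) (hx : x < 2 ^ (L:ℤ)) :
    Bd ξ x = chi (dd (L+M) L ξ) (fun i => dd (L+M) M x i.rev) := by
  unfold Bd chi
  rw [wMulDigit_eq hξ0 hξ hx0 hx, negone_zpow_mod, negone_zpow_sum]
  symm
  refine Finset.prod_bij (fun (i : Fin (L+M)) _ => (L:ℤ) - 1 - i) ?_ ?_ ?_ ?_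
  · intro i _; rw [Finset.mem_Ioo]; have := i.2; omega
  · intro i _ j _ h; ext; omega
  · intro m hm
    rw [Finset.mem_Ioo] at hm
    refine ⟨⟨((L:ℤ) - 1 - m).toNat, by omega⟩, Finset.mem_univ _, ?_⟩
    simp only; omega
  · intro i _
    have hi := i.2
    have e1 : (-1 - ((L:ℤ) - 1 - i)) = (i:ℤ) - L := by ring
    have e2 : (((Fin.rev i : Fin (L+M)) : ℕ) : ℤ) - M = (L:ℤ) - 1 - i := by
      rw [Fin.val_rev]; omega
    unfold dd sg
    simp only [e1, e2]
    rcases digit01 ((i:ℤ) - L) ξ with h | h <;> rcases digit01 ((L:ℤ) - 1 - i) x with h' | h' <;>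
      simp [h, h']

end SMM

namespace SMM

/-- A cell of the digit map. -/
def cell (n L : ℕ) (η : Fin n → Bool) : Set ℝ := {ξ | 0 ≤ ξ ∧ ξ < 2 ^ ((n:ℤ) - L) ∧ dd n L ξ = η}

lemma testBit_bij (n : ℕ) :
    Function.Bijective fun (j : Fin (2 ^ n)) (i : Fin n) => (j : ℕ).testBit i := by
  rw [Fintype.bijective_iff_injective_and_card]
  refine ⟨?_, by simp⟩
  intro j k h
  ext
  refine Nat.eq_of_testBit_eq fun i => ?_
  by_cases hi : i < n
  · exact congrFun h ⟨i, hi⟩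
  · have hp : 2 ^ n ≤ 2 ^ i := Nat.pow_le_pow_right (by norm_num) (not_lt.1 hi)
    rw [Nat.testBit_eq_false_of_lt (j.2.trans_le hp), Nat.testBit_eq_false_of_lt (k.2.trans_le hp)]

lemma dd_testBit {n L : ℕ} {ξ : ℝ} {j : ℕ} (h : ⌊ξ * 2 ^ L⌋ = j) (i : Fin n) :
    dd n L ξ i = j.testBit i := by
  unfold dd digit
  have e : ξ / 2 ^ ((i:ℤ) - L) = (ξ * 2 ^ L) / ((2 ^ (i:ℕ) : ℕ) : ℝ) := by
    rw [zpow_sub₀ (by norm_num), zpow_natCast, zpow_natCast]; push_cast; field_simp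
  rw [e, Int.floor_div_natCast, h, Nat.testBit_eq_decide_div_mod_eq]
  congr 1
  norm_cast

lemma cell_eq (n L : ℕ) (η : Fin n → Bool) : ∃ j : ℕ, cell n L η =
    Set.Ico ((j:ℝ) / 2 ^ L) (((j:ℝ) + 1) / 2 ^ L) := by
  obtain ⟨j, hj⟩ := (testBit_bij n).2 η
  refine ⟨j, ?_⟩
  have hP : (0:ℝ) < 2 ^ L := by positivity
  have e : (2:ℝ) ^ ((n:ℤ) - L) = 2 ^ n / 2 ^ L := by
    rw [zpow_sub₀ (by norm_num), zpow_natCast, zpow_natCast]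
  ext ξ
  simp only [cell, Set.mem_setOf_eq, Set.mem_Ico, e]
  rw [div_le_iff₀ hP, lt_div_iff₀ hP, lt_div_iff₀ hP]
  constructor
  · rintro ⟨h0, h1, h2⟩
    have k0 : 0 ≤ ⌊ξ * 2 ^ L⌋ := Int.floor_nonneg.2 (by positivity)
    obtain ⟨k, hk⟩ := Int.eq_ofNat_of_zero_le k0
    have k1 : k < 2 ^ n := by
      have : ⌊ξ * 2 ^ L⌋ < (2:ℤ) ^ n := by rw [Int.floor_lt]; exact_mod_cast h1
      rw [hk] at this; exact_mod_cast this
    have : (⟨k, k1⟩ : Fin (2 ^ n)) = j := by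
      apply (testBit_bij n).1
      rw [hj, ← h2]
      funext i
      exact (dd_testBit hk i).symm
    rw [← this]
    rw [Int.floor_eq_iff] at hk
    exact_mod_cast hk
  · rintro ⟨h0, h1⟩
    have hf : ⌊ξ * 2 ^ L⌋ = ((j:ℕ):ℤ) := by
      rw [Int.floor_eq_iff]
      constructor
      · push_cast; exact h0
      · push_cast; exact h1
    refine ⟨?_, ?_, ?_⟩
    · have : 0 ≤ ξ * 2 ^ L := le_trans (by positivity) h0
      exact nonneg_of_mul_nonneg_left this hP
    · have : ((j:ℕ):ℝ) + 1 ≤ 2 ^ n := by exact_mod_cast j.2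
      linarith
    · rw [← hj]; funext i; exact dd_testBit hf i

lemma cell_meas (n L : ℕ) (η : Fin n → Bool) : MeasurableSet (cell n L η) := by
  obtain ⟨j, hj⟩ := cell_eq n L η
  rw [hj]; exact measurableSet_Ico

lemma cell_vol (n L : ℕ) (η : Fin n → Bool) : volume (cell n L η) = ENNReal.ofReal ((2 ^ L)⁻¹) := by
  obtain ⟨j, hj⟩ := cell_eq n L η
  rw [hj, Real.volume_Ico]; congr 1; ring

lemma cell_nonempty (n L : ℕ) (η : Fin n → Bool) : (cell n L η).Nonempty := by
  obtain ⟨j, hj⟩ := cell_eq n L η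
  rw [hj, Set.nonempty_Ico]
  gcongr; linarith

lemma cell_disj (n L : ℕ) : Pairwise (Function.onFun Disjoint (cell n L)) := by
  intro η η' h
  rw [Function.onFun, Set.disjoint_left]
  intro ξ h1 h2
  exact h (h1.2.2.symm.trans h2.2.2)

lemma cell_union (n L : ℕ) : (⋃ η, cell n L η) = Set.Ico 0 ((2:ℝ) ^ ((n:ℤ) - L)) := by
  ext ξ
  simp only [Set.mem_iUnion, cell, Set.mem_setOf_eq, Set.mem_Ico]
  constructor
  · rintro ⟨η, h0, h1, _⟩; exact ⟨h0, h1⟩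
  · rintro ⟨h0, h1⟩; exact ⟨_, h0, h1, rfl⟩

/-- An integral over the big interval splits into cells. -/
lemma int_cells (n L : ℕ) {h : ℝ → ℝ} (c : (Fin n → Bool) → ℝ)
    (g : ℝ → ℝ) (hg : IntegrableOn g (Set.Ico 0 ((2:ℝ) ^ ((n:ℤ) - L))))
    (hh : ∀ᵐ ξ ∂(volume.restrict (Set.Ico 0 ((2:ℝ) ^ ((n:ℤ) - L)))), h ξ = c (dd n L ξ) * g ξ) :
    ∫ ξ in Set.Ico 0 ((2:ℝ) ^ ((n:ℤ) - L)), h ξ = ∑ η, c η * ∫ ξ in cell n L η, g ξ := by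
  rw [integral_congr_ae hh]
  have hsub : ∀ η, cell n L η ⊆ Set.Ico 0 ((2:ℝ) ^ ((n:ℤ) - L)) := fun η => by
    rw [← cell_union]; exact Set.subset_iUnion _ _
  have e : ∀ η, Set.EqOn (fun ξ => c η * g ξ) (fun ξ => c (dd n L ξ) * g ξ) (cell n L η) := by
    intro η ξ hξ
    simp only; rw [hξ.2.2]
  rw [← cell_union, integral_iUnion_fintype (cell_meas n L) (cell_disj n L)]
  · refine Finset.sum_congr rfl fun η _ => ?_
    rw [← setIntegral_congr_fun (cell_meas n L η) (e η), integral_const_mul]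
  · intro η
    have : IntegrableOn (fun ξ => c η * g ξ) (cell n L η) := (hg.mono_set (hsub η)).const_mul _
    exact this.congr_fun (e η) (cell_meas n L η)

end SMM

namespace SMM

lemma digit_meas (n : ℤ) : Measurable (digit n) := by
  unfold digit
  have h : Measurable fun x : ℝ => ⌊x / 2 ^ n⌋ := Int.measurable_floor.comp (measurable_id.div_const _)
  exact (measurable_from_top (f := fun z : ℤ => z % 2)).comp h

lemma Bd_aesm {ξ : ℝ} (hξ : 0 ≤ ξ) :
    AEStronglyMeasurable (Bd ξ) (volume.restrict (Set.Ici (0:ℝ))) := by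
  have hU : Set.Ici (0:ℝ) = ⋃ b : ℕ, Set.Ico 0 ((2:ℝ) ^ (b:ℤ)) := by
    ext x
    simp only [Set.mem_Ici, Set.mem_iUnion, Set.mem_Ico]
    constructor
    · intro h
      obtain ⟨n, hn⟩ := pow_unbounded_of_one_lt x (show (1:ℝ) < 2 by norm_num)
      exact ⟨n, h, by rw [zpow_natCast]; exact hn⟩
    · rintro ⟨_, h, _⟩; exact h
  rw [hU, aestronglyMeasurable_iUnion_iff]
  intro b
  obtain ⟨a, ha, -⟩ := exists_bd ξ 0
  have hm : Measurable fun x : ℝ =>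
      (-1:ℝ) ^ ((∑ m ∈ Finset.Ioo (-1 - a) (b:ℤ), digit (-1 - m) ξ * digit m x) % 2) := by
    have h1 : Measurable fun x : ℝ => ∑ m ∈ Finset.Ioo (-1 - a) (b:ℤ), digit (-1 - m) ξ * digit m x := by
      refine Finset.measurable_sum _ fun m _ => ?_
      exact (measurable_from_top (f := fun z : ℤ => digit (-1 - m) ξ * z)).comp (digit_meas m)
    exact (measurable_from_top (f := fun z : ℤ => (-1:ℝ) ^ (z % 2))).comp h1
  refine hm.aestronglyMeasurable.congr ?_
  filter_upwards [ae_restrict_mem measurableSet_Ico] with x hx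
  unfold Bd
  rw [wMulDigit_eq hξ ha hx.1 hx.2]

lemma walshe_pm (y : ℝ) : walshe y = 1 ∨ walshe y = -1 := by
  unfold walshe
  rcases digit01 (-1) y with h | h <;> rw [h] <;> simp

lemma walshe_norm (y : ℝ) : ‖walshe y‖ = 1 := by
  rcases walshe_pm y with h | h <;> rw [h] <;> simp

lemma walshe_aesm {ξ : ℝ} (hξ : 0 ≤ ξ) :
    AEStronglyMeasurable (fun x => walshe (wMul ξ x)) (volume.restrict (Set.Ici (0:ℝ))) :=
  (Bd_aesm hξ).congr ((walshe_ae hξ).mono fun _ h => h.symm)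

lemma walshFT_nonint {g : ℝ → ℝ} (hg : ¬ IntegrableOn g (Set.Ici 0)) {ξ : ℝ} (hξ : 0 ≤ ξ) :
    walshFT g ξ = 0 := by
  unfold walshFT
  refine integral_undef fun h => hg ?_
  have := h.bdd_mul (c := 1) (walshe_aesm hξ) (ae_of_all _ fun x => (walshe_norm _).le)
  refine this.congr (ae_of_all _ fun x => ?_)
  simp only
  rcases walshe_pm (wMul ξ x) with h | h <;> rw [h] <;> ring

lemma walshFT_bound {g : ℝ → ℝ} (ξ : ℝ) : ‖walshFT g ξ‖ ≤ ∫ x in Set.Ici (0:ℝ), ‖g x‖ := by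
  unfold walshFT
  refine (norm_integral_le_integral_norm _).trans_eq ?_
  simp only [norm_mul, walshe_norm, one_mul]

/-- Abstract hypotheses on the sequence of multipliers. -/
structure RSys (M L0 l : ℕ) (r : ℝ) (X : Finset ℝ) (m : ℤ → ℝ → ℝ) : Prop where
  card : X.card ≤ 2 ^ l
  mem : ∀ a ∈ X, 0 ≤ a ∧ a < 2 ^ (M:ℤ)
  supp : ∀ k ξ, 2 ^ (M:ℤ) ≤ ξ → m k ξ = 0
  loc : ∀ k ξ η, 0 ≤ ξ → 0 ≤ η → ⌊ξ / 2 ^ (1 - k)⌋ = ⌊η / 2 ^ (1 - k)⌋ → m k ξ = m k η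
  hi : ∀ k : ℤ, (L0:ℤ) + 1 ≤ k → m k = m (L0 + 1)
  lo : ∀ k : ℤ, k ≤ 1 - (M:ℤ) → m k = m (1 - M)
  stab : ∀ k k' : ℤ, k' ≤ k → ∀ ξ, 0 ≤ ξ → (∀ a ∈ X, ⌊ξ / 2 ^ (1 - k')⌋ ≠ ⌊a / 2 ^ (1 - k')⌋) →
    m k ξ = m k' ξ
  bd : ∀ k ξ, 0 ≤ ξ → |m k ξ| ≤ 1
  var : ∀ ξ, 0 ≤ ξ → ∀ u : ℕ → ℤ, Antitone u → ∀ N : ℕ,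
    ∑ j ∈ Finset.range N, |m (u (j+1)) ξ - m (u j) ξ| ^ r ≤ 1

/-- A representative of a cell. -/
def rep (n L : ℕ) (η : Fin n → Bool) : ℝ := (cell_nonempty n L η).some

lemma rep_mem (n L : ℕ) (η : Fin n → Bool) : rep n L η ∈ cell n L η := (cell_nonempty n L η).some_mem

/-- Discretized multiplier. -/
def mm (M L : ℕ) (m : ℤ → ℝ → ℝ) (t : ℕ) (η : Fin (L+M) → Bool) : ℝ := m (L + 1 - t) (rep (L+M) L η)

lemma exp_eq (L M : ℕ) : (((L+M:ℕ):ℤ) - (L:ℤ)) = (M:ℤ) := by push_cast; ring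

lemma exp_eq' (L M : ℕ) : (((L+M:ℕ):ℤ) - (M:ℤ)) = (L:ℤ) := by push_cast; ring

lemma cls_floor {L M t : ℕ} {ξ η : ℝ} (hξ0 : 0 ≤ ξ) (hξ : ξ < 2 ^ (M:ℤ)) (hη0 : 0 ≤ η)
    (hη : η < 2 ^ (M:ℤ)) (h : cls t (dd (L+M) L ξ) = cls t (dd (L+M) L η)) :
    ⌊ξ / 2 ^ ((t:ℤ) - L)⌋ = ⌊η / 2 ^ ((t:ℤ) - L)⌋ := by
  by_cases ht : t ≤ L + M
  · refine floor_of_digits (K := (M:ℤ)) (by omega) ?_ ?_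
    · rw [floor_zero hξ0 hξ, floor_zero hη0 hη]
    · intro i hi hi2
      rw [cls_eq_iff] at h
      have := h ⟨(i + L).toNat, by omega⟩ (by simp only; omega)
      unfold dd at this
      have e : (((i + L).toNat : ℕ) : ℤ) - L = i := by omega
      simp only [e, decide_eq_decide] at this
      rcases digit01 i ξ with h1 | h1 <;> rcases digit01 i η with h2 | h2 <;> simp_all
  · have h2 : (2:ℝ) ^ (M:ℤ) ≤ 2 ^ ((t:ℤ) - L) := zpow_le_zpow_right₀ (by norm_num) (by omega)
    rw [floor_zero hξ0 (hξ.trans_le h2), floor_zero hη0 (hη.trans_le h2)]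

lemma floor_cls {L M t : ℕ} {ξ η : ℝ} (h : ⌊ξ / 2 ^ ((t:ℤ) - L)⌋ = ⌊η / 2 ^ ((t:ℤ) - L)⌋) :
    cls t (dd (L+M) L ξ) = cls t (dd (L+M) L η) := by
  rw [cls_eq_iff]
  intro i hi
  unfold dd digit
  rw [floor_up (k := (t:ℤ) - L) (k' := (i:ℤ) - L) (by omega) h]

lemma rsys_sys {M L0 l : ℕ} {r : ℝ} {X : Finset ℝ} {m : ℤ → ℝ → ℝ} (H : RSys M L0 l r X m) (L : ℕ) :
    Sys (L+M) l r (X.image (dd (L+M) L)) (mm M L m) := by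
  have hrep : ∀ η : Fin (L+M) → Bool, 0 ≤ rep (L+M) L η ∧ rep (L+M) L η < 2 ^ (M:ℤ) ∧
      dd (L+M) L (rep (L+M) L η) = η := by
    intro η
    have := rep_mem (L+M) L η
    unfold cell at this
    rw [exp_eq] at this
    exact this
  refine ⟨Finset.card_image_le.trans H.card, ?_, ?_, ?_⟩
  · intro t ξ η h
    unfold mm
    refine H.loc _ _ _ (hrep ξ).1 (hrep η).1 ?_
    have e : (1 - ((L:ℤ) + 1 - t)) = (t:ℤ) - L := by ring
    rw [e]
    refine cls_floor (hrep ξ).1 (hrep ξ).2.1 (hrep η).1 (hrep η).2.1 ?_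
    rw [(hrep ξ).2.2, (hrep η).2.2, h]
  · intro s t hst ht ξ hξ
    unfold mm
    refine H.stab _ _ (by omega) _ (hrep ξ).1 fun a ha hf => hξ ?_
    have e : (1 - ((L:ℤ) + 1 - t)) = (t:ℤ) - L := by ring
    rw [e] at hf
    rw [Finset.mem_image]
    refine ⟨dd (L+M) L a, Finset.mem_image_of_mem _ ha, ?_⟩
    rw [← floor_cls hf, (hrep ξ).2.2]
  · intro ξ
    refine ⟨fun t => H.bd _ _ (hrep ξ).1, fun u hu N => ?_⟩
    unfold mm
    refine H.var _ (hrep ξ).1 (fun j => (L:ℤ) + 1 - (u j : ℕ)) ?_ N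
    intro i j hij
    have := hu hij
    simp only; omega

lemma rsys_mm {M L0 l : ℕ} {r : ℝ} {X : Finset ℝ} {m : ℤ → ℝ → ℝ} (H : RSys M L0 l r X m) {L : ℕ}
    (hL : L0 ≤ L) (k : ℤ) : ∃ t ≤ L + M, ∀ ξ, 0 ≤ ξ → ξ < 2 ^ (M:ℤ) →
      m k ξ = mm M L m t (dd (L+M) L ξ) := by
  have key : ∀ t : ℕ, t ≤ L + M → ∀ ξ, 0 ≤ ξ → ξ < 2 ^ (M:ℤ) →
      m ((L:ℤ) + 1 - t) ξ = mm M L m t (dd (L+M) L ξ) := by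
    intro t ht ξ h0 h1
    unfold mm
    have hr := rep_mem (L+M) L (dd (L+M) L ξ)
    unfold cell at hr
    rw [exp_eq] at hr
    obtain ⟨r0, r1, r2⟩ := hr
    refine H.loc _ _ _ h0 r0 ?_
    have e : (1 - ((L:ℤ) + 1 - t)) = (t:ℤ) - L := by ring
    rw [e]
    refine cls_floor h0 h1 r0 r1 ?_
    rw [r2]
  by_cases h1 : (L:ℤ) + 1 ≤ k
  · refine ⟨0, by omega, ?_⟩
    rw [H.hi k (by omega), ← H.hi ((L:ℤ) + 1 - (0:ℕ)) (by omega)]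
    exact key 0 (by omega)
  · by_cases h2 : k ≤ 1 - (M:ℤ)
    · refine ⟨L+M, le_rfl, ?_⟩
      rw [H.lo k h2, ← H.lo ((L:ℤ) + 1 - ((L+M:ℕ):ℤ)) (by push_cast; omega)]
      exact key _ le_rfl
    · obtain ⟨t, ht⟩ : ∃ t : ℕ, (L:ℤ) + 1 - t = k := ⟨((L:ℤ) + 1 - k).toNat, by omega⟩
      refine ⟨t, by omega, ?_⟩
      rw [← ht]
      exact key t (by omega)

end SMM

namespace SMM

/-- Reversal of digits. -/
def rv {n : ℕ} (η : Fin n → Bool) : Fin n → Bool := fun i => η i.rev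

lemma rv_rv {n : ℕ} (η : Fin n → Bool) : rv (rv η) = η := by funext i; simp [rv]

/-- Reversal of digits as an equivalence. -/
def rvE (n : ℕ) : (Fin n → Bool) ≃ (Fin n → Bool) := ⟨rv, rv, rv_rv, rv_rv⟩

/-- Truncation of `g`. -/
def trunc (L : ℕ) (g : ℝ → ℝ) : ℝ → ℝ := Set.indicator (Set.Ico 0 ((2:ℝ) ^ (L:ℤ))) g

/-- Cell integrals of `g`. -/
def fv (L M : ℕ) (g : ℝ → ℝ) (y : Fin (L+M) → Bool) : ℝ := ∫ x in cell (L+M) M (rv y), g x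

lemma int_ind {a : ℝ} (h : ℝ → ℝ) (hz : ∀ x, a ≤ x → h x = 0) :
    ∫ x in Set.Ici (0:ℝ), h x = ∫ x in Set.Ico (0:ℝ) a, h x := by
  refine setIntegral_eq_of_subset_of_forall_sdiff_eq_zero measurableSet_Ici
    (fun x hx => hx.1) ?_
  intro x hx
  refine hz x ?_
  by_contra hc
  exact hx.2 ⟨hx.1, not_le.1 hc⟩

lemma trunc_zero {L : ℕ} {g : ℝ → ℝ} {x : ℝ} (h : (2:ℝ) ^ (L:ℤ) ≤ x) : trunc L g x = 0 := by
  unfold trunc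
  rw [Set.indicator_of_notMem]
  exact fun hx => absurd hx.2 (not_lt.2 h)

lemma ft_trunc {L M : ℕ} {g : ℝ → ℝ} (hg : IntegrableOn g (Set.Ici 0)) {ξ : ℝ} (h0 : 0 ≤ ξ)
    (h1 : ξ < 2 ^ (M:ℤ)) : walshFT (trunc L g) ξ = hat (fv L M g) (dd (L+M) L ξ) := by
  unfold walshFT
  rw [int_ind (a := (2:ℝ) ^ (L:ℤ)) _ (fun x hx => by rw [trunc_zero hx, mul_zero])]
  have := int_cells (L+M) M (h := fun x => walshe (wMul ξ x) * trunc L g x)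
    (fun η => chi (dd (L+M) L ξ) (rv η)) g
    (hg.mono_set fun x hx => hx.1) ?_
  · rw [exp_eq'] at this
    rw [this]
    unfold hat fv
    rw [← (rvE (L+M)).sum_comp]
    simp only [rvE, Equiv.coe_fn_mk, rv_rv]
  · rw [exp_eq']
    have hsub : Set.Ico (0:ℝ) (2 ^ (L:ℤ)) ⊆ Set.Ici 0 := fun x hx => hx.1
    filter_upwards [ae_restrict_of_ae_restrict_of_subset hsub (walshe_ae h0),
      ae_restrict_mem measurableSet_Ico] with x hx hm
    rw [hx, Bd_chi L M h0 h1 hm.1 hm.2, trunc, Set.indicator_of_mem hm]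
    rfl

lemma ft_mult {L M : ℕ} {g : ℝ → ℝ} (hg : IntegrableOn g (Set.Ici 0)) {x : ℝ} (h0 : 0 ≤ x)
    (h1 : x < 2 ^ (L:ℤ)) (mu : ℝ → ℝ) (hs : ∀ ξ, 2 ^ (M:ℤ) ≤ ξ → mu ξ = 0)
    (nu : (Fin (L+M) → Bool) → ℝ) (hnu : ∀ ξ, 0 ≤ ξ → ξ < 2 ^ (M:ℤ) → mu ξ = nu (dd (L+M) L ξ)) :
    walshFT (fun ξ => mu ξ * walshFT (trunc L g) ξ) x =
      2 ^ M * Tm nu (fv L M g) (rv (dd (L+M) M x)) := by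
  rw [show walshFT (fun ξ => mu ξ * walshFT (trunc L g) ξ) x =
    ∫ ξ in Set.Ici (0:ℝ), walshe (wMul x ξ) * (mu ξ * walshFT (trunc L g) ξ) from rfl]
  rw [int_ind (a := (2:ℝ) ^ (M:ℤ)) _ (fun ξ hξ => by rw [hs ξ hξ, zero_mul, mul_zero])]
  have := int_cells (L+M) L (h := fun ξ => walshe (wMul x ξ) * (mu ξ * walshFT (trunc L g) ξ))
    (fun η => nu η * chi η (rv (dd (L+M) M x)) * hat (fv L M g) η) (fun _ => 1) ?_ ?_
  · rw [exp_eq] at this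
    rw [this]
    have hc : ∀ η, ∫ ξ in cell (L+M) L η, (1:ℝ) = (2 ^ L)⁻¹ := by
      intro η
      rw [setIntegral_const, Measure.real, cell_vol, ENNReal.toReal_ofReal (by positivity)]; simp
    simp only [hc]
    unfold Tm
    rw [← Finset.sum_mul, mul_comm, ← mul_assoc]
    congr 1
    rw [pow_add]; field_simp
  · exact integrableOn_const (by rw [Real.volume_Ico]; exact ENNReal.ofReal_ne_top)
  · rw [exp_eq]
    have hsub : Set.Ico (0:ℝ) (2 ^ (M:ℤ)) ⊆ Set.Ici 0 := fun x hx => hx.1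
    filter_upwards [ae_restrict_of_ae_restrict_of_subset hsub (walshe_ae h0),
      ae_restrict_mem measurableSet_Ico] with ξ hξ hm
    rw [hξ, Bd_comm, Bd_chi L M hm.1 hm.2 h0 h1, ft_trunc hg hm.1 hm.2, hnu ξ hm.1 hm.2]
    unfold rv
    ring

/-- Jensen on a cell. -/
lemma jensen_cell {q : ℝ} (hq : 1 < q) (n M : ℕ) (η : Fin n → Bool) {g : ℝ → ℝ}
    (hg : IntegrableOn g (Set.Ici 0)) :
    ENNReal.ofReal (|∫ x in cell n M η, g x| ^ q) ≤
      ENNReal.ofReal (((2:ℝ) ^ M)⁻¹ ^ (q - 1)) * ∫⁻ x in cell n M η, ENNReal.ofReal (|g x| ^ q) := by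
  have hq0 : 0 < q := by linarith
  have hsub : cell n M η ⊆ Set.Ici 0 := fun x hx => hx.1
  have hgm : AEMeasurable (fun x => ‖g x‖ₑ) (volume.restrict (cell n M η)) :=
    (hg.mono_set hsub).aestronglyMeasurable.enorm
  have h1 : ENNReal.ofReal |∫ x in cell n M η, g x| ≤ ∫⁻ x in cell n M η, ‖g x‖ₑ := by
    rw [← Real.enorm_eq_ofReal_abs]
    exact enorm_integral_le_lintegral_enorm _
  have hpq : q.HolderConjugate (q / (q - 1)) := by
    rw [Real.holderConjugate_iff]; refine ⟨hq, ?_⟩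
    have : q - 1 ≠ 0 := by linarith
    field_simp; ring
  have h2 := ENNReal.lintegral_mul_le_Lp_mul_Lq (volume.restrict (cell n M η)) hpq hgm
    (g := fun _ => 1) aemeasurable_const
  simp only [Pi.mul_apply, mul_one, ENNReal.one_rpow, lintegral_one, Measure.restrict_apply_univ,
    cell_vol] at h2
  calc ENNReal.ofReal (|∫ x in cell n M η, g x| ^ q)
      = (ENNReal.ofReal |∫ x in cell n M η, g x|) ^ q :=
        (ENNReal.ofReal_rpow_of_nonneg (abs_nonneg _) hq0.le).symm
    _ ≤ ((∫⁻ x in cell n M η, ‖g x‖ₑ ^ q) ^ (1 / q) *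
          ENNReal.ofReal (((2:ℝ) ^ M)⁻¹) ^ (1 / (q / (q - 1)))) ^ q :=
        ENNReal.rpow_le_rpow (h1.trans h2) hq0.le
    _ = _ := by
        rw [ENNReal.mul_rpow_of_nonneg _ _ hq0.le, ← ENNReal.rpow_mul, ← ENNReal.rpow_mul,
          one_div_mul_cancel hq0.ne', ENNReal.rpow_one, mul_comm]
        congr 1
        · rw [ENNReal.ofReal_rpow_of_nonneg (by positivity) (by
            have : 0 < q - 1 := by linarith
            positivity)]
          congr 2
          have : q - 1 ≠ 0 := by linarith
          field_simp
        · refine lintegral_congr fun x => ?_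
          rw [Real.enorm_eq_ofReal_abs, ENNReal.ofReal_rpow_of_nonneg (abs_nonneg _) hq0.le]

end SMM

namespace SMM

lemma trunc_max {q K : ℝ} (hq : 1 < q) {M L0 l : ℕ} {r : ℝ} {X : Finset ℝ} {m : ℤ → ℝ → ℝ}
    (H : RSys M L0 l r X m) {L : ℕ} (hL : L0 ≤ L)
    (hK : ∀ (f : (Fin (L+M) → Bool) → ℝ) (τ : (Fin (L+M) → Bool) → ℕ), (∀ x, τ x ≤ L+M) →
      ∑ x, |Tm (mm M L m (τ x)) f x| ^ q ≤ K ^ q * ∑ x, |f x| ^ q)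
    (hK0 : 0 < K)
    {g : ℝ → ℝ} (hg : IntegrableOn g (Set.Ici 0)) :
    ∃ G : ℝ → ℝ≥0∞, Measurable G ∧
      ∫⁻ x in Set.Ici (0:ℝ), G x ≤ ENNReal.ofReal (K ^ q) * ∫⁻ x in Set.Ici (0:ℝ), ENNReal.ofReal (|g x| ^ q) ∧
      ∀ x, 0 ≤ x → x < 2 ^ (L:ℤ) → ∀ k,
        ENNReal.ofReal (|walshFT (fun ξ => m k ξ * walshFT (trunc L g) ξ) x| ^ q) ≤ G x := by
  have hq0 : 0 < q := by linarith
  set f := fv L M g with hf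
  have hτ : ∀ x : Fin (L+M) → Bool, ∃ t, t ≤ L+M ∧ ∀ s ≤ L+M, |Tm (mm M L m s) f x| ≤ |Tm (mm M L m t) f x| := by
    intro x
    obtain ⟨t, ht, hmax⟩ := Finset.exists_max_image (Finset.range (L+M+1))
      (fun s => |Tm (mm M L m s) f x|) ⟨0, by simp⟩
    exact ⟨t, by simpa [Nat.lt_succ_iff] using ht, fun s hs => hmax s (by simp; omega)⟩
  choose τ hτ1 hτ2 using hτ
  set v : (Fin (L+M) → Bool) → ℝ := fun y => ((2:ℝ) ^ M) ^ q * |Tm (mm M L m (τ y)) f y| ^ q with hv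
  have hv0 : ∀ y, 0 ≤ v y := fun y => by simp only [hv]; positivity
  refine ⟨fun x => ∑ η, (cell (L+M) M η).indicator (fun _ => ENNReal.ofReal (v (rv η))) x, ?_, ?_, ?_⟩
  · refine Finset.measurable_sum _ fun η _ => ?_
    exact measurable_const.indicator (cell_meas _ _ _)
  · rw [lintegral_finsetSum _ fun η _ => measurable_const.indicator (cell_meas _ _ _)]
    have e1 : ∀ η, ∫⁻ x in Set.Ici (0:ℝ), (cell (L+M) M η).indicator (fun _ => ENNReal.ofReal (v (rv η))) x
        ≤ ENNReal.ofReal (((2:ℝ) ^ M)⁻¹ * v (rv η)) := by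
      intro η
      rw [lintegral_indicator_const (cell_meas _ _ _), mul_comm,
        ENNReal.ofReal_mul (show (0:ℝ) ≤ ((2:ℝ) ^ M)⁻¹ by positivity)]
      rw [← cell_vol (L+M) M η]
      refine mul_le_mul' ?_ le_rfl
      exact Measure.restrict_apply_le _ _
    refine (Finset.sum_le_sum fun η _ => e1 η).trans ?_
    have e2 : ∑ η : Fin (L+M) → Bool, ENNReal.ofReal (((2:ℝ) ^ M)⁻¹ * v (rv η)) =
        ENNReal.ofReal (((2:ℝ) ^ M)⁻¹ * ∑ y, v y) := by
      rw [← ENNReal.ofReal_sum_of_nonneg fun η _ => mul_nonneg (by positivity) (hv0 _),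
        ← Finset.mul_sum]
      congr 2
      exact (rvE (L+M)).sum_comp v
    rw [e2]
    have e3 : ((2:ℝ) ^ M)⁻¹ * ∑ y, v y ≤ K ^ q * (((2:ℝ) ^ M) ^ (q - 1) * ∑ y, |f y| ^ q) := by
      simp only [hv]
      rw [← Finset.mul_sum]
      have h := hK f τ hτ1
      have h2 : ((2:ℝ) ^ M) ^ q = 2 ^ M * ((2:ℝ) ^ M) ^ (q - 1) := by
        rw [Real.rpow_sub_one (by positivity)]; field_simp
      rw [h2]
      calc ((2:ℝ) ^ M)⁻¹ * (2 ^ M * ((2:ℝ) ^ M) ^ (q - 1) * ∑ y, |Tm (mm M L m (τ y)) f y| ^ q)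
          = ((2:ℝ) ^ M) ^ (q - 1) * ∑ y, |Tm (mm M L m (τ y)) f y| ^ q := by field_simp
        _ ≤ ((2:ℝ) ^ M) ^ (q - 1) * (K ^ q * ∑ y, |f y| ^ q) := by gcongr
        _ = _ := by ring
    refine (ENNReal.ofReal_le_ofReal e3).trans ?_
    rw [ENNReal.ofReal_mul (by positivity)]
    gcongr
    rw [ENNReal.ofReal_mul (by positivity), ENNReal.ofReal_sum_of_nonneg fun y _ => by positivity,
      Finset.mul_sum]
    have e4 : ∀ y, ENNReal.ofReal (((2:ℝ) ^ M) ^ (q - 1)) * ENNReal.ofReal (|f y| ^ q) ≤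
        ∫⁻ x in cell (L+M) M (rv y), ENNReal.ofReal (|g x| ^ q) := by
      intro y
      calc _ ≤ ENNReal.ofReal (((2:ℝ) ^ M) ^ (q - 1)) * (ENNReal.ofReal (((2:ℝ) ^ M)⁻¹ ^ (q - 1)) *
            ∫⁻ x in cell (L+M) M (rv y), ENNReal.ofReal (|g x| ^ q)) := by
              gcongr; exact jensen_cell hq _ _ _ hg
        _ = _ := by
            rw [← mul_assoc, ← ENNReal.ofReal_mul (by positivity),
              ← Real.mul_rpow (by positivity) (by positivity), mul_inv_cancel₀ (by positivity)]
            simp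
    refine (Finset.sum_le_sum fun y _ => e4 y).trans ?_
    have e5 : ∑ y, ∫⁻ x in cell (L+M) M (rv y), ENNReal.ofReal (|g x| ^ q) = _ :=
      (rvE (L+M)).sum_comp (fun η => ∫⁻ x in cell (L+M) M η, ENNReal.ofReal (|g x| ^ q))
    rw [e5, ← tsum_fintype (L := .unconditional _), ← lintegral_iUnion (cell_meas _ _) (cell_disj _ _), cell_union]
    exact lintegral_mono_set fun x hx => hx.1
  · intro x h0 h1 k
    obtain ⟨t, ht, hmt⟩ := rsys_mm H hL k
    rw [ft_mult hg h0 h1 (m k) (H.supp k) _ hmt]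
    have hx : x ∈ cell (L+M) M (dd (L+M) M x) := ⟨h0, by rw [exp_eq']; exact h1, rfl⟩
    refine le_trans ?_ (Finset.single_le_sum (f := fun η => (cell (L+M) M η).indicator (fun _ => ENNReal.ofReal (v (rv η))) x)
      (fun _ _ => zero_le) (Finset.mem_univ (dd (L+M) M x)))
    rw [Set.indicator_of_mem hx]
    apply ENNReal.ofReal_le_ofReal
    simp only [hv]
    rw [abs_mul, Real.mul_rpow (abs_nonneg _) (abs_nonneg _), abs_of_pos (by positivity : (0:ℝ) < 2 ^ M)]
    exact mul_le_mul_of_nonneg_left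
      (Real.rpow_le_rpow (abs_nonneg _) (hτ2 _ t ht) hq0.le) (by positivity)

lemma trunc_norm_le (L : ℕ) (g : ℝ → ℝ) (x : ℝ) : ‖trunc L g x‖ ≤ ‖g x‖ := by
  unfold trunc; exact norm_indicator_le_norm_self _ _

lemma trunc_tendsto (g : ℝ → ℝ) {x : ℝ} (hx : 0 ≤ x) (L0 : ℕ) :
    Tendsto (fun j : ℕ => trunc (L0 + j) g x) atTop (nhds (g x)) := by
  obtain ⟨n, hn⟩ := pow_unbounded_of_one_lt x (show (1:ℝ) < 2 by norm_num)
  refine tendsto_const_nhds.congr' ?_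
  filter_upwards [eventually_ge_atTop n] with j hj
  unfold trunc
  rw [Set.indicator_of_mem]
  refine ⟨hx, hn.trans_le ?_⟩
  rw [zpow_natCast]
  exact pow_le_pow_right₀ (by norm_num) (by omega)

lemma trunc_ft_tendsto {g : ℝ → ℝ} (hg : IntegrableOn g (Set.Ici 0)) {ξ : ℝ} (hξ : 0 ≤ ξ) (L0 : ℕ) :
    Tendsto (fun j : ℕ => walshFT (trunc (L0 + j) g) ξ) atTop (nhds (walshFT g ξ)) := by
  unfold walshFT
  refine tendsto_integral_of_dominated_convergence (fun x => ‖g x‖) ?_ hg.norm ?_ ?_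
  · intro j
    refine (walshe_aesm hξ).mul ?_
    exact hg.aestronglyMeasurable.indicator measurableSet_Ico
  · intro j
    refine ae_of_all _ fun x => ?_
    rw [norm_mul, walshe_norm, one_mul]; exact trunc_norm_le _ _ _
  · filter_upwards [ae_restrict_mem measurableSet_Ici] with x hx
    exact (trunc_tendsto g hx L0).const_mul _

lemma step_aesm {M L : ℕ} {h : ℝ → ℝ} (nu : (Fin (L+M) → Bool) → ℝ) (hz : ∀ ξ, 2 ^ (M:ℤ) ≤ ξ → h ξ = 0)
    (hh : ∀ ξ, 0 ≤ ξ → ξ < 2 ^ (M:ℤ) → h ξ = nu (dd (L+M) L ξ)) :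
    AEStronglyMeasurable h (volume.restrict (Set.Ici (0:ℝ))) := by
  have hm : Measurable fun ξ => ∑ η, (cell (L+M) L η).indicator (fun _ => nu η) ξ :=
    Finset.measurable_sum _ fun η _ => measurable_const.indicator (cell_meas _ _ _)
  refine hm.aestronglyMeasurable.congr ?_
  filter_upwards [ae_restrict_mem measurableSet_Ici] with ξ h0
  by_cases h1 : ξ < 2 ^ (M:ℤ)
  · rw [hh ξ h0 h1, Finset.sum_eq_single (dd (L+M) L ξ)]
    · rw [Set.indicator_of_mem]
      exact ⟨h0, by rw [exp_eq]; exact h1, rfl⟩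
    · intro η _ hne
      rw [Set.indicator_of_notMem]
      exact fun hc => hne hc.2.2.symm
    · simp
  · rw [hz ξ (not_lt.1 h1)]
    refine Finset.sum_eq_zero fun η _ => ?_
    rw [Set.indicator_of_notMem]
    intro hc
    have := hc.2.1
    rw [exp_eq] at this
    exact h1 this

lemma mult_tendsto {M L0 l : ℕ} {r : ℝ} {X : Finset ℝ} {m : ℤ → ℝ → ℝ}
    (H : RSys M L0 l r X m) {g : ℝ → ℝ} (hg : IntegrableOn g (Set.Ici 0)) (k : ℤ) {x : ℝ} (hx : 0 ≤ x) :
    Tendsto (fun j : ℕ => walshFT (fun ξ => m k ξ * walshFT (trunc (L0 + j) g) ξ) x) atTop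
      (nhds (walshFT (fun ξ => m k ξ * walshFT g ξ) x)) := by
  set A : ℝ := ∫ x in Set.Ici (0:ℝ), ‖g x‖ with hA
  have hA0 : 0 ≤ A := integral_nonneg fun x => norm_nonneg _
  have hb : ∀ j ξ, ‖walshFT (trunc (L0 + j) g) ξ‖ ≤ A := by
    intro j ξ
    refine (walshFT_bound ξ).trans ?_
    refine integral_mono_of_nonneg (ae_of_all _ fun _ => norm_nonneg _) hg.norm
      (ae_of_all _ fun x => trunc_norm_le _ _ _)
  rw [show walshFT (fun ξ => m k ξ * walshFT g ξ) x =
    ∫ ξ in Set.Ici (0:ℝ), walshe (wMul x ξ) * (m k ξ * walshFT g ξ) from rfl]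
  refine tendsto_integral_of_dominated_convergence
    (Set.indicator (Set.Ico 0 ((2:ℝ) ^ (M:ℤ))) fun _ => A) ?_ ?_ ?_ ?_
  · intro j
    refine (walshe_aesm hx).mul ?_
    obtain ⟨t, ht, hmt⟩ := rsys_mm H (Nat.le_add_right L0 j) k
    refine step_aesm (L := L0 + j) (M := M)
      (fun η => mm M (L0+j) m t η * hat (fv (L0+j) M g) η) ?_ ?_
    · intro ξ hξ; rw [H.supp k ξ hξ, zero_mul]
    · intro ξ h0 h1
      rw [hmt ξ h0 h1, ft_trunc hg h0 h1]
  · refine Integrable.mono_measure ?_ Measure.restrict_le_self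
    rw [integrable_indicator_iff measurableSet_Ico]
    exact integrableOn_const (by rw [Real.volume_Ico]; exact ENNReal.ofReal_ne_top)
  · intro j
    filter_upwards [ae_restrict_mem measurableSet_Ici] with ξ h0
    rw [norm_mul, walshe_norm, one_mul, norm_mul]
    by_cases h1 : ξ < 2 ^ (M:ℤ)
    · rw [Set.indicator_of_mem (show ξ ∈ Set.Ico 0 ((2:ℝ) ^ (M:ℤ)) from ⟨h0, h1⟩)]
      calc _ ≤ 1 * A := mul_le_mul (H.bd k ξ h0) (hb j ξ) (norm_nonneg _) (by norm_num)
        _ = A := one_mul _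
    · rw [H.supp k ξ (not_lt.1 h1)]
      simp only [norm_zero, zero_mul]
      exact Set.indicator_nonneg (fun _ _ => hA0) _
  · filter_upwards [ae_restrict_mem measurableSet_Ici] with ξ h0
    exact ((trunc_ft_tendsto hg h0 L0).const_mul _).const_mul _

/-- The bridge from the finite model to the half line. -/
theorem rsys_bound {q K : ℝ} (hq : 1 < q) {M L0 l : ℕ} {r : ℝ} {X : Finset ℝ} {m : ℤ → ℝ → ℝ}
    (H : RSys M L0 l r X m)
    (hK : ∀ (n : ℕ) (Ξ : Finset (Fin n → Bool)) (m : ℕ → (Fin n → Bool) → ℝ), Sys n l r Ξ m →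
      ∀ (f : (Fin n → Bool) → ℝ) (τ : (Fin n → Bool) → ℕ), (∀ x, τ x ≤ n) →
      ∑ x, |Tm (m (τ x)) f x| ^ q ≤ K ^ q * ∑ x, |f x| ^ q)
    (hK0 : 0 < K) : Mqstar q m ≤ ENNReal.ofReal K := by
  have hq0 : 0 < q := by linarith
  unfold Mqstar
  refine iSup₂_le fun g hg1 => ?_
  have hnorm : ∫⁻ x in Set.Ici (0:ℝ), ENNReal.ofReal (|g x| ^ q) = 1 := by
    rw [eLpNorm_eq_lintegral_rpow_enorm_toReal (by simpa using hq0) ENNReal.ofReal_ne_top,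
      ENNReal.toReal_ofReal hq0.le] at hg1
    have h2 := congrArg (fun z : ℝ≥0∞ => z ^ q) hg1
    simp only [← ENNReal.rpow_mul, one_div_mul_cancel hq0.ne', ENNReal.rpow_one, ENNReal.one_rpow] at h2
    rw [← h2]
    unfold μplus
    refine lintegral_congr fun x => ?_
    rw [Real.enorm_eq_ofReal_abs, ENNReal.ofReal_rpow_of_nonneg (abs_nonneg _) hq0.le]
  unfold lpNormE
  suffices h : ∫⁻ x, (⨆ k : ℤ, (‖walshFT (fun ξ => m k ξ * walshFT g ξ) x‖₊ : ℝ≥0∞)) ^ q ∂μplus ≤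
      ENNReal.ofReal (K ^ q) by
    calc _ ≤ (ENNReal.ofReal (K ^ q)) ^ (1 / q) := ENNReal.rpow_le_rpow h (by positivity)
      _ = _ := by
        rw [← ENNReal.ofReal_rpow_of_nonneg hK0.le hq0.le, ← ENNReal.rpow_mul,
          mul_one_div_cancel hq0.ne', ENNReal.rpow_one]
  unfold μplus
  by_cases hg : IntegrableOn g (Set.Ici 0)
  · have hG : ∀ j : ℕ, _ := fun j : ℕ => trunc_max hq H (Nat.le_add_right L0 j)
      (fun f τ hτ => hK _ _ _ (rsys_sys H (L0 + j)) f τ hτ) hK0 hg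
    choose G hGm hGi hGp using hG
    have hpt : ∀ᵐ x ∂(volume.restrict (Set.Ici (0:ℝ))),
        (⨆ k : ℤ, (‖walshFT (fun ξ => m k ξ * walshFT g ξ) x‖₊ : ℝ≥0∞)) ^ q ≤
          liminf (fun j => G j x) atTop := by
      filter_upwards [ae_restrict_mem measurableSet_Ici] with x hx
      rw [← ENNReal.le_rpow_inv_iff hq0]
      refine iSup_le fun k => ?_
      rw [ENNReal.le_rpow_inv_iff hq0]
      have e : (‖walshFT (fun ξ => m k ξ * walshFT g ξ) x‖₊ : ℝ≥0∞) ^ q =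
          ENNReal.ofReal (|walshFT (fun ξ => m k ξ * walshFT g ξ) x| ^ q) := by
        rw [← ENNReal.ofReal_rpow_of_nonneg (abs_nonneg _) hq0.le, ← Real.enorm_eq_ofReal_abs]; rfl
      rw [e]
      have ht := (ENNReal.continuous_ofReal.tendsto _).comp
        (((mult_tendsto H hg k hx).abs).rpow_const (p := q) (Or.inr hq0.le))
      rw [← ht.liminf_eq]
      refine liminf_le_liminf ?_
      obtain ⟨n, hn⟩ := pow_unbounded_of_one_lt x (show (1:ℝ) < 2 by norm_num)
      filter_upwards [eventually_ge_atTop n] with j hj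
      refine hGp j x hx (hn.trans_le ?_) k
      rw [zpow_natCast]
      exact pow_le_pow_right₀ (by norm_num) (by omega)
    refine (lintegral_mono_ae hpt).trans ((lintegral_liminf_le hGm).trans ?_)
    refine liminf_le_of_le (by isBoundedDefault) fun b hb => ?_
    obtain ⟨j, hj⟩ := hb.exists
    refine hj.trans ((hGi j).trans ?_)
    rw [hnorm, mul_one]
  · have : ∫⁻ x in Set.Ici (0:ℝ), (⨆ k : ℤ, (‖walshFT (fun ξ => m k ξ * walshFT g ξ) x‖₊ : ℝ≥0∞)) ^ q = 0 := by
      have hz : ∀ k x, walshFT (fun ξ => m k ξ * walshFT g ξ) x = 0 := by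
        intro k x
        rw [show walshFT (fun ξ => m k ξ * walshFT g ξ) x =
          ∫ ξ in Set.Ici (0:ℝ), walshe (wMul x ξ) * (m k ξ * walshFT g ξ) from rfl]
        refine setIntegral_eq_zero_of_forall_eq_zero fun ξ hξ => ?_
        rw [walshFT_nonint hg hξ, mul_zero, mul_zero]
      simp [hz, hq0]
    rw [this]; exact zero_le

end SMM

namespace SMM

lemma mem_Ico_floor (b e : ℤ) (y : ℝ) :
    y ∈ Set.Ico ((b:ℝ) * 2 ^ e) (((b:ℝ) + 1) * 2 ^ e) ↔ ⌊y / 2 ^ e⌋ = b := by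
  have hp : (0:ℝ) < 2 ^ e := by positivity
  rw [Int.floor_eq_iff, Set.mem_Ico, le_div_iff₀ hp, div_lt_iff₀ hp]

lemma Ico_vol (b e : ℤ) : volume (Set.Ico ((b:ℝ) * 2 ^ e) (((b:ℝ) + 1) * 2 ^ e)) =
    ENNReal.ofReal (2 ^ e) := by
  rw [Real.volume_Ico]; congr 1; ring

lemma bitile_data (P : Bitile) : ∃ j a b : ℤ,
    P.I = Set.Ico ((a:ℝ) * 2 ^ j) (((a:ℝ) + 1) * 2 ^ j) ∧
    P.ω = Set.Ico ((b:ℝ) * 2 ^ (1 - j)) (((b:ℝ) + 1) * 2 ^ (1 - j)) := by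
  obtain ⟨a, j, hI⟩ := P.hI
  obtain ⟨b, e, hω⟩ := P.hω
  have h := P.harea
  rw [hI, hω, Ico_vol, Ico_vol, ← ENNReal.ofReal_mul (by positivity), ← zpow_add₀ (by norm_num)] at h
  have h2 : (2:ℝ) ^ (j + e) = 2 ^ (1:ℤ) := by
    have := congrArg ENNReal.toReal h
    rw [ENNReal.toReal_ofReal (by positivity)] at this
    rw [this]; simp
  have h3 : j + e = 1 := zpow_right_injective₀ (by norm_num) (by norm_num) h2
  have : e = 1 - j := by omega
  subst this
  exact ⟨j, a, b, hI, hω⟩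

/-- Scale of a bitile. -/
def jj (P : Bitile) : ℤ := (bitile_data P).choose
/-- Time index of a bitile. -/
def aa (P : Bitile) : ℤ := (bitile_data P).choose_spec.choose
/-- Frequency index of a bitile. -/
def bb (P : Bitile) : ℤ := (bitile_data P).choose_spec.choose_spec.choose

lemma I_eq (P : Bitile) : P.I = Set.Ico ((aa P:ℝ) * 2 ^ jj P) (((aa P:ℝ) + 1) * 2 ^ jj P) :=
  (bitile_data P).choose_spec.choose_spec.choose_spec.1

lemma ω_eq (P : Bitile) :
    P.ω = Set.Ico ((bb P:ℝ) * 2 ^ (1 - jj P)) (((bb P:ℝ) + 1) * 2 ^ (1 - jj P)) :=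
  (bitile_data P).choose_spec.choose_spec.choose_spec.2

lemma memI {P : Bitile} {y : ℝ} : y ∈ P.I ↔ ⌊y / 2 ^ jj P⌋ = aa P := by
  rw [I_eq, mem_Ico_floor]

lemma memω {P : Bitile} {y : ℝ} : y ∈ P.ω ↔ ⌊y / 2 ^ (1 - jj P)⌋ = bb P := by
  rw [ω_eq, mem_Ico_floor]

lemma mid_eq (P : Bitile) : (sInf P.ω + sSup P.ω) / 2 = (2 * (bb P:ℝ) + 1) * 2 ^ (- jj P) := by
  have hp : (0:ℝ) < 2 ^ (1 - jj P) := by positivity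
  have hlt : (bb P:ℝ) * 2 ^ (1 - jj P) < ((bb P:ℝ) + 1) * 2 ^ (1 - jj P) := by nlinarith
  rw [ω_eq, csInf_Ico hlt, csSup_Ico hlt]
  have e : (2:ℝ) ^ (1 - jj P) = 2 * 2 ^ (-jj P) := by
    rw [show (1 - jj P) = 1 + (- jj P) by ring, zpow_add₀ (by norm_num), zpow_one]
  rw [e]; ring

lemma floor_one_sub (y : ℝ) (j : ℤ) : ⌊y / 2 ^ (1 - j)⌋ = ⌊y / 2 ^ (-j)⌋ / 2 := by
  rw [show (1 - j) = -j + 1 by ring, floor_succ]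

lemma memU {P : Bitile} {y : ℝ} : y ∈ upperHalf P.ω ↔ ⌊y / 2 ^ (- jj P)⌋ = 2 * bb P + 1 := by
  unfold upperHalf
  rw [mid_eq, Set.mem_inter_iff, memω, Set.mem_Ici, ← le_div_iff₀ (by positivity), floor_one_sub]
  have : (2 * (bb P:ℝ) + 1) ≤ y / 2 ^ (- jj P) ↔ 2 * bb P + 1 ≤ ⌊y / 2 ^ (- jj P)⌋ := by
    rw [Int.le_floor]; push_cast; rfl
  rw [this]
  omega

lemma memL {P : Bitile} {y : ℝ} : y ∈ lowerHalf P.ω ↔ ⌊y / 2 ^ (- jj P)⌋ = 2 * bb P := by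
  unfold lowerHalf
  rw [mid_eq, Set.mem_inter_iff, memω, Set.mem_Iio, ← div_lt_iff₀ (by positivity), floor_one_sub]
  have : y / 2 ^ (- jj P) < (2 * (bb P:ℝ) + 1) ↔ ⌊y / 2 ^ (- jj P)⌋ < 2 * bb P + 1 := by
    rw [Int.floor_lt]; push_cast; rfl
  rw [this]
  omega

lemma U_sub {P : Bitile} {y : ℝ} (h : y ∈ upperHalf P.ω) : y ∈ P.ω := h.1

lemma vol_lt {P : Bitile} {k : ℤ} : volume P.I < 2 ^ k ↔ jj P < k := by
  rw [I_eq, Ico_vol]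
  have e : (2:ℝ≥0∞) ^ k = ENNReal.ofReal (2 ^ k) := by
    rw [← ENNReal.rpow_intCast, ← Real.rpow_intCast, ← ENNReal.ofReal_rpow_of_pos (by norm_num)]; simp
  rw [e, ENNReal.ofReal_lt_ofReal_iff (by positivity)]
  exact zpow_lt_zpow_iff_right₀ (by norm_num)

lemma bitile_ext {P Q : Bitile} (hj : jj P = jj Q) (ha : aa P = aa Q) (hb : bb P = bb Q) : P = Q := by
  have h1 : P.I = Q.I := by rw [I_eq, I_eq, hj, ha]
  have h2 : P.ω = Q.ω := by rw [ω_eq, ω_eq, hj, hb]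
  cases P; cases Q
  simp only at h1 h2
  subst h1; subst h2; rfl

lemma bitile_ext' {P Q : Bitile} {x y : ℝ} (hP : x ∈ P.I) (hQ : x ∈ Q.I) (hj : jj P = jj Q)
    (hP' : y ∈ P.ω) (hQ' : y ∈ Q.ω) : P = Q := by
  rw [memI] at hP hQ
  rw [memω] at hP' hQ'
  refine bitile_ext hj ?_ ?_
  · rw [← hP, ← hQ, hj]
  · rw [← hP', ← hQ', hj]

/-- The left endpoint of the dyadic interval of length `2^e` containing `y`. -/
def lft (e : ℤ) (y : ℝ) : ℝ := (⌊y / 2 ^ e⌋ : ℝ) * 2 ^ e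

lemma lft_floor (e : ℤ) (y : ℝ) : ⌊lft e y / 2 ^ e⌋ = ⌊y / 2 ^ e⌋ := by
  unfold lft
  rw [mul_div_cancel_right₀ _ (by positivity)]; simp

lemma lft_le (e : ℤ) (y : ℝ) : lft e y ≤ y := by
  unfold lft
  rw [← le_div_iff₀ (by positivity)]; exact Int.floor_le _

lemma lft_nonneg {e : ℤ} {y : ℝ} (h : 0 ≤ y) : 0 ≤ lft e y := by
  unfold lft
  have : 0 ≤ ⌊y / 2 ^ e⌋ := Int.floor_nonneg.2 (by positivity)
  have : (0:ℝ) ≤ (⌊y / 2 ^ e⌋ : ℝ) := by exact_mod_cast this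
  positivity

lemma lft_int {e e' : ℤ} (h : e' ≤ e) (y : ℝ) : lft e y / 2 ^ e' = ((⌊y / 2 ^ e⌋ * 2 ^ (e - e').toNat : ℤ) : ℝ) := by
  unfold lft
  push_cast
  rw [← zpow_natCast, Int.toNat_of_nonneg (by omega), mul_div_assoc, ← zpow_sub₀ (by norm_num)]

lemma lft_even {e e' : ℤ} (h : e' < e) (y : ℝ) : ∃ z, ⌊lft e y / 2 ^ e'⌋ = 2 * z := by
  rw [lft_int h.le, Int.floor_intCast]
  obtain ⟨n, hn⟩ : ∃ n, (e - e').toNat = n + 1 := ⟨(e - e').toNat - 1, by omega⟩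
  rw [hn]
  exact ⟨⌊y / 2 ^ e⌋ * 2 ^ n, by ring⟩

lemma lft_mono {e e' : ℤ} (h : e' ≤ e) (y : ℝ) : lft e y ≤ lft e' y := by
  have h1 := lft_int h y
  rw [div_eq_iff (by positivity)] at h1
  rw [h1]
  unfold lft
  gcongr
  rw [Int.le_floor, ← lft_int h y]
  gcongr
  exact lft_le _ _

/-- Truncated multiplier as a finite sum. -/
def mS (S : Finset Bitile) (c : Bitile → ℝ) (k : ℤ) (ξ : ℝ) : ℝ :=
  ∑ P ∈ S with jj P < k ∧ ξ ∈ upperHalf P.ω, c P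

/-- Tree multiplier as a finite sum. -/
def FT (S : Finset Bitile) (c : Bitile → ℝ) (T : WTree) (ξ : ℝ) : ℝ :=
  ∑ P ∈ S with P ∈ T.carrier ∧ ξ ∈ upperHalf P.ω, c P

lemma finsum_ind (S : Finset Bitile) (c : Bitile → ℝ) (p : Bitile → Prop) (hp : ∀ P, p P → P ∈ S)
    (ξ : ℝ) : (∑ᶠ (P : Bitile) (_ : p P), c P * Set.indicator (upperHalf P.ω) (fun _ => (1 : ℝ)) ξ) =
      ∑ P ∈ S with p P ∧ ξ ∈ upperHalf P.ω, c P := by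
  rw [finsum_cond_eq_sum_of_cond_iff (t := S.filter fun P => p P ∧ ξ ∈ upperHalf P.ω)]
  · refine Finset.sum_congr rfl fun P hP => ?_
    rw [Finset.mem_filter] at hP
    rw [Set.indicator_of_mem hP.2.2, mul_one]
  · intro P hne
    rw [Finset.mem_filter]
    constructor
    · intro h
      refine ⟨hp P h, h, ?_⟩
      by_contra hc
      exact hne (by rw [Set.indicator_of_notMem hc, mul_zero])
    · exact fun h => h.2.1

/-- The pointwise structure: values of the truncated multiplier are values of one tree multiplier. -/
def PtStr (S : Finset Bitile) (Ts : Set WTree) : Prop :=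
  ∀ (ξ : ℝ), 0 ≤ ξ → (∀ (c : Bitile → ℝ) k, mS S c k ξ = 0) ∨ ∃ T ∈ Ts, ∃ z : ℤ → ℝ, Monotone z ∧ (∀ k, 0 ≤ z k) ∧
    ∀ (c : Bitile → ℝ) k, mS S c k ξ = FT S c T (z k)

lemma empty_case {S : Finset Bitile} {ξ : ℝ} (h : ∀ P ∈ S, ξ ∉ upperHalf P.ω) (c : Bitile → ℝ) (k : ℤ) :
    mS S c k ξ = 0 := by
  unfold mS
  rw [Finset.filter_false_of_mem, Finset.sum_empty]
  exact fun P hP hc => h P hP hc.2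

lemma ptstr_u {S : Finset Bitile} {Ts : Set WTree} {x : ℝ} (hx : ∀ P ∈ S, x ∈ P.I)
    (hcov : ∀ P ∈ S, ∃ T ∈ Ts, P ∈ T.carrier)
    (h : ∀ T ∈ Ts, IsTree T ∧ UOverlapping T ∧
        TdMaximalAmong T {T' | IsTree T' ∧ T'.carrier ⊆ (S : Set Bitile)}) : PtStr S Ts := by
  intro ξ hξ
  by_cases hne : ∃ P ∈ S, ξ ∈ upperHalf P.ω
  swap
  · left; push Not at hne; exact empty_case hne
  right
  obtain ⟨Q0, hQ0, hQ0'⟩ := hne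
  obtain ⟨Q, hQ, hmax⟩ := Finset.exists_max_image (S.filter fun P => ξ ∈ upperHalf P.ω) jj
    ⟨Q0, by simp [hQ0, hQ0']⟩
  rw [Finset.mem_filter] at hQ
  obtain ⟨hQS, hQξ⟩ := hQ
  obtain ⟨T, hT, hQT⟩ := hcov Q hQS
  obtain ⟨hTt, hTu, hTm⟩ := h T hT
  refine ⟨T, hT, fun k => lft (1 - min k (jj Q + 1)) T.ξtop, ?_, fun k => lft_nonneg hTt.2.1, ?_⟩
  · intro k k' hk
    refine lft_mono ?_ _
    omega
  intro c k
  have hTS : T.carrier ⊆ S := hTm.1.2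
  have hfl : ⌊ξ / 2 ^ (1 - jj Q)⌋ = ⌊T.ξtop / 2 ^ (1 - jj Q)⌋ := by
    rw [memω.1 (U_sub hQξ), memω.1 (hTt.2.2 Q hQT).2]
  unfold mS FT
  congr 1
  ext P
  simp only [Finset.mem_filter, and_congr_right_iff]
  intro hP
  constructor
  · rintro ⟨hk, hPξ⟩
    have hj : jj P ≤ jj Q := hmax P (by simp [hP, hPξ])
    have hPT : P ∈ T.carrier := by
      have hsub : P.I ⊆ Q.I := by
        intro y hy
        have hxP := hx P hP
        have hxQ := hx Q hQS
        rw [memI] at hy hxP hxQ ⊢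
        rw [← hxQ]
        exact floor_up hj (hy.trans hxP.symm)
      have hωm : T.ξtop ∈ P.ω := by
        have := U_sub hPξ
        rw [memω] at this ⊢
        rw [← this]
        exact (floor_up (by omega) hfl).symm
      refine hTm.2 ⟨{R | R ∈ S ∧ R.I ⊆ T.Itop ∧ T.ξtop ∈ R.ω}, T.ξtop, T.Itop⟩ ?_ rfl rfl ?_ ?_
      · exact ⟨⟨hTt.1, hTt.2.1, fun R hR => hR.2⟩, fun R hR => hR.1⟩
      · exact fun R hR => ⟨hTS hR, hTt.2.2 R hR⟩
      · exact ⟨hP, hsub.trans (hTt.2.2 Q hQT).1, hωm⟩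
    refine ⟨hPT, ?_⟩
    have := hTu P hPT
    rw [memU] at this ⊢
    rw [← this]
    exact floor_up (k := 1 - min k (jj Q + 1)) (by omega) (lft_floor _ _)
  · rintro ⟨hPT, hz⟩
    have hlt : jj P < min k (jj Q + 1) := by
      by_contra hc
      rw [memU] at hz
      obtain ⟨w, hw⟩ := lft_even (e := 1 - min k (jj Q + 1)) (e' := - jj P) (by omega) T.ξtop
      omega
    refine ⟨by omega, ?_⟩
    rcases (show jj P ≤ jj Q by omega).eq_or_lt with he | hl
    · rw [bitile_ext' (hx P hP) (hx Q hQS) he (hTt.2.2 P hPT).2 (hTt.2.2 Q hQT).2]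
      exact hQξ
    · have := hTu P hPT
      rw [memU] at this ⊢
      rw [← this]
      exact floor_up (by omega) hfl

lemma ptstr_l {S : Finset Bitile} {Ts : Set WTree} {x : ℝ} (hx : ∀ P ∈ S, x ∈ P.I)
    (hcov : ∀ P ∈ S, ∃ T ∈ Ts, P ∈ T.carrier)
    (h : ProperlySorted Ts) : PtStr S Ts := by
  intro ξ hξ
  by_cases hne : ∃ P ∈ S, ξ ∈ upperHalf P.ω
  swap
  · left; push Not at hne; exact empty_case hne
  right
  have huniq0 : ∀ P ∈ S, ∀ Q ∈ S, ξ ∈ upperHalf P.ω → ξ ∈ upperHalf Q.ω → jj Q ≤ jj P → Q = P := by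
    intro P hP Q hQ hPξ hQξ hj
    rcases hj.eq_or_lt with he | hl
    · exact bitile_ext' (hx Q hQ) (hx P hP) he (U_sub hQξ) (U_sub hPξ)
    · exfalso
      obtain ⟨T, hT, hPT⟩ := hcov P hP
      obtain ⟨T', hT', hQT'⟩ := hcov Q hQ
      have hTt := (h.1 T hT).1
      refine h.2.2 T' hT' Q hQT' T hT ⟨x, (hTt.2.2 P hPT).1 (hx P hP), hx Q hQ⟩ ?_
      rw [memU] at hQξ ⊢
      rw [← hQξ]
      refine floor_up (k := 1 - jj P) (by omega) ?_
      rw [memω.1 (U_sub hPξ), memω.1 (hTt.2.2 P hPT).2]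
  have huniq : ∀ P ∈ S, ∀ Q ∈ S, ξ ∈ upperHalf P.ω → ξ ∈ upperHalf Q.ω → Q = P := by
    intro P hP Q hQ hPξ hQξ
    rcases le_total (jj Q) (jj P) with hj | hj
    · exact huniq0 P hP Q hQ hPξ hQξ hj
    · exact (huniq0 Q hQ P hP hQξ hPξ hj).symm
  obtain ⟨P, hP, hPξ⟩ := hne
  obtain ⟨T, hT, hPT⟩ := hcov P hP
  obtain ⟨hTt, hTl, -⟩ := h.1 T hT
  refine ⟨T, hT, fun k => if jj P < k then ξ else lft (1 - jj P) ξ, ?_, ?_, ?_⟩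
  · intro k k' hk
    simp only
    split_ifs
    · exact le_rfl
    · omega
    · exact lft_le _ _
    · exact le_rfl
  · intro k
    simp only
    split_ifs
    · exact hξ
    · exact lft_nonneg hξ
  intro c k
  unfold mS FT
  congr 1
  ext Q
  simp only [Finset.mem_filter, and_congr_right_iff]
  intro hQ
  split_ifs with hk
  · constructor
    · rintro ⟨_, hQξ⟩
      rw [huniq P hP Q hQ hPξ hQξ]
      exact ⟨hPT, hPξ⟩
    · rintro ⟨_, hQξ⟩
      have := huniq P hP Q hQ hPξ hQξ
      exact ⟨by rw [this]; exact hk, hQξ⟩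
  · constructor
    · rintro ⟨hk', hQξ⟩
      rw [huniq P hP Q hQ hPξ hQξ] at hk'
      exact absurd hk' hk
    · rintro ⟨hQT, hz⟩
      exfalso
      rw [memU] at hz
      by_cases hj : jj Q < jj P
      · have h1 := hTl Q hQT
        rw [memL] at h1
        have h2 : ⌊lft (1 - jj P) ξ / 2 ^ (- jj Q)⌋ = ⌊T.ξtop / 2 ^ (- jj Q)⌋ := by
          refine floor_up (k := 1 - jj P) (by omega) ?_
          rw [lft_floor, memω.1 (U_sub hPξ), memω.1 (hTt.2.2 P hPT).2]
        omega
      · obtain ⟨w, hw⟩ := lft_even (e := 1 - jj P) (e' := - jj Q) (by omega) ξ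
        omega

end SMM

namespace SMM

lemma var_extract {r : ℝ} (hr : 0 < r) (F : ℝ → ℝ) (v : ℕ → ℝ) (hv : Antitone v) (h0 : ∀ j, 0 ≤ v j) (M : ℕ) :
    ∃ (N : ℕ) (u : Fin (N + 1) → ℝ), StrictMono u ∧ (∀ i, u i ∈ Set.Ici (0:ℝ)) ∧ u 0 = v M ∧
      ∑ j ∈ Finset.range M, |F (v (j+1)) - F (v j)| ^ r =
        ∑ i : Fin N, |F (u i.succ) - F (u i.castSucc)| ^ r := by
  induction M with
  | zero =>
    refine ⟨0, fun _ => v 0, ?_, fun _ => h0 0, rfl, by simp⟩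
    intro i j hij
    have h1 := i.2
    have h2 := j.2
    have h3 := Fin.lt_def.1 hij
    omega
  | succ M ih =>
    obtain ⟨N, u, hu, hu0, hu1, hs⟩ := ih
    rcases (hv (Nat.le_succ M)).eq_or_lt with he | hl
    · refine ⟨N, u, hu, hu0, hu1.trans he.symm, ?_⟩
      have he' : v (M+1) = v M := he
      rw [Finset.sum_range_succ, hs, he', sub_self, abs_zero, Real.zero_rpow hr.ne', add_zero]
    · refine ⟨N+1, Fin.cons (v (M+1)) u, ?_, ?_, rfl, ?_⟩
      · rw [Fin.strictMono_iff_lt_succ]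
        intro i
        refine Fin.cases ?_ (fun i => ?_) i
        · rw [Fin.cons_succ, Fin.castSucc_zero, Fin.cons_zero, hu1]; exact hl
        · rw [Fin.cons_succ, Fin.castSucc_succ, Fin.cons_succ]
          exact hu (Fin.castSucc_lt_succ)
      · intro i
        refine Fin.cases ?_ (fun i => ?_) i
        · exact h0 _
        · rw [Fin.cons_succ]; exact hu0 i
      · rw [Finset.sum_range_succ, hs, Fin.sum_univ_succ]
        simp only [Fin.cons_succ, Fin.castSucc_zero, Fin.cons_zero, Fin.castSucc_succ]
        rw [hu1, add_comm, abs_sub_comm]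

lemma vnorm_bd {r A : ℝ} (hA : 0 < A) {F : ℝ → ℝ}
    (h : vnorm r (Set.Ici 0) F ≤ ENNReal.ofReal A) {ξ : ℝ} (hξ : 0 ≤ ξ) : |F ξ| ≤ A := by
  have h1 : (‖F ξ‖₊ : ℝ≥0∞) ≤ ENNReal.ofReal A := by
    refine le_trans ?_ ((le_self_add).trans h)
    exact le_iSup₂ (f := fun ξ (_ : ξ ∈ Set.Ici (0:ℝ)) => (‖F ξ‖₊ : ℝ≥0∞)) ξ hξ
  have h2 : ENNReal.ofReal |F ξ| ≤ ENNReal.ofReal A := by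
    rw [← Real.enorm_eq_ofReal_abs]; exact h1
  exact (ENNReal.ofReal_le_ofReal_iff hA.le).1 h2

lemma vnorm_var {r A : ℝ} (hr : 0 < r) (hA : 0 < A) {F : ℝ → ℝ}
    (h : vnorm r (Set.Ici 0) F ≤ ENNReal.ofReal A) (v : ℕ → ℝ) (hv : Antitone v) (h0 : ∀ j, 0 ≤ v j)
    (M : ℕ) : ∑ j ∈ Finset.range M, |F (v (j+1)) - F (v j)| ^ r ≤ A ^ r := by
  obtain ⟨N, u, hu, hu0, -, hs⟩ := var_extract hr F v hv h0 M
  rw [hs]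
  have h1 : (∑ i : Fin N, (‖F (u i.succ) - F (u i.castSucc)‖₊ : ℝ≥0∞) ^ r) ^ (1 / r) ≤ ENNReal.ofReal A := by
    refine le_trans ?_ ((le_add_self).trans h)
    refine le_iSup_of_le N (le_iSup_of_le u (le_iSup_of_le hu (le_iSup_of_le hu0 le_rfl)))
  rw [one_div, ENNReal.rpow_inv_le_iff hr] at h1
  have h2 : ∀ i : Fin N, (‖F (u i.succ) - F (u i.castSucc)‖₊ : ℝ≥0∞) ^ r =
      ENNReal.ofReal (|F (u i.succ) - F (u i.castSucc)| ^ r) := by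
    intro i
    rw [← ENNReal.ofReal_rpow_of_nonneg (abs_nonneg _) hr.le, ← Real.enorm_eq_ofReal_abs]; rfl
  simp only [h2] at h1
  rw [← ENNReal.ofReal_sum_of_nonneg fun i _ => by positivity,
    ENNReal.ofReal_rpow_of_pos hA] at h1
  exact (ENNReal.ofReal_le_ofReal_iff (by positivity)).1 h1

lemma Mqstar_smul {q A : ℝ} (hq : 0 < q) (hA : 0 < A) (m : ℤ → ℝ → ℝ) :
    Mqstar q (fun k ξ => A * m k ξ) ≤ ENNReal.ofReal A * Mqstar q m := by
  unfold Mqstar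
  refine iSup₂_le fun g hg => ?_
  have e : ∀ k x, (‖walshFT (fun ξ => A * m k ξ * walshFT g ξ) x‖₊ : ℝ≥0∞) =
      ENNReal.ofReal A * (‖walshFT (fun ξ => m k ξ * walshFT g ξ) x‖₊ : ℝ≥0∞) := by
    intro k x
    have : walshFT (fun ξ => A * m k ξ * walshFT g ξ) x = A * walshFT (fun ξ => m k ξ * walshFT g ξ) x := by
      rw [show walshFT (fun ξ => A * m k ξ * walshFT g ξ) x =
        ∫ ξ in Set.Ici (0:ℝ), walshe (wMul x ξ) * (A * m k ξ * walshFT g ξ) from rfl,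
        show walshFT (fun ξ => m k ξ * walshFT g ξ) x =
        ∫ ξ in Set.Ici (0:ℝ), walshe (wMul x ξ) * (m k ξ * walshFT g ξ) from rfl,
        ← integral_const_mul]
      congr 1; funext ξ; ring
    rw [this, nnnorm_mul, ENNReal.coe_mul]
    congr 1
    exact Real.enorm_of_nonneg hA.le
  have e2 : lpNormE q μplus (fun x => ⨆ k : ℤ, (‖walshFT (fun ξ => A * m k ξ * walshFT g ξ) x‖₊ : ℝ≥0∞)) =
      ENNReal.ofReal A * lpNormE q μplus (fun x => ⨆ k : ℤ, (‖walshFT (fun ξ => m k ξ * walshFT g ξ) x‖₊ : ℝ≥0∞)) := by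
    unfold lpNormE
    simp only [e, ← ENNReal.mul_iSup, ENNReal.mul_rpow_of_nonneg _ _ hq.le]
    rw [lintegral_const_mul' _ _ (by simp [ENNReal.rpow_eq_top_iff, hq.le, not_lt.2 hq.le]),
      ENNReal.mul_rpow_of_nonneg _ _ (by positivity), ← ENNReal.rpow_mul, mul_one_div_cancel hq.ne',
      ENNReal.rpow_one]
  rw [e2]
  gcongr
  exact le_iSup₂ (f := fun g (_ : eLpNorm g (ENNReal.ofReal q) μplus = 1) => lpNormE q μplus
    (fun x => ⨆ k : ℤ, (‖walshFT (fun ξ => m k ξ * walshFT g ξ) x‖₊ : ℝ≥0∞))) g hg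

lemma build_rsys {r A : ℝ} (hr : 0 < r) (hA : 0 < A) {S : Finset Bitile} {Ts : Set WTree} (hfin : Ts.Finite)
    (hcov : ∀ P ∈ S, ∃ T ∈ Ts, P ∈ T.carrier) (htree : ∀ T ∈ Ts, IsTree T)
    (hpt : PtStr S Ts) (hTop : ∀ T ∈ Ts, 0 ≤ T.ξtop) (c : Bitile → ℝ)
    (hc : ∀ T ∈ Ts, vnorm r (Set.Ici 0) (FT S c T) ≤ ENNReal.ofReal A) (l : ℕ) (hl : Ts.ncard ≤ 2 ^ l) :
    ∃ M L0 X, RSys M L0 l r X (fun k ξ => A⁻¹ * mS S c k ξ) := by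
  have hA' : A ^ r ≠ 0 := by positivity
  -- choice of the parameters
  have hM1 : ∀ P : Bitile, ∃ a : ℕ, ((bb P:ℝ) + 1) * 2 ^ (1 - jj P) ≤ 2 ^ (a:ℤ) ∧ 1 - jj P ≤ a := by
    intro P
    obtain ⟨a, ha, ha'⟩ := exists_bd (((bb P:ℝ) + 1) * 2 ^ (1 - jj P)) (max (1 - jj P) 0)
    refine ⟨a.toNat, ?_, by omega⟩
    rw [Int.toNat_of_nonneg (by omega)]; exact ha.le
  choose w hw1 hw2 using hM1
  have hM2 : ∀ T : WTree, ∃ a : ℕ, T.ξtop < 2 ^ (a:ℤ) := by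
    intro T
    obtain ⟨a, ha, ha'⟩ := exists_bd T.ξtop 0
    exact ⟨a.toNat, by rw [Int.toNat_of_nonneg ha']; exact ha⟩
  choose w' hw' using hM2
  set M : ℕ := max (S.sup w) (hfin.toFinset.sup w') with hM
  set L0 : ℕ := S.sup fun P => (jj P).toNat with hL0
  have hMw : ∀ P ∈ S, w P ≤ M := fun P hP => (Finset.le_sup hP).trans (le_max_left _ _)
  have hMw' : ∀ T ∈ Ts, w' T ≤ M := fun T hT =>
    (Finset.le_sup (f := w') (hfin.mem_toFinset.2 hT)).trans (le_max_right _ _)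
  have hLw : ∀ P ∈ S, jj P ≤ L0 := by
    intro P hP
    have : (jj P).toNat ≤ L0 := Finset.le_sup (f := fun P => (jj P).toNat) hP
    omega
  refine ⟨M, L0, hfin.toFinset.image WTree.ξtop, ?_⟩
  constructor
  · refine Finset.card_image_le.trans ?_
    rw [← Set.ncard_eq_toFinset_card _ hfin]; exact hl
  · intro a ha
    obtain ⟨T, hT, rfl⟩ := Finset.mem_image.1 ha
    rw [hfin.mem_toFinset] at hT
    refine ⟨hTop T hT, (hw' T).trans_le (zpow_le_zpow_right₀ (by norm_num) ?_)⟩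
    exact_mod_cast hMw' T hT
  · intro k ξ hξ
    rw [empty_case, mul_zero]
    intro P hP hU
    have h1 := U_sub hU
    rw [ω_eq] at h1
    have h2 : (2:ℝ) ^ ((w P : ℕ):ℤ) ≤ 2 ^ (M:ℤ) := zpow_le_zpow_right₀ (by norm_num) (by exact_mod_cast hMw P hP)
    exact absurd h1.2 (not_lt.2 ((hw1 P).trans (h2.trans hξ)))
  · intro k ξ η _ _ hf
    unfold mS
    congr 2
    ext P
    simp only [Finset.mem_filter, and_congr_right_iff]
    intro hP hk
    rw [memU, memU, floor_up (by omega) hf]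
  · intro k hk
    funext ξ
    unfold mS
    congr 2
    ext P
    simp only [Finset.mem_filter, and_congr_right_iff]
    intro hP
    have := hLw P hP
    constructor
    · exact fun h => ⟨by omega, h.2⟩
    · exact fun h => ⟨by omega, h.2⟩
  · intro k hk
    funext ξ
    unfold mS
    congr 2
    ext P
    simp only [Finset.mem_filter, and_congr_right_iff]
    intro hP
    have h1 := hMw P hP
    have h2 := hw2 P
    constructor
    · exact fun h => by omega
    · exact fun h => by omega
  · intro k k' hk ξ hξ hX
    unfold mS
    congr 2
    ext P
    simp only [Finset.mem_filter, and_congr_right_iff]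
    intro hP
    constructor
    · rintro ⟨h1, h2⟩
      refine ⟨?_, h2⟩
      by_contra hlt
      obtain ⟨T, hT, hPT⟩ := hcov P hP
      refine hX T.ξtop (Finset.mem_image_of_mem _ (hfin.mem_toFinset.2 hT)) ?_
      refine floor_up (k := 1 - jj P) (by omega) ?_
      rw [memω.1 (U_sub h2), memω.1 ((htree T hT).2.2 P hPT).2]
    · rintro ⟨h1, h2⟩
      exact ⟨by omega, h2⟩
  · intro k ξ hξ
    rcases hpt ξ hξ with h | ⟨T, hT, z, hz, hz0, h⟩
    · simp only [h, mul_zero, abs_zero]; norm_num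
    · simp only [h, abs_mul, abs_inv, abs_of_pos hA]
      rw [inv_mul_le_iff₀ hA, mul_one]
      exact vnorm_bd hA (hc T hT) (hz0 k)
  · intro ξ hξ u hu N
    rcases hpt ξ hξ with h | ⟨T, hT, z, hz, hz0, h⟩
    · simp only [h, mul_zero, sub_self, abs_zero, Real.zero_rpow hr.ne', Finset.sum_const_zero]; norm_num
    · have e : ∀ j, |A⁻¹ * mS S c (u (j+1)) ξ - A⁻¹ * mS S c (u j) ξ| ^ r =
          (A ^ r)⁻¹ * |FT S c T (z (u (j+1))) - FT S c T (z (u j))| ^ r := by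
        intro j
        rw [h, h, ← mul_sub, abs_mul, Real.mul_rpow (abs_nonneg _) (abs_nonneg _), abs_inv, abs_of_pos hA,
          Real.inv_rpow hA.le]
      simp only [e]
      rw [← Finset.mul_sum, inv_mul_le_iff₀ (by positivity), mul_one]
      exact vnorm_var hr hA (hc T hT) (fun j => z (u j)) (fun i j hij => hz (hu hij)) (fun j => hz0 _) N

end SMM

/-- Lemma 7.1: for `1 < q ≤ 2`, `2 < r < 2q`, `ε > 0` and a stack of trees (td-maximal
`u`-overlapping, or properly-sorted `l`-overlapping) whose time intervals contain `x`,
`‖Σ_{P ∈ Ps, |I_P| < 2^k} c_P 1_{ω_{P_u}}‖_{M^{q,*}}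
  ≤ C_{q,r,ε} |Ts|^{1/q - 1/r + ε} sup_{T ∈ Ts} ‖Σ_{P ∈ T} c_P 1_{ω_{P_u}}‖_{V^r}`. -/
theorem stack_maximal_multiplier (q r eps : ℝ) (hq1 : 1 < q) (hq2 : q ≤ 2)
    (hr1 : 2 < r) (hr2 : r < 2 * q) (heps : 0 < eps) :
    ∃ C : ℝ, 0 < C ∧
    ∀ x : ℝ, 0 ≤ x → ∀ Ps : Set Bitile, Ps.Finite → (∀ P ∈ Ps, x ∈ P.I) →
    ∀ Ts : Set WTree, Ts.Finite → Ps = (⋃ T ∈ Ts, T.carrier) →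
    ((∀ T ∈ Ts, IsTree T ∧ UOverlapping T ∧
        TdMaximalAmong T {T' | IsTree T' ∧ T'.carrier ⊆ Ps}) ∨
      ProperlySorted Ts) →
    ∀ c : Bitile → ℝ,
      Mqstar q (fun k ξ =>
          ∑ᶠ (P : Bitile) (_ : P ∈ Ps ∧ volume P.I < 2 ^ k),
            c P * Set.indicator (upperHalf P.ω) (fun _ => (1 : ℝ)) ξ) ≤
        ENNReal.ofReal C * (Ts.ncard : ℝ≥0∞) ^ (1 / q - 1 / r + eps) *
          ⨆ T ∈ Ts, vnorm r (Set.Ici 0) (fun ξ =>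
            ∑ᶠ P ∈ T.carrier, c P * Set.indicator (upperHalf P.ω) (fun _ => (1 : ℝ)) ξ) := by
  obtain ⟨C, hC, hfm⟩ := SMM.finite_model q r eps hq1 hq2 hr1 heps
  have hq0 : 0 < q := by linarith
  have hr0 : 0 < r := by linarith
  have he : 0 < 1 / q - 1 / r + eps := by
    have : 1 / r < 1 / q := one_div_lt_one_div_of_lt hq0 (by linarith)
    linarith
  set e : ℝ := 1 / q - 1 / r + eps with he_def
  refine ⟨C * 2 ^ e, by positivity, ?_⟩
  intro x hx Ps hPs hxI Ts hTs hcovPs hcase c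
  obtain ⟨S, rfl⟩ := hPs.exists_finset_coe
  have hcov : ∀ P ∈ S, ∃ T ∈ Ts, P ∈ T.carrier := by
    intro P hP
    have h1 : P ∈ (S : Set Bitile) := hP
    rw [hcovPs] at h1
    simpa using h1
  have hsub : ∀ T ∈ Ts, ∀ P ∈ T.carrier, P ∈ S := by
    intro T hT P hP
    have h1 : P ∈ (S : Set Bitile) := by
      rw [hcovPs]; exact Set.mem_biUnion hT hP
    exact h1
  have htree : ∀ T ∈ Ts, IsTree T := by
    rcases hcase with h | h
    · exact fun T hT => (h T hT).1
    · exact fun T hT => (h.1 T hT).1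
  have hpt : SMM.PtStr S Ts := by
    rcases hcase with h | h
    · exact SMM.ptstr_u hxI hcov h
    · exact SMM.ptstr_l hxI hcov h
  have hm : (fun (k : ℤ) (ξ : ℝ) => ∑ᶠ (P : Bitile) (_ : P ∈ (S : Set Bitile) ∧ volume P.I < 2 ^ k),
      c P * Set.indicator (upperHalf P.ω) (fun _ => (1 : ℝ)) ξ) = SMM.mS S c := by
    funext k ξ
    rw [SMM.finsum_ind S c (fun P => P ∈ (S : Set Bitile) ∧ volume P.I < 2 ^ k) (fun P h => h.1) ξ]
    unfold SMM.mS
    refine Finset.sum_congr ?_ fun _ _ => rfl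
    ext P
    simp only [Finset.mem_filter, Finset.mem_coe, SMM.vol_lt]
    tauto
  have hF : ∀ T ∈ Ts, (fun ξ => ∑ᶠ P ∈ T.carrier,
      c P * Set.indicator (upperHalf P.ω) (fun _ => (1 : ℝ)) ξ) = SMM.FT S c T := by
    intro T hT
    funext ξ
    exact SMM.finsum_ind S c (fun P => P ∈ T.carrier) (hsub T hT) ξ
  rw [hm]
  have hsup : (⨆ T ∈ Ts, vnorm r (Set.Ici 0) (fun ξ =>
      ∑ᶠ P ∈ T.carrier, c P * Set.indicator (upperHalf P.ω) (fun _ => (1 : ℝ)) ξ)) =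
      ⨆ T ∈ Ts, vnorm r (Set.Ici 0) (SMM.FT S c T) :=
    iSup_congr fun T => iSup_congr fun hT => by rw [hF T hT]
  rw [hsup]
  set V : ℝ≥0∞ := ⨆ T ∈ Ts, vnorm r (Set.Ici 0) (SMM.FT S c T) with hV
  by_cases hN : Ts.ncard = 0
  · have hTe : Ts = ∅ := (Set.ncard_eq_zero hTs).1 hN
    have hSe : ∀ k ξ, SMM.mS S c k ξ = 0 := by
      intro k ξ
      refine SMM.empty_case (fun P hP => ?_) c k
      obtain ⟨T, hT, -⟩ := hcov P hP
      rw [hTe] at hT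
      exact absurd hT (Set.notMem_empty T)
    have h0 : Mqstar q (SMM.mS S c) = 0 := by
      unfold Mqstar lpNormE walshFT
      simp [hSe, hq0]
    rw [h0]
    exact zero_le
  have hN1 : 1 ≤ Ts.ncard := Nat.one_le_iff_ne_zero.2 hN
  have hNr : (0:ℝ) < (Ts.ncard : ℝ) := by exact_mod_cast hN1
  have hBe : ENNReal.ofReal (C * 2 ^ e) * (Ts.ncard : ℝ≥0∞) ^ e =
      ENNReal.ofReal (C * 2 ^ e * (Ts.ncard : ℝ) ^ e) := by
    rw [ENNReal.ofReal_mul (show 0 ≤ C * 2 ^ e by positivity), ← ENNReal.ofReal_rpow_of_pos hNr, ENNReal.ofReal_natCast]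
  rw [hBe]
  set B : ℝ := C * 2 ^ e * (Ts.ncard : ℝ) ^ e with hB
  have hB0 : 0 < B := by positivity
  have key : ∀ A : ℝ, 0 < A → V ≤ ENNReal.ofReal A →
      Mqstar q (SMM.mS S c) ≤ ENNReal.ofReal B * ENNReal.ofReal A := by
    intro A hA hVA
    have hl : Ts.ncard ≤ 2 ^ Nat.clog 2 Ts.ncard := Nat.le_pow_clog (by norm_num) _
    have hl2 : (2:ℕ) ^ Nat.clog 2 Ts.ncard ≤ 2 * Ts.ncard := by
      rcases hN1.eq_or_lt with h1 | h1
      · rw [← h1]; simp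
      · have h2 := Nat.pow_pred_clog_lt_self (b := 2) (by norm_num) h1
        have h3 : 0 < Nat.clog 2 Ts.ncard := Nat.clog_pos (by norm_num) h1
        obtain ⟨n, hn⟩ : ∃ n, Nat.clog 2 Ts.ncard = n + 1 := ⟨_, (Nat.succ_pred_eq_of_pos h3).symm⟩
        rw [hn] at h2 ⊢
        simp only [Nat.pred_succ] at h2
        rw [pow_succ]; omega
    obtain ⟨M, L0, X, H⟩ := SMM.build_rsys hr0 hA hTs hcov htree hpt (fun T hT => (htree T hT).2.1) c
      (fun T hT => (le_iSup₂ (f := fun T (_ : T ∈ Ts) => vnorm r (Set.Ici 0) (SMM.FT S c T)) T hT).trans hVA)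
      (Nat.clog 2 Ts.ncard) hl
    have hb := SMM.rsys_bound hq1 H (K := C * ((2:ℝ) ^ Nat.clog 2 Ts.ncard) ^ e)
      (fun n Ξ m hS f τ hτ => hfm n _ Ξ m hS f τ hτ) (by positivity)
    have hKB : C * ((2:ℝ) ^ Nat.clog 2 Ts.ncard) ^ e ≤ B := by
      rw [hB, mul_assoc, ← Real.mul_rpow (by norm_num) hNr.le]
      gcongr
      exact_mod_cast hl2
    have hs := SMM.Mqstar_smul hq0 hA (fun k ξ => A⁻¹ * SMM.mS S c k ξ)
    have hee : (fun (k : ℤ) (ξ : ℝ) => A * (A⁻¹ * SMM.mS S c k ξ)) = SMM.mS S c := by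
      funext k ξ
      rw [mul_inv_cancel_left₀ hA.ne']
    rw [hee] at hs
    refine hs.trans ?_
    rw [mul_comm]
    exact mul_le_mul' (hb.trans (ENNReal.ofReal_le_ofReal hKB)) le_rfl
  by_cases hVt : V = ⊤
  · rw [hVt, ENNReal.mul_top (by simpa using hB0)]
    exact le_top
  · have hVr : V = ENNReal.ofReal V.toReal := (ENNReal.ofReal_toReal hVt).symm
    rw [hVr, ← ENNReal.ofReal_mul hB0.le]
    refine ENNReal.le_of_forall_pos_le_add fun δ hδ _ => ?_
    have hδ' : (0:ℝ) < δ := hδ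
    have hA : 0 < V.toReal + δ / B := by positivity
    have hVA : V ≤ ENNReal.ofReal (V.toReal + δ / B) := by
      conv_lhs => rw [hVr]
      apply ENNReal.ofReal_le_ofReal
      have : 0 < (δ:ℝ) / B := by positivity
      linarith
    refine (key _ hA hVA).trans_eq ?_
    rw [← ENNReal.ofReal_mul hB0.le, mul_add, mul_div_cancel₀ _ hB0.ne',
      ENNReal.ofReal_add (by positivity) hδ'.le, ENNReal.ofReal_coe_nnreal]

end
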